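/- Kato–Ponce inequality in Gevrey classes (Lemma 2.6): Let d ≥ 1, β ≥ 0, and let 1 < p, p₁, q₁, p₂, q₂ < ∞ satisfy 1/p = 1/p₁ + 1/q₁ = 1/p₂ + 1/q₂. Then there exists a constant C, depending only on d, β and the exponents but NOT on a, such that for every a ≥ 0 and all Schwartz functions f, g on ℝ^d whose Fourier transforms are compactly supported: ‖G_{a,β}(fg)‖_{L^p} ≤ C (‖G_{a,β} f‖_{L^{p₁}} ‖G_{a,0} g‖_{L^{q₁}} + ‖G_{a,0} f‖_{L^{p₂}} ‖G_{a,β} g‖_{L^{q₂}}). -/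

import Mathlib

open MeasureTheory SchwartzMap
open scoped ENNReal FourierTransform RealInnerProductSpace

/-- `G_{a,β} h (x) = ∫ e^{2πi⟨x,ξ⟩} e^{a‖ξ‖₁} ‖ξ‖^β 𝓕h(ξ) dξ`, where
`‖ξ‖₁ = ∑ᵢ |ξᵢ|` and `𝓕h(ξ) = ∫ e^{−2πi⟨x,ξ⟩} h(x) dx`. -/
noncomputable def gev (d : ℕ) (a β : ℝ) (h : EuclideanSpace ℝ (Fin d) → ℂ) :
    EuclideanSpace ℝ (Fin d) → ℂ :=
  fun x => ∫ ξ : EuclideanSpace ℝ (Fin d),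
    Complex.exp (((2 * Real.pi * ⟪x, ξ⟫) : ℝ) * Complex.I) *
      ((Real.exp (a * ∑ i, |ξ i|) * ‖ξ‖ ^ β : ℝ) : ℂ) * 𝓕 h ξ

namespace GevreyKatoPonce

open Set Filter Topology

set_option linter.unusedSectionVars false

/-! ### Lebesgue norms indexed by the reciprocal exponent -/

section RecipNorm

variable {X : Type*} [MeasureSpace X]

/-- The `L^{1/θ}` norm of an `ℝ≥0∞`-valued function. -/
noncomputable def recipNorm (θ : ℝ) (H : X → ℝ≥0∞) : ℝ≥0∞ :=
  (∫⁻ x, H x ^ (1 / θ)) ^ θ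

lemma recipNorm_mono {θ : ℝ} (hθ : 0 < θ) {H K : X → ℝ≥0∞} (h : ∀ x, H x ≤ K x) :
    recipNorm θ H ≤ recipNorm θ K := by
  unfold recipNorm
  gcongr with x
  exact h x

lemma recipNorm_const_mul {θ : ℝ} (hθ : 0 < θ) (c : ℝ≥0∞) (hc : c ≠ ∞) (H : X → ℝ≥0∞) :
    recipNorm θ (fun x => c * H x) = c * recipNorm θ H := by
  unfold recipNorm
  have h1 : (0:ℝ) ≤ 1 / θ := by positivity
  simp_rw [ENNReal.mul_rpow_of_nonneg _ _ h1]
  rw [lintegral_const_mul' _ _ (ENNReal.rpow_ne_top_of_nonneg h1 hc),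
    ENNReal.mul_rpow_of_nonneg _ _ hθ.le, ← ENNReal.rpow_mul, one_div_mul_cancel hθ.ne',
    ENNReal.rpow_one]

lemma recipNorm_rpow {θ c : ℝ} (hc : 0 < c) (H : X → ℝ≥0∞) :
    recipNorm θ (fun x => H x ^ c) = recipNorm (θ / c) H ^ c := by
  unfold recipNorm
  rw [← ENNReal.rpow_mul, div_mul_cancel₀ _ hc.ne']
  congr 2
  ext x
  rw [← ENNReal.rpow_mul]
  congr 1
  rw [one_div_div]; ring

lemma recipNorm_add_le {θ : ℝ} (hθ : 0 < θ) (hθ1 : θ ≤ 1) {H K : X → ℝ≥0∞}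
    (hH : AEMeasurable H) (hK : AEMeasurable K) :
    recipNorm θ (fun x => H x + K x) ≤ recipNorm θ H + recipNorm θ K := by
  have := ENNReal.lintegral_Lp_add_le hH hK (p := 1 / θ) (by rw [le_div_iff₀ hθ]; linarith)
  simpa [recipNorm] using this

lemma recipNorm_mul_le {θ₁ θ₂ : ℝ} (h₁ : 0 < θ₁) (h₂ : 0 < θ₂) {H K : X → ℝ≥0∞}
    (hH : AEMeasurable H) (hK : AEMeasurable K) :
    recipNorm (θ₁ + θ₂) (fun x => H x * K x) ≤ recipNorm θ₁ H * recipNorm θ₂ K := by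
  have := ENNReal.lintegral_Lp_mul_le_Lq_mul_Lr (p := 1 / (θ₁ + θ₂)) (q := 1 / θ₁) (r := 1 / θ₂)
    (by positivity) (one_div_lt_one_div_of_lt h₁ (by linarith)) (by simp) volume hH hK
  simpa [recipNorm] using this

lemma recipNorm_geom_le {θ₁ θ₂ t : ℝ} (h₁ : 0 < θ₁) (h₂ : 0 < θ₂) (ht : 0 < t) (ht1 : t < 1)
    {H K : X → ℝ≥0∞} (hH : AEMeasurable H) (hK : AEMeasurable K) :
    recipNorm ((1 - t) * θ₁ + t * θ₂) (fun x => H x ^ (1 - t) * K x ^ t) ≤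
      recipNorm θ₁ H ^ (1 - t) * recipNorm θ₂ K ^ t := by
  have h1t : 0 < 1 - t := by linarith
  refine (recipNorm_mul_le (by positivity) (by positivity) (hH.pow_const _) (hK.pow_const _)).trans
    (le_of_eq ?_)
  rw [recipNorm_rpow h1t, recipNorm_rpow ht, mul_div_cancel_left₀ _ h1t.ne',
    mul_div_cancel_left₀ _ ht.ne']

lemma eLpNorm_eq_recipNorm {E : Type*} [NormedAddCommGroup E] {p : ℝ≥0∞} (hp : 0 < p)
    (hp' : p < ⊤) (f : X → E) :
    eLpNorm f p volume = recipNorm (1 / p.toReal) (fun x => ‖f x‖ₑ) := by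
  rw [eLpNorm_eq_lintegral_rpow_enorm_toReal hp.ne' hp'.ne, recipNorm, one_div_one_div]

end RecipNorm

/-! ### Gaussian averages and the associated maximal function -/

section Maximal

variable {V : Type*} [NormedAddCommGroup V] [InnerProductSpace ℝ V] [FiniteDimensional ℝ V]
  [MeasurableSpace V] [BorelSpace V]

variable (V) in
/-- The Gaussian probability measure with density `e^{-π‖y‖²}`. -/
noncomputable def gauss : Measure V :=
  volume.withDensity fun y => ENNReal.ofReal (Real.exp (-Real.pi * ‖y‖ ^ 2))

lemma lintegral_gauss (f : V → ℝ≥0∞) :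
    ∫⁻ y, f y ∂(gauss V) = ∫⁻ y, ENNReal.ofReal (Real.exp (-Real.pi * ‖y‖ ^ 2)) * f y := by
  unfold gauss
  rw [lintegral_withDensity_eq_lintegral_mul_non_measurable _ (by fun_prop) (by simp)]
  rfl

lemma integral_gauss (f : V → ℂ) :
    ∫ y, f y ∂(gauss V) = ∫ y, (Real.exp (-Real.pi * ‖y‖ ^ 2) : ℂ) * f y := by
  unfold gauss
  rw [integral_withDensity_eq_integral_toReal_smul (by fun_prop) (by simp)]
  congr 1
  ext y
  rw [ENNReal.toReal_ofReal (by positivity), Complex.real_smul]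

lemma integral_gauss_cexp (v : V) :
    ∫ y, Complex.exp ((2 * Real.pi * ⟪y, v⟫ : ℝ) * Complex.I) ∂(gauss V) =
      (Real.exp (-Real.pi * ‖v‖ ^ 2) : ℂ) := by
  rw [integral_gauss]
  have := GaussianFourier.integral_cexp_neg_mul_sq_norm_add (V := V) (b := Real.pi)
    (by simpa using Real.pi_pos) (2 * Real.pi * Complex.I) v
  have h2 : (Real.pi / Real.pi : ℂ) ^ (Module.finrank ℝ V / 2 : ℂ) = 1 := by
    rw [div_self (by exact_mod_cast Real.pi_ne_zero), Complex.one_cpow]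
  rw [h2, one_mul] at this
  convert this using 2
  · ext y
    push_cast
    rw [← Complex.exp_add, real_inner_comm]
    congr 1
    ring
  · push_cast
    congr 1
    have : (Real.pi : ℂ) ≠ 0 := by exact_mod_cast Real.pi_ne_zero
    field_simp
    rw [Complex.I_sq]; ring

instance : IsProbabilityMeasure (gauss V) := by
  constructor
  have h1 : IsFiniteMeasure (gauss V) := by
    unfold gauss
    refine isFiniteMeasure_withDensity_ofReal ?_
    have := (GaussianFourier.integrable_cexp_neg_mul_sq_norm_add (V := V) (b := Real.pi)
      (by simpa using Real.pi_pos) 0 0).re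
    refine HasFiniteIntegral.congr this.2 ?_
    filter_upwards with y
    simp only [zero_mul, add_zero, RCLike.re_to_complex]
    norm_cast
  have := integral_gauss_cexp (0 : V)
  simp only [inner_zero_right, mul_zero, Complex.ofReal_zero, zero_mul, Complex.exp_zero,
    integral_const, norm_zero] at this
  simp only [ne_eq, OfNat.ofNat_ne_zero, not_false_eq_true, zero_pow, mul_zero,
    Real.exp_zero, Complex.real_smul, mul_one] at this
  have h3 : (gauss V).real univ = 1 := by exact_mod_cast this
  rw [measureReal_def, ENNReal.toReal_eq_one_iff] at h3
  exact h3

/-- Average of `H` over Gaussian of width `ρ` centred at `x`. -/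
noncomputable def gaussAvg (H : V → ℝ≥0∞) (ρ : ℝ) (x : V) : ℝ≥0∞ :=
  ∫⁻ y, H (x + ρ • y) ∂(gauss V)

/-- Maximal function of Gaussian averages. -/
noncomputable def gaussMax (H : V → ℝ≥0∞) (x : V) : ℝ≥0∞ := ⨆ ρ : ℝ, gaussAvg H ρ x

lemma gaussAvg_le_gaussMax (H : V → ℝ≥0∞) (ρ : ℝ) (x : V) : gaussAvg H ρ x ≤ gaussMax H x :=
  le_iSup (fun ρ => gaussAvg H ρ x) ρ

lemma le_gaussMax (H : V → ℝ≥0∞) (x : V) : H x ≤ gaussMax H x := by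
  refine le_trans (le_of_eq ?_) (gaussAvg_le_gaussMax H 0 x)
  simp [gaussAvg]

lemma gaussMax_mono {H K : V → ℝ≥0∞} (h : ∀ x, H x ≤ K x) (x : V) :
    gaussMax H x ≤ gaussMax K x :=
  iSup_mono fun _ => lintegral_mono fun _ => h _

lemma gaussMax_const_mul (c : ℝ≥0∞) (hc : c ≠ ∞) (H : V → ℝ≥0∞) (x : V) :
    gaussMax (fun x => c * H x) x = c * gaussMax H x := by
  simp [gaussMax, gaussAvg, lintegral_const_mul' _ _ hc, ENNReal.mul_iSup]

lemma lowerSemicontinuous_gaussAvg {H : V → ℝ≥0∞} (hH : LowerSemicontinuous H) (ρ : ℝ) :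
    LowerSemicontinuous (gaussAvg H ρ) := by
  intro x a ha
  by_contra hcon
  obtain ⟨s, hs, hsa⟩ := exists_seq_forall_of_frequently (not_eventually.1 hcon)
  refine absurd ha (not_lt.2 ?_)
  calc gaussAvg H ρ x ≤ ∫⁻ y, liminf (fun n => H (s n + ρ • y)) atTop ∂(gauss V) := by
        refine lintegral_mono fun y => ?_
        have hc : Tendsto (fun n => s n + ρ • y) atTop (𝓝 (x + ρ • y)) := hs.add_const _
        refine ((lowerSemicontinuous_iff_le_liminf.1 hH) _).trans ?_
        exact liminf_le_liminf_of_le hc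
    _ ≤ liminf (fun n => gaussAvg H ρ (s n)) atTop :=
        lintegral_liminf_le fun n => hH.measurable.comp (by fun_prop)
    _ ≤ a := by
        refine (liminf_le_liminf (v := fun _ => a) (Eventually.of_forall fun n => ?_)).trans
          (liminf_const a).le
        exact not_lt.1 (hsa n)

lemma lowerSemicontinuous_gaussMax {H : V → ℝ≥0∞} (hH : LowerSemicontinuous H) :
    LowerSemicontinuous (gaussMax H) :=
  lowerSemicontinuous_iSup fun ρ => lowerSemicontinuous_gaussAvg hH ρ

lemma lowerSemicontinuous_iterate_gaussMax {H : V → ℝ≥0∞} (hH : LowerSemicontinuous H) (n : ℕ) :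
    LowerSemicontinuous (gaussMax^[n] H) := by
  induction n with
  | zero => exact hH
  | succ n ih => rw [Function.iterate_succ_apply']; exact lowerSemicontinuous_gaussMax ih

lemma lintegral_comp_add_smul {f : V → ℝ≥0∞} (hf : Measurable f) (x : V) {ρ : ℝ} (hρ : ρ ≠ 0) :
    ∫⁻ y, f (x + ρ • y) =
      ENNReal.ofReal |(ρ ^ Module.finrank ℝ V)⁻¹| * ∫⁻ y, f y := by
  have h1 : ∫⁻ y, f (x + ρ • y) = ∫⁻ y, f (x + y) ∂(Measure.map (ρ • ·) (volume : Measure V)) := by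
    rw [lintegral_map (by fun_prop) (by fun_prop)]
  rw [h1, Measure.map_addHaar_smul _ hρ, lintegral_smul_measure, smul_eq_mul,
    lintegral_add_left_eq_self f x]

lemma lintegral_gauss_eq_ball {f : V → ℝ≥0∞} (hf : Measurable f) :
    ∫⁻ y, f y ∂(gauss V) = ∫⁻ r in Ioi (0 : ℝ),
      ENNReal.ofReal (2 * Real.pi * r * Real.exp (-Real.pi * r ^ 2)) *
        ∫⁻ y in Metric.ball 0 r, f y := by
  have key : ∀ s : ℝ, 0 ≤ s → ENNReal.ofReal (Real.exp (-Real.pi * s ^ 2)) =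
      ∫⁻ r in Ioi s, ENNReal.ofReal (2 * Real.pi * r * Real.exp (-Real.pi * r ^ 2)) := by
    intro s hs
    have hd : ∀ r ∈ Ici s, HasDerivAt (fun r : ℝ => -Real.exp (-Real.pi * r ^ 2))
        (2 * Real.pi * r * Real.exp (-Real.pi * r ^ 2)) r := by
      intro r _
      have := (((hasDerivAt_pow 2 r).const_mul (-Real.pi)).exp).neg
      refine this.congr_deriv ?_
      push_cast
      ring
    have hnn : ∀ r ∈ Ioi s, 0 ≤ 2 * Real.pi * r * Real.exp (-Real.pi * r ^ 2) := by
      intro r hr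
      have : 0 < r := lt_of_le_of_lt hs hr
      positivity
    have hlim : Tendsto (fun r : ℝ => -Real.exp (-Real.pi * r ^ 2)) atTop (𝓝 0) := by
      rw [← neg_zero]
      refine Tendsto.neg (Real.tendsto_exp_atBot.comp ?_)
      exact (tendsto_pow_atTop two_ne_zero).const_mul_atTop_of_neg (by linarith [Real.pi_pos])
    have hi := integrableOn_Ioi_deriv_of_nonneg' hd hnn hlim
    rw [← ofReal_integral_eq_lintegral_ofReal hi
      ((ae_restrict_iff' measurableSet_Ioi).2 (Eventually.of_forall hnn)),
      integral_Ioi_of_hasDerivAt_of_tendsto' hd hi hlim]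
    simp
  rw [lintegral_gauss]
  have h1 : ∀ y : V, ENNReal.ofReal (Real.exp (-Real.pi * ‖y‖ ^ 2)) * f y =
      ∫⁻ r in Ioi (0:ℝ), ENNReal.ofReal (2 * Real.pi * r * Real.exp (-Real.pi * r ^ 2)) *
        (Metric.ball (0:V) r).indicator f y := by
    intro y
    rw [key _ (norm_nonneg y), ← lintegral_mul_const _ (by fun_prop)]
    rw [← lintegral_indicator measurableSet_Ioi, ← lintegral_indicator measurableSet_Ioi]
    congr 1
    ext r
    by_cases hr : ‖y‖ < r
    · have : 0 < r := (norm_nonneg y).trans_lt hr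
      simp [indicator, hr, this]
    · simp [indicator, hr]
  simp_rw [h1]
  rw [lintegral_lintegral_swap]
  · refine lintegral_congr fun r => ?_
    rw [lintegral_const_mul _ (hf.indicator Metric.isOpen_ball.measurableSet),
      lintegral_indicator Metric.isOpen_ball.measurableSet]
  · have hms : MeasurableSet {p : V × ℝ | ‖p.1‖ < p.2} :=
      measurableSet_lt (by fun_prop) (by fun_prop)
    have : (Function.uncurry fun (y : V) (r : ℝ) =>
        ENNReal.ofReal (2 * Real.pi * r * Real.exp (-Real.pi * r ^ 2)) *
        (Metric.ball (0:V) r).indicator f y) = fun p : V × ℝ =>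
        ENNReal.ofReal (2 * Real.pi * p.2 * Real.exp (-Real.pi * p.2 ^ 2)) *
          {p : V × ℝ | ‖p.1‖ < p.2}.indicator (fun p => f p.1) p := by
      ext p
      simp [indicator, Function.uncurry]
    rw [this]
    exact (Measurable.mul (by fun_prop) ((hf.comp measurable_fst).indicator hms)).aemeasurable

/-- The centred Hardy–Littlewood maximal function. -/
noncomputable def ballMax (H : V → ℝ≥0∞) (x : V) : ℝ≥0∞ :=
  ⨆ r : ℝ, ⨆ _ : 0 < r, (volume (Metric.ball x r))⁻¹ * ∫⁻ y in Metric.ball x r, H y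

lemma setLIntegral_ball_le_ballMax (H : V → ℝ≥0∞) (x : V) {r : ℝ} (hr : 0 < r) :
    ∫⁻ y in Metric.ball x r, H y ≤ volume (Metric.ball x r) * ballMax H x := by
  have h := le_iSup₂ (f := fun (r : ℝ) (_ : 0 < r) =>
    (volume (Metric.ball x r))⁻¹ * ∫⁻ y in Metric.ball x r, H y) r hr
  calc _ = volume (Metric.ball x r) *
        ((volume (Metric.ball x r))⁻¹ * ∫⁻ y in Metric.ball x r, H y) := by
        rw [← mul_assoc, ENNReal.mul_inv_cancel (Metric.measure_ball_pos _ _ hr).ne'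
          measure_ball_lt_top.ne, one_mul]
    _ ≤ _ := by gcongr; exact h

lemma gaussAvg_le_ballMax {H : V → ℝ≥0∞} (hH : Measurable H) {ρ : ℝ} (hρ : ρ ≠ 0) (x : V) :
    gaussAvg H ρ x ≤ ballMax H x := by
  have hball : ∀ r : ℝ, 0 < r → ∫⁻ y in Metric.ball (0:V) r, H (x + ρ • y) ≤
      volume (Metric.ball (0:V) r) * ballMax H x := by
    intro r hr
    have hρr : 0 < |ρ| * r := by positivity
    have e : ∀ K : V → ℝ≥0∞, Measurable K → ∫⁻ y in Metric.ball (0:V) r, K (x + ρ • y) =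
        ENNReal.ofReal |(ρ ^ Module.finrank ℝ V)⁻¹| * ∫⁻ y in Metric.ball x (|ρ| * r), K y := by
      intro K hK
      rw [← lintegral_indicator Metric.isOpen_ball.measurableSet,
        ← lintegral_indicator Metric.isOpen_ball.measurableSet,
        ← lintegral_comp_add_smul (hK.indicator Metric.isOpen_ball.measurableSet) x hρ]
      congr 1
      ext y
      have : |ρ| * ‖y‖ < |ρ| * r ↔ ‖y‖ < r := mul_lt_mul_iff_right₀ (abs_pos.2 hρ)
      simp [indicator, norm_smul, this]
    rw [e H hH]
    have e1 := e (fun _ => 1) measurable_const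
    simp only [setLIntegral_const, one_mul] at e1
    rw [e1, mul_assoc]
    gcongr
    exact setLIntegral_ball_le_ballMax H x hρr
  calc gaussAvg H ρ x ≤ ∫⁻ r in Ioi (0 : ℝ),
      ENNReal.ofReal (2 * Real.pi * r * Real.exp (-Real.pi * r ^ 2)) *
        (∫⁻ y in Metric.ball (0:V) r, 1) * ballMax H x := by
        rw [gaussAvg, lintegral_gauss_eq_ball (f := fun y => H (x + ρ • y)) (by fun_prop)]
        refine setLIntegral_mono' measurableSet_Ioi fun r hr => ?_
        have h := hball r hr
        rw [← setLIntegral_one] at h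
        exact (mul_le_mul' le_rfl h).trans_eq (mul_assoc _ _ _).symm
    _ = (∫⁻ _ : V, 1 ∂(gauss V)) * ballMax H x := by
        rw [lintegral_gauss_eq_ball measurable_const, lintegral_mul_const'']
        have : Measurable fun r : ℝ => (∫⁻ _ in Metric.ball (0:V) r, (1:ℝ≥0∞)) := by
          simp only [setLIntegral_const, one_mul]
          refine Monotone.measurable fun r s h => measure_mono (Metric.ball_subset_ball h)
        exact (Measurable.mul (by fun_prop) this).aemeasurable
    _ = ballMax H x := by simp

lemma le_ballMax {H : V → ℝ≥0∞} (hH : LowerSemicontinuous H) (x : V) : H x ≤ ballMax H x := by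
  refine le_of_forall_lt fun a ha => ?_
  obtain ⟨b, hab, hb⟩ := exists_between ha
  obtain ⟨r, hr, hrb⟩ := Metric.eventually_nhds_iff_ball.1 (hH x b hb)
  refine hab.trans_le ?_
  have h2 : volume (Metric.ball x r) * b ≤ volume (Metric.ball x r) * ballMax H x := by
    refine le_trans ?_ (setLIntegral_ball_le_ballMax H x hr)
    rw [mul_comm, ← setLIntegral_const]
    exact setLIntegral_mono' Metric.isOpen_ball.measurableSet fun y hy => (hrb y hy).le
  rwa [ENNReal.mul_le_mul_iff_right (Metric.measure_ball_pos _ _ hr).ne'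
    measure_ball_lt_top.ne] at h2

lemma gaussMax_le_ballMax {H : V → ℝ≥0∞} (hH : LowerSemicontinuous H) (x : V) :
    gaussMax H x ≤ ballMax H x := by
  refine iSup_le fun ρ => ?_
  by_cases hρ : ρ = 0
  · subst hρ
    simpa [gaussAvg] using le_ballMax hH x
  · exact gaussAvg_le_ballMax hH.measurable hρ x

lemma measure_ballMax_gt_le (H : V → ℝ≥0∞) (a : ℝ≥0∞) :
    a * volume {x | a < ballMax H x} ≤ 4 ^ Module.finrank ℝ V * ∫⁻ y, H y := by
  let S : ℕ → Set V := fun n => {x | ∃ r : ℝ, 0 < r ∧ r ≤ n ∧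
    a * volume (Metric.ball x r) < ∫⁻ y in Metric.ball x r, H y}
  have hmono : Monotone S := by
    intro m n hmn x ⟨r, h0, h1, h2⟩
    exact ⟨r, h0, h1.trans (by exact_mod_cast hmn), h2⟩
  have hsub : {x | a < ballMax H x} ⊆ ⋃ n, S n := by
    intro x hx
    simp only [ballMax, mem_ofPred_eq, lt_iSup_iff] at hx
    obtain ⟨r, hr, h⟩ := hx
    obtain ⟨n, hn⟩ := exists_nat_ge r
    refine mem_iUnion.2 ⟨n, r, hr, hn, ?_⟩
    rw [mul_comm, ← div_eq_mul_inv] at h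
    exact (ENNReal.lt_div_iff_mul_lt (Or.inl (Metric.measure_ball_pos _ _ hr).ne')
      (Or.inl measure_ball_lt_top.ne)).1 h
  have hS : ∀ n, a * volume (S n) ≤ 4 ^ Module.finrank ℝ V * ∫⁻ y, H y := by
    intro n
    choose! r h0 h1 h2 using fun x (hx : x ∈ S n) => hx
    obtain ⟨t, htS, hdisj, hcov⟩ := Vitali.exists_disjoint_subfamily_covering_enlargement_ball
      (S n) id r n h1 4 (by norm_num)
    replace hdisj : t.PairwiseDisjoint fun a => Metric.ball a (r a) := hdisj
    have htc : t.Countable := hdisj.countable_of_isOpen (fun _ _ => Metric.isOpen_ball)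
      fun x hx => ⟨x, Metric.mem_ball_self (h0 x (htS hx))⟩
    have hcov' : S n ⊆ ⋃ x ∈ t, Metric.ball x (4 * r x) := by
      intro x hx
      obtain ⟨y, hy, h⟩ := hcov x hx
      exact mem_iUnion₂.2 ⟨y, hy, h (Metric.mem_ball_self (h0 x hx))⟩
    calc a * volume (S n) ≤ a * ∑' x : t, volume (Metric.ball (x:V) (4 * r x)) := by
          gcongr
          exact (measure_mono hcov').trans (measure_biUnion_le _ htc _)
      _ = 4 ^ Module.finrank ℝ V * ∑' x : t, a * volume (Metric.ball (x:V) (r x)) := by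
          rw [← ENNReal.tsum_mul_left, ← ENNReal.tsum_mul_left]
          congr 1
          ext x
          rw [Measure.addHaar_ball_mul_of_pos volume _ (by norm_num),
            ENNReal.ofReal_pow (by norm_num)]
          rw [Measure.addHaar_ball_center volume (x:V)]
          norm_num
          ring
      _ ≤ 4 ^ Module.finrank ℝ V * ∑' x : t, ∫⁻ y in Metric.ball (x:V) (r x), H y := by
          gcongr with x
          exact (h2 x (htS x.2)).le
      _ = 4 ^ Module.finrank ℝ V * ∫⁻ y in ⋃ x ∈ t, Metric.ball (x:V) (r x), H y := by
          rw [lintegral_biUnion htc (fun _ _ => Metric.isOpen_ball.measurableSet) hdisj]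
      _ ≤ _ := mul_le_mul' le_rfl (setLIntegral_le_lintegral _ _)
  calc a * volume {x | a < ballMax H x} ≤ a * volume (⋃ n, S n) := by gcongr
    _ = ⨆ n, a * volume (S n) := by rw [hmono.measure_iUnion, ENNReal.mul_iSup]
    _ ≤ _ := iSup_le hS

lemma setLIntegral_rpow_Iio {q : ℝ} (hq : 0 < q) (T : ℝ) (hT : 0 ≤ T) :
    ∫⁻ a in Ioi (0:ℝ), ENNReal.ofReal (q * a ^ (q - 1)) *
      (Iio (ENNReal.ofReal T)).indicator 1 (ENNReal.ofReal a) = ENNReal.ofReal T ^ q := by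
  have h1 : ∫⁻ a in Ioi (0:ℝ), ENNReal.ofReal (q * a ^ (q - 1)) *
      (Iio (ENNReal.ofReal T)).indicator 1 (ENNReal.ofReal a) =
      ∫⁻ a in Ioo 0 T, ENNReal.ofReal (q * a ^ (q - 1)) := by
    rw [← lintegral_indicator measurableSet_Ioi, ← lintegral_indicator measurableSet_Ioo]
    congr 1
    ext a
    by_cases ha : 0 < a
    · by_cases haT : a < T
      · simp [indicator, ha, haT, ENNReal.ofReal_lt_ofReal_iff (ha.trans haT)]
      · have : ¬ ENNReal.ofReal a < ENNReal.ofReal T :=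
          not_lt.2 (ENNReal.ofReal_le_ofReal (not_lt.1 haT))
        simp [indicator, haT, this]
    · simp [indicator, ha]
  have hi : IntervalIntegrable (fun a : ℝ => q * a ^ (q - 1)) volume 0 T :=
    (intervalIntegral.intervalIntegrable_rpow' (by linarith)).const_mul _
  rw [h1, ← Measure.restrict_congr_set Ioo_ae_eq_Ioc.symm, ← ofReal_integral_eq_lintegral_ofReal,
    ← intervalIntegral.integral_of_le hT, intervalIntegral.integral_const_mul,
    integral_rpow (Or.inl (by linarith)), ENNReal.ofReal_rpow_of_nonneg hT hq.le]
  · rw [sub_add_cancel, Real.zero_rpow hq.ne', sub_zero, mul_div_cancel₀ _ hq.ne']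
  · exact (intervalIntegrable_iff_integrableOn_Ioc_of_le hT).1 hi
  · refine (ae_restrict_iff' measurableSet_Ioc).2 (Eventually.of_forall fun a ha => ?_)
    have := ha.1
    show 0 ≤ q * a ^ (q - 1)
    positivity

lemma rpow_le_setLIntegral {q : ℝ} (hq : 0 < q) (F : ℝ≥0∞) :
    F ^ q ≤ ∫⁻ a in Ioi (0:ℝ), ENNReal.ofReal (q * a ^ (q - 1)) *
      (Iio F).indicator 1 (ENNReal.ofReal a) := by
  by_cases hF : F = ∞
  · subst hF
    have h : ∀ n : ℕ, (n : ℝ≥0∞) ^ q ≤ ∫⁻ a in Ioi (0:ℝ), ENNReal.ofReal (q * a ^ (q - 1)) *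
        (Iio ∞).indicator 1 (ENNReal.ofReal a) := by
      intro n
      have := setLIntegral_rpow_Iio hq n n.cast_nonneg
      rw [ENNReal.ofReal_natCast] at this
      rw [← this]
      refine lintegral_mono fun a => ?_
      gcongr
      by_cases h : ENNReal.ofReal a < n <;> simp
    have ht : Tendsto (fun n : ℕ => (n : ℝ≥0∞) ^ q) atTop (𝓝 (∞ ^ q)) :=
      (ENNReal.continuous_rpow_const.tendsto _).comp ENNReal.tendsto_nat_nhds_top
    exact le_of_tendsto' ht h
  · rw [← ENNReal.ofReal_toReal hF]
    exact (setLIntegral_rpow_Iio hq _ ENNReal.toReal_nonneg).ge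

lemma ballMax_le_add (H : V → ℝ≥0∞) (c : ℝ≥0∞) (x : V) :
    ballMax H x ≤ ballMax ((H ⁻¹' Ioi c).indicator H) x + c := by
  refine iSup₂_le fun r hr => ?_
  have hv := (Metric.measure_ball_pos volume x hr).ne'
  have hv' : volume (Metric.ball x r) ≠ ∞ := measure_ball_lt_top.ne
  have h1 : ∫⁻ y in Metric.ball x r, H y ≤
      (∫⁻ y in Metric.ball x r, (H ⁻¹' Ioi c).indicator H y) + volume (Metric.ball x r) * c := by
    rw [mul_comm, ← setLIntegral_const, ← lintegral_add_right _ measurable_const]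
    refine lintegral_mono fun y => ?_
    by_cases h : c < H y
    · simp [indicator, h]
    · simp [indicator, h, not_lt.1 h]
  calc _ ≤ (volume (Metric.ball x r))⁻¹ * ((∫⁻ y in Metric.ball x r,
        (H ⁻¹' Ioi c).indicator H y) + volume (Metric.ball x r) * c) := by gcongr
    _ = (volume (Metric.ball x r))⁻¹ * (∫⁻ y in Metric.ball x r,
        (H ⁻¹' Ioi c).indicator H y) + c := by
        rw [mul_add, ← mul_assoc, ENNReal.inv_mul_cancel hv hv', one_mul]
    _ ≤ _ := by
        gcongr
        exact le_iSup₂ (f := fun (r : ℝ) (_ : 0 < r) => (volume (Metric.ball x r))⁻¹ *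
          ∫⁻ y in Metric.ball x r, (H ⁻¹' Ioi c).indicator H y) r hr

lemma lintegral_gaussMax_rpow_le {q : ℝ} (hq : 1 < q) {H : V → ℝ≥0∞}
    (hH : LowerSemicontinuous H) :
    ∫⁻ x, gaussMax H x ^ q ≤
      2 * 4 ^ Module.finrank ℝ V * ENNReal.ofReal (q / (q - 1)) * 2 ^ (q - 1) *
      ∫⁻ x, H x ^ q := by
  have hq0 : 0 < q := by linarith
  have hq1 : 0 < q - 1 := by linarith
  have hM : Measurable (gaussMax H) := (lowerSemicontinuous_gaussMax hH).measurable
  have hHm := hH.measurable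
  set D : ℝ≥0∞ := 4 ^ Module.finrank ℝ V with hD
  have weak : ∀ a : ℝ, 0 < a → volume {x | ENNReal.ofReal a < gaussMax H x} ≤
      ENNReal.ofReal (2 / a) * D *
        ∫⁻ x, (H ⁻¹' Ioi (ENNReal.ofReal (a / 2))).indicator H x := by
    intro a ha
    have h := measure_ballMax_gt_le ((H ⁻¹' Ioi (ENNReal.ofReal (a / 2))).indicator H)
      (ENNReal.ofReal (a / 2))
    have hsub : {x | ENNReal.ofReal a < gaussMax H x} ⊆ {x | ENNReal.ofReal (a / 2) <
        ballMax ((H ⁻¹' Ioi (ENNReal.ofReal (a / 2))).indicator H) x} := by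
      intro x hx
      by_contra hcon
      rw [mem_ofPred_eq] at hx
      rw [mem_ofPred_eq, not_lt] at hcon
      refine absurd hx (not_lt.2 ?_)
      calc gaussMax H x ≤ ballMax H x := gaussMax_le_ballMax hH x
        _ ≤ _ := ballMax_le_add H (ENNReal.ofReal (a / 2)) x
        _ ≤ ENNReal.ofReal (a / 2) + ENNReal.ofReal (a / 2) := by gcongr
        _ = ENNReal.ofReal a := by
          rw [← ENNReal.ofReal_add (by positivity) (by positivity), add_halves]
    calc _ ≤ ENNReal.ofReal (2 / a) * (ENNReal.ofReal (a / 2) *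
          volume {x | ENNReal.ofReal a < gaussMax H x}) := by
          rw [← mul_assoc, ← ENNReal.ofReal_mul (by positivity)]
          rw [show 2 / a * (a / 2) = 1 by field_simp, ENNReal.ofReal_one, one_mul]
      _ ≤ ENNReal.ofReal (2 / a) * (ENNReal.ofReal (a / 2) * volume {x | ENNReal.ofReal (a / 2) <
        ballMax ((H ⁻¹' Ioi (ENNReal.ofReal (a / 2))).indicator H) x}) := by gcongr
      _ ≤ _ := by
          rw [mul_assoc]
          gcongr
  have hind : ∀ F : V → ℝ≥0∞, Measurable F → ∀ w : ℝ → ℝ≥0∞, Measurable w → ∀ c : ℝ,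
      Measurable (fun p : V × ℝ => w p.2 *
        (Iio (F p.1)).indicator (1 : ℝ≥0∞ → ℝ≥0∞) (ENNReal.ofReal (p.2 / c))) := by
    intro F hF w hw c
    have hms : MeasurableSet {p : V × ℝ | ENNReal.ofReal (p.2 / c) < F p.1} :=
      measurableSet_lt (by fun_prop) (by fun_prop)
    refine (hw.comp measurable_snd).mul ?_
    exact (measurable_const (a := (1:ℝ≥0∞))).indicator hms
  calc ∫⁻ x, gaussMax H x ^ q
      ≤ ∫⁻ x, ∫⁻ a in Ioi (0:ℝ), ENNReal.ofReal (q * a ^ (q - 1)) *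
          (Iio (gaussMax H x)).indicator 1 (ENNReal.ofReal a) :=
        lintegral_mono fun x => rpow_le_setLIntegral hq0 _
    _ = ∫⁻ a in Ioi (0:ℝ), ∫⁻ x, ENNReal.ofReal (q * a ^ (q - 1)) *
          (Iio (gaussMax H x)).indicator 1 (ENNReal.ofReal a) := by
        refine lintegral_lintegral_swap ?_
        have := hind (gaussMax H) hM (fun a => ENNReal.ofReal (q * a ^ (q - 1))) (by fun_prop) 1
        simp only [div_one] at this
        exact this.aemeasurable
    _ ≤ ∫⁻ a in Ioi (0:ℝ), ∫⁻ x, 2 * D * ENNReal.ofReal (q / (q - 1)) * (H x *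
          (ENNReal.ofReal ((q - 1) * a ^ (q - 1 - 1)) *
          (Iio (H x)).indicator 1 (ENNReal.ofReal (a / 2)))) := by
        refine setLIntegral_mono' measurableSet_Ioi fun a (ha : 0 < a) => ?_
        have e1 : ∫⁻ x, ENNReal.ofReal (q * a ^ (q - 1)) *
            (Iio (gaussMax H x)).indicator 1 (ENNReal.ofReal a) =
            ENNReal.ofReal (q * a ^ (q - 1)) * volume {x | ENNReal.ofReal a < gaussMax H x} := by
          rw [lintegral_const_mul' _ _ ENNReal.ofReal_ne_top]
          congr 1
          rw [← lintegral_indicator_one (measurableSet_lt measurable_const hM)]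
          rfl
        have e2 : ∀ x, H x * (ENNReal.ofReal ((q - 1) * a ^ (q - 1 - 1)) *
            (Iio (H x)).indicator 1 (ENNReal.ofReal (a / 2))) =
            ENNReal.ofReal ((q - 1) * a ^ (q - 1 - 1)) *
              (H ⁻¹' Ioi (ENNReal.ofReal (a / 2))).indicator H x := by
          intro x
          by_cases h : ENNReal.ofReal (a / 2) < H x
          · simp [indicator, h, mul_comm]
          · simp [indicator, h]
        simp_rw [e2]
        rw [e1, lintegral_const_mul' _ _ (by
          rw [hD]; finiteness), lintegral_const_mul' _ _ ENNReal.ofReal_ne_top]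
        refine (mul_le_mul' le_rfl (weak a ha)).trans (le_of_eq ?_)
        have e3 : ENNReal.ofReal (q * a ^ (q - 1)) * ENNReal.ofReal (2 / a) =
            2 * ENNReal.ofReal (q / (q - 1)) * ENNReal.ofReal ((q - 1) * a ^ (q - 1 - 1)) := by
          rw [← ENNReal.ofReal_mul (by positivity),
            ← ENNReal.ofReal_ofNat 2, ← ENNReal.ofReal_mul (by positivity),
            ← ENNReal.ofReal_mul (by positivity)]
          congr 1
          rw [Real.rpow_sub_one ha.ne' (q - 1)]
          field_simp
        rw [← mul_assoc, ← mul_assoc, e3]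
        ring
    _ = ∫⁻ x, ∫⁻ a in Ioi (0:ℝ), 2 * D * ENNReal.ofReal (q / (q - 1)) * (H x *
          (ENNReal.ofReal ((q - 1) * a ^ (q - 1 - 1)) *
          (Iio (H x)).indicator 1 (ENNReal.ofReal (a / 2)))) := by
        refine (lintegral_lintegral_swap ?_).symm
        have := hind H hHm (fun a => ENNReal.ofReal ((q - 1) * a ^ (q - 1 - 1))) (by fun_prop) 2
        exact (((hHm.comp measurable_fst).mul this).const_mul _).aemeasurable
    _ ≤ ∫⁻ x, 2 * D * ENNReal.ofReal (q / (q - 1)) * 2 ^ (q - 1) * H x ^ q := by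
        refine lintegral_mono fun x => ?_
        by_cases hx : H x = ∞
        · rw [hx, ENNReal.top_rpow_of_pos hq0, ENNReal.mul_top]
          · exact le_top
          · have : ENNReal.ofReal (q / (q - 1)) ≠ 0 := by
              simpa using (by positivity : 0 < q / (q - 1))
            have h2 : (2:ℝ≥0∞) ^ (q - 1) ≠ 0 := by simp
            rw [hD]
            simp [this, h2]
        · dsimp only
          rw [lintegral_const_mul' _ _ (by rw [hD]; finiteness), lintegral_const_mul' _ _ hx]
          have e4 : ∀ a : ℝ, (Iio (H x)).indicator (1 : ℝ≥0∞ → ℝ≥0∞) (ENNReal.ofReal (a / 2)) =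
              (Iio (ENNReal.ofReal (2 * (H x).toReal))).indicator 1 (ENNReal.ofReal a) := by
            intro a
            have : ENNReal.ofReal (a / 2) < H x ↔
                ENNReal.ofReal a < ENNReal.ofReal (2 * (H x).toReal) := by
              rw [ENNReal.ofReal_mul (by norm_num), ENNReal.ofReal_toReal hx,
                ENNReal.ofReal_div_of_pos (by norm_num), ENNReal.ofReal_ofNat,
                ENNReal.div_lt_iff (by simp) (by simp), mul_comm]
            simp [indicator, this]
          simp_rw [e4]
          rw [setLIntegral_rpow_Iio hq1 _ (by positivity), ENNReal.ofReal_mul (by norm_num),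
            ENNReal.ofReal_toReal hx, ENNReal.ofReal_ofNat,
            ENNReal.mul_rpow_of_nonneg _ _ hq1.le]
          have e5 : H x ^ q = H x * H x ^ (q - 1) := by
            conv_lhs => rw [← add_sub_cancel 1 q]
            rw [ENNReal.rpow_add_of_nonneg 1 _ zero_le_one hq1.le, ENNReal.rpow_one]
          rw [e5]
          exact le_of_eq (by ring)
    _ = _ := lintegral_const_mul' _ _ (by rw [hD]; finiteness)

variable (V) in
lemma exists_recipNorm_gaussMax_le {θ : ℝ} (hθ : 0 < θ) (hθ1 : θ < 1) :
    ∃ C : ℝ≥0∞, C ≠ ∞ ∧ ∀ H : V → ℝ≥0∞, LowerSemicontinuous H →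
      recipNorm θ (gaussMax H) ≤ C * recipNorm θ H := by
  have hq : 1 < 1 / θ := by rwa [lt_div_iff₀ hθ, one_mul]
  refine ⟨(2 * 4 ^ Module.finrank ℝ V * ENNReal.ofReal (1 / θ / (1 / θ - 1)) *
    2 ^ (1 / θ - 1)) ^ θ, ?_, fun H hH => ?_⟩
  · refine ENNReal.rpow_ne_top_of_nonneg hθ.le ?_
    have : (2:ℝ≥0∞) ^ (1 / θ - 1) ≠ ∞ := ENNReal.rpow_ne_top_of_nonneg (by linarith) (by simp)
    finiteness
  · unfold recipNorm
    rw [← ENNReal.mul_rpow_of_nonneg _ _ hθ.le]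
    exact ENNReal.rpow_le_rpow (lintegral_gaussMax_rpow_le hq hH) hθ.le

variable (V) in
lemma exists_recipNorm_iterate_gaussMax_le {θ : ℝ} (hθ : 0 < θ) (hθ1 : θ < 1) (n : ℕ) :
    ∃ C : ℝ≥0∞, C ≠ ∞ ∧ ∀ H : V → ℝ≥0∞, LowerSemicontinuous H →
      recipNorm θ (gaussMax^[n] H) ≤ C * recipNorm θ H := by
  obtain ⟨C, hC, h⟩ := exists_recipNorm_gaussMax_le V hθ hθ1
  refine ⟨C ^ n, by finiteness, fun H hH => ?_⟩
  induction n with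
  | zero => simp
  | succ n ih =>
    rw [Function.iterate_succ_apply', pow_succ', mul_assoc]
    exact (h _ (lowerSemicontinuous_iterate_gaussMax hH n)).trans (by gcongr)

end Maximal

/-! ### Synthesis from compactly supported frequency profiles -/

section Synthesis

variable {V : Type*} [NormedAddCommGroup V] [InnerProductSpace ℝ V]

/-- The character `e^{2πi⟨x,ξ⟩}`. -/
noncomputable def wave (x ξ : V) : ℂ := Complex.exp ((2 * Real.pi * ⟪x, ξ⟫ : ℝ) * Complex.I)

@[simp] lemma norm_wave (x ξ : V) : ‖wave x ξ‖ = 1 := Complex.norm_exp_ofReal_mul_I _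

@[simp] lemma enorm_wave (x ξ : V) : ‖wave x ξ‖ₑ = 1 := by
  rw [← ofReal_norm, norm_wave, ENNReal.ofReal_one]

lemma wave_add_left (x y ξ : V) : wave (x + y) ξ = wave x ξ * wave y ξ := by
  rw [wave, wave, wave, ← Complex.exp_add, inner_add_left]
  congr 1; push_cast; ring

lemma wave_add_right (x ξ η : V) : wave x (ξ + η) = wave x ξ * wave x η := by
  rw [wave, wave, wave, ← Complex.exp_add, inner_add_right]
  congr 1; push_cast; ring

lemma wave_smul_comm (c : ℝ) (x ξ : V) : wave (c • x) ξ = wave x (c • ξ) := by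
  rw [wave, wave, inner_smul_left, inner_smul_right]; rfl

lemma wave_ne_zero (x ξ : V) : wave x ξ ≠ 0 := Complex.exp_ne_zero _

@[simp] lemma wave_zero_left (ξ : V) : wave 0 ξ = 1 := by simp [wave]

@[simp] lemma wave_zero_right (ξ : V) : wave ξ 0 = 1 := by simp [wave]

lemma wave_intCast_smul (n : ℤ) (x ξ : V) : wave ((n : ℝ) • x) ξ = wave x ξ ^ n := by
  rw [wave, wave, ← Complex.exp_int_mul, inner_smul_left]
  congr 1
  simp
  ring

lemma wave_natCast_smul (n : ℕ) (x ξ : V) : wave ((n : ℝ) • x) ξ = wave x ξ ^ n := by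
  have := wave_intCast_smul n x ξ
  simpa using this

@[fun_prop]
lemma Continuous.wave {X : Type*} [TopologicalSpace X] {f g : X → V} (hf : Continuous f)
    (hg : Continuous g) : Continuous fun t => wave (f t) (g t) := by
  unfold GevreyKatoPonce.wave
  fun_prop

variable [MeasurableSpace V] [BorelSpace V] [FiniteDimensional ℝ V]

/-- `∫ e^{2πi⟨x,ξ⟩} φ(ξ) dξ`. -/
noncomputable def synth (φ : V → ℂ) (x : V) : ℂ := ∫ ξ, wave x ξ * φ ξ

/-- Integrable and of bounded support. -/
def Nice (φ : V → ℂ) : Prop := Integrable φ ∧ ∃ R : ℝ, ∀ ξ, R < ‖ξ‖ → φ ξ = 0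

/-- Measurable and bounded on bounded sets. -/
def LocBdd (m : V → ℂ) : Prop :=
  Measurable m ∧ ∀ R : ℝ, ∃ C : ℝ, ∀ ξ, ‖ξ‖ ≤ R → ‖m ξ‖ ≤ C

lemma _root_.Continuous.locBdd {m : V → ℂ} (hm : Continuous m) : LocBdd m := by
  refine ⟨hm.measurable, fun R => ?_⟩
  obtain ⟨C, hC⟩ := (isCompact_closedBall (0 : V) R).exists_bound_of_continuousOn hm.continuousOn
  exact ⟨C, fun ξ hξ => hC ξ (by simpa using hξ)⟩

lemma LocBdd.of_norm_le {m : V → ℂ} (hm : Measurable m) (C : ℝ) (h : ∀ ξ, ‖m ξ‖ ≤ C) : LocBdd m :=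
  ⟨hm, fun _ => ⟨C, fun ξ _ => h ξ⟩⟩

lemma Nice.mul {φ m : V → ℂ} (hφ : Nice φ) (hm : LocBdd m) : Nice (fun ξ => m ξ * φ ξ) := by
  obtain ⟨hi, R, hR⟩ := hφ
  obtain ⟨hmeas, hb⟩ := hm
  obtain ⟨C, hC⟩ := hb R
  refine ⟨?_, R, fun ξ hξ => by simp [hR ξ hξ]⟩
  refine (hi.norm.const_mul |C|).mono' (hmeas.aestronglyMeasurable.mul hi.1) ?_
  refine Eventually.of_forall fun ξ => ?_
  by_cases hξ : ‖ξ‖ ≤ R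
  · rw [norm_mul]
    exact mul_le_mul_of_nonneg_right ((hC ξ hξ).trans (le_abs_self C)) (norm_nonneg _)
  · simp [hR ξ (not_le.1 hξ)]

lemma integrable_wave_mul {φ : V → ℂ} (hφ : Integrable φ) (x : V) :
    Integrable fun ξ => wave x ξ * φ ξ :=
  hφ.bdd_mul (c := 1) (Continuous.aestronglyMeasurable (by fun_prop))
    (Eventually.of_forall fun ξ => by simp)

lemma continuous_synth {φ : V → ℂ} (hφ : Integrable φ) : Continuous (synth φ) := by
  refine continuous_of_dominated (bound := fun ξ => ‖φ ξ‖)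
    (fun x => (integrable_wave_mul hφ x).1) (fun x => Eventually.of_forall fun ξ => by simp)
    hφ.norm (Eventually.of_forall fun ξ => by fun_prop)

lemma norm_synth_le (φ : V → ℂ) (x : V) : ‖synth φ x‖ ≤ ∫ ξ, ‖φ ξ‖ := by
  refine (norm_integral_le_integral_norm _).trans (le_of_eq ?_)
  simp

lemma synth_add {φ ψ : V → ℂ} (hφ : Integrable φ) (hψ : Integrable ψ) (x : V) :
    synth (fun ξ => φ ξ + ψ ξ) x = synth φ x + synth ψ x := by
  simp only [synth, mul_add]
  exact integral_add (integrable_wave_mul hφ x) (integrable_wave_mul hψ x)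

lemma synth_sub {φ ψ : V → ℂ} (hφ : Integrable φ) (hψ : Integrable ψ) (x : V) :
    synth (fun ξ => φ ξ - ψ ξ) x = synth φ x - synth ψ x := by
  simp only [synth, mul_sub]
  exact integral_sub (integrable_wave_mul hφ x) (integrable_wave_mul hψ x)

lemma synth_const_mul (c : ℂ) (φ : V → ℂ) (x : V) :
    synth (fun ξ => c * φ ξ) x = c * synth φ x := by
  simp only [synth]
  rw [← integral_const_mul]
  congr 1; ext ξ; ring

lemma synth_sum {ι : Type*} (s : Finset ι) {φ : ι → V → ℂ} (hφ : ∀ i ∈ s, Integrable (φ i))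
    (x : V) : synth (fun ξ => ∑ i ∈ s, φ i ξ) x = ∑ i ∈ s, synth (φ i) x := by
  simp only [synth, Finset.mul_sum]
  exact integral_finsetSum s fun i hi => integrable_wave_mul (hφ i hi) x

lemma synth_wave_mul (y : V) (φ : V → ℂ) (x : V) :
    synth (fun ξ => wave y ξ * φ ξ) x = synth φ (x + y) := by
  simp only [synth, wave_add_left, mul_assoc]

lemma synth_congr_ae {φ ψ : V → ℂ} (h : φ =ᵐ[volume] ψ) (x : V) : synth φ x = synth ψ x :=
  integral_congr_ae (h.mono fun ξ hξ => by simp only [hξ])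

lemma synth_integral_mul {T : Type*} [MeasurableSpace T] {μ : Measure T} [SFinite μ]
    {m : T → V → ℂ} (hm : Measurable (Function.uncurry m)) {φ : V → ℂ} (hφ : Integrable φ)
    (hfin : ∫⁻ ξ, (∫⁻ t, ‖m t ξ‖ₑ ∂μ) * ‖φ ξ‖ₑ ≠ ∞) (x : V) :
    synth (fun ξ => (∫ t, m t ξ ∂μ) * φ ξ) x = ∫ t, synth (fun ξ => m t ξ * φ ξ) x ∂μ := by
  simp only [synth]
  have hF : AEStronglyMeasurable (fun p : V × T => wave x p.1 * (m p.2 p.1 * φ p.1))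
      (volume.prod μ) := by
    have hw : Continuous fun ξ : V => wave x ξ := by fun_prop
    refine (hw.measurable.comp measurable_fst).aestronglyMeasurable.mul
      (AEStronglyMeasurable.mul ?_ ?_)
    · exact (hm.comp measurable_swap).aestronglyMeasurable
    · exact hφ.1.comp_fst
  have hi : Integrable (Function.uncurry fun (ξ : V) (t : T) => wave x ξ * (m t ξ * φ ξ))
      (volume.prod μ) := by
    refine ⟨hF, ?_⟩
    rw [hasFiniteIntegral_iff_enorm, lintegral_prod _ (by exact hF.enorm)]
    refine lt_of_le_of_lt (le_of_eq ?_) (lt_top_iff_ne_top.2 hfin)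
    refine lintegral_congr fun ξ => ?_
    simp only [Function.uncurry, enorm_mul, enorm_wave, one_mul]
    rw [lintegral_mul_const' _ _ enorm_ne_top]
  rw [← integral_integral_swap hi]
  refine integral_congr_ae (Eventually.of_forall fun ξ => ?_)
  simp only
  rw [integral_const_mul, integral_mul_const]

lemma enorm_synth_integral_mul_le {T : Type*} [MeasurableSpace T] {μ : Measure T} [SFinite μ]
    {m : T → V → ℂ} (hm : Measurable (Function.uncurry m)) {φ : V → ℂ} (hφ : Integrable φ)
    (hfin : ∫⁻ ξ, (∫⁻ t, ‖m t ξ‖ₑ ∂μ) * ‖φ ξ‖ₑ ≠ ∞) (x : V) :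
    ‖synth (fun ξ => (∫ t, m t ξ ∂μ) * φ ξ) x‖ₑ ≤
      ∫⁻ t, ‖synth (fun ξ => m t ξ * φ ξ) x‖ₑ ∂μ := by
  rw [synth_integral_mul hm hφ hfin]
  exact enorm_integral_le_lintegral_enorm _

/-- The heat symbol `e^{-πρ²‖ξ‖²}`. -/
noncomputable def heat (ρ : ℝ) (ξ : V) : ℂ := (Real.exp (-Real.pi * (ρ ^ 2 * ‖ξ‖ ^ 2)) : ℝ)

lemma norm_heat_le (ρ : ℝ) (ξ : V) : ‖heat ρ ξ‖ ≤ 1 := by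
  rw [heat, Complex.norm_of_nonneg (by positivity), Real.exp_le_one_iff]
  have : 0 ≤ Real.pi * (ρ ^ 2 * ‖ξ‖ ^ 2) := by positivity
  linarith

@[fun_prop]
lemma continuous_heat : Continuous fun p : ℝ × V => heat p.1 p.2 := by
  unfold heat
  fun_prop

lemma locBdd_heat (ρ : ℝ) : LocBdd (heat ρ : V → ℂ) :=
  Continuous.locBdd (by unfold heat; fun_prop)

lemma heat_pow {ρ : ℝ} (j : ℕ) (ξ : V) : heat ρ ξ ^ j = heat (√j * ρ) ξ := by
  unfold heat
  rw [← Complex.ofReal_pow, ← Real.exp_nat_mul, mul_pow, Real.sq_sqrt (by positivity)]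
  congr 2
  ring

lemma integral_gauss_wave_smul (ρ : ℝ) (ξ : V) :
    ∫ y, wave (ρ • y) ξ ∂(gauss V) = heat ρ ξ := by
  simp_rw [wave_smul_comm]
  unfold wave
  rw [integral_gauss_cexp, norm_smul, heat, mul_pow, Real.norm_eq_abs, sq_abs]

lemma integral_gauss_synth (ρ : ℝ) {φ : V → ℂ} (hφ : Integrable φ) (x : V) :
    ∫ y, synth φ (x + ρ • y) ∂(gauss V) = synth (fun ξ => heat ρ ξ * φ ξ) x := by
  have := synth_integral_mul (μ := gauss V) (m := fun y ξ => wave (ρ • y) ξ)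
    (Continuous.measurable (by fun_prop)) hφ (by simpa using hφ.2.ne) x
  simp_rw [integral_gauss_wave_smul, synth_wave_mul] at this
  exact this.symm

lemma enorm_synth_heat_le (ρ : ℝ) {φ : V → ℂ} (hφ : Integrable φ) (x : V) :
    ‖synth (fun ξ => heat ρ ξ * φ ξ) x‖ₑ ≤ gaussMax (fun x => ‖synth φ x‖ₑ) x := by
  rw [← integral_gauss_synth ρ hφ]
  exact (enorm_integral_le_lintegral_enorm _).trans (gaussAvg_le_gaussMax _ ρ x)

lemma lowerSemicontinuous_enorm_synth {φ : V → ℂ} (hφ : Integrable φ) :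
    LowerSemicontinuous fun x => ‖synth φ x‖ₑ :=
  (continuous_synth hφ).enorm.lowerSemicontinuous

lemma abs_exp_sub_exp_le {a b c : ℝ} (ha : a ≤ c) (hb : b ≤ c) :
    |Real.exp a - Real.exp b| ≤ |a - b| * Real.exp c := by
  wlog h : b ≤ a generalizing a b
  · rw [abs_sub_comm, abs_sub_comm a]
    exact this hb ha (le_of_not_ge h)
  rw [abs_of_nonneg (by simpa using h), abs_of_nonneg (by simpa using h)]
  have h1 : Real.exp b = Real.exp a * Real.exp (b - a) := by rw [← Real.exp_add]; ring_nf
  have h2 := Real.add_one_le_exp (b - a)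
  calc Real.exp a - Real.exp b ≤ (a - b) * Real.exp a := by
        rw [h1]; nlinarith [Real.exp_pos a]
    _ ≤ _ := by gcongr

lemma abs_gaussian_translate_sub_le (z v : V) (hv : ‖v‖ ≤ 1) :
    |Real.exp (-Real.pi * ‖z - v‖ ^ 2) - Real.exp (-Real.pi * ‖z‖ ^ 2)| ≤
      Real.pi * Real.exp (3 * Real.pi) * ‖v‖ * Real.exp (-Real.pi * ‖(2⁻¹ : ℝ) • z‖ ^ 2) := by
  set r := ‖z‖
  have hr : 0 ≤ r := norm_nonneg z
  have hπ := Real.pi_gt_three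
  have h1 : ‖z - v‖ ^ 2 = r ^ 2 - 2 * ⟪z, v⟫ + ‖v‖ ^ 2 := norm_sub_sq_real z v
  have h2 : |⟪z, v⟫| ≤ r * ‖v‖ := abs_real_inner_le_norm z v
  have h2' := abs_le.1 h2
  have hvv : ‖v‖ ^ 2 ≤ ‖v‖ := by nlinarith [norm_nonneg v]
  have hrv : r * ‖v‖ ≤ r := by nlinarith [norm_nonneg v]
  have h3 := abs_exp_sub_exp_le (a := -Real.pi * ‖z - v‖ ^ 2) (b := -Real.pi * r ^ 2)
    (c := Real.pi * (2 * r - r ^ 2)) (by rw [h1]; nlinarith [sq_nonneg ‖v‖]) (by nlinarith)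
  refine h3.trans ?_
  have h4 : |-Real.pi * ‖z - v‖ ^ 2 - -Real.pi * r ^ 2| ≤ Real.pi * ‖v‖ * (2 * r + 1) := by
    rw [h1, show -Real.pi * (r ^ 2 - 2 * ⟪z, v⟫ + ‖v‖ ^ 2) - -Real.pi * r ^ 2 =
      Real.pi * (2 * ⟪z, v⟫ - ‖v‖ ^ 2) by ring, abs_mul, abs_of_pos Real.pi_pos, mul_assoc]
    gcongr
    rw [abs_le]
    constructor <;> nlinarith [sq_nonneg ‖v‖]
  have h5 : 2 * r + 1 ≤ Real.exp (2 * r) := Real.add_one_le_exp _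
  calc _ ≤ Real.pi * ‖v‖ * Real.exp (2 * r) * Real.exp (Real.pi * (2 * r - r ^ 2)) := by
        gcongr
        exact h4.trans (by gcongr)
    _ = Real.pi * ‖v‖ * Real.exp (2 * r + Real.pi * (2 * r - r ^ 2)) := by
        rw [Real.exp_add]; ring
    _ ≤ Real.pi * ‖v‖ * Real.exp (3 * Real.pi + (-Real.pi * ‖(2⁻¹ : ℝ) • z‖ ^ 2)) := by
        refine mul_le_mul_of_nonneg_left (Real.exp_le_exp.2 ?_) (by positivity)
        rw [norm_smul, Real.norm_of_nonneg (by norm_num)]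
        change _ ≤ 3 * Real.pi + -Real.pi * (2⁻¹ * r) ^ 2
        nlinarith [mul_nonneg (by linarith : 0 ≤ Real.pi - 3) hr, sq_nonneg (r - 2),
          mul_nonneg Real.pi_pos.le (sq_nonneg (3 * r - 16 / 3))]
    _ = _ := by rw [Real.exp_add]; ring

lemma lintegral_gaussian_half_le (H : V → ℝ≥0∞) (hH : Measurable H) {ρ : ℝ} (x : V) :
    ∫⁻ z, ENNReal.ofReal (Real.exp (-Real.pi * ‖(2⁻¹ : ℝ) • z‖ ^ 2)) * H (x + ρ • z) ≤
      2 ^ Module.finrank ℝ V * gaussMax H x := by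
  have h := lintegral_comp_add_smul (f := fun z : V => ENNReal.ofReal
    (Real.exp (-Real.pi * ‖z‖ ^ 2)) * H (x + (ρ * 2) • z)) (by fun_prop) 0
    (ρ := 2⁻¹) (by norm_num)
  simp only [zero_add, smul_smul] at h
  rw [show ρ * 2 * 2⁻¹ = ρ by ring] at h
  rw [h, ← lintegral_gauss (fun z => H (x + (ρ * 2) • z))]
  refine mul_le_mul' (le_of_eq ?_) (gaussAvg_le_gaussMax H (ρ * 2) x)
  rw [inv_pow, inv_inv, abs_of_pos (by positivity), ENNReal.ofReal_pow (by norm_num)]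
  simp

/-- The symbol `e^{2πi⟨y,ξ⟩} - 1` of a difference operator. -/
noncomputable def delta (y ξ : V) : ℂ := wave y ξ - 1

@[fun_prop]
lemma Continuous.delta {X : Type*} [TopologicalSpace X] {f g : X → V} (hf : Continuous f)
    (hg : Continuous g) : Continuous fun t => delta (f t) (g t) := by
  unfold GevreyKatoPonce.delta
  fun_prop

lemma norm_delta_le (y ξ : V) : ‖delta y ξ‖ ≤ 2 := by
  refine (norm_sub_le _ _).trans ?_
  norm_num

lemma synth_delta_mul (y : V) {φ : V → ℂ} (hφ : Integrable φ) (x : V) :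
    synth (fun ξ => delta y ξ * φ ξ) x = synth φ (x + y) - synth φ x := by
  simp only [delta, sub_mul, one_mul]
  rw [synth_sub (integrable_wave_mul hφ y) hφ, synth_wave_mul]

variable (V) in
/-- The constant in the smoothing estimate for a difference of Gaussian averages. -/
noncomputable def diffConst : ℝ≥0∞ :=
  ENNReal.ofReal (Real.pi * Real.exp (3 * Real.pi)) * 2 ^ Module.finrank ℝ V

variable (V) in
lemma diffConst_ne_top : diffConst V ≠ ∞ := by
  unfold diffConst
  finiteness

lemma enorm_synth_delta_heat_le {φ : V → ℂ} (hφ : Integrable φ) {ρ : ℝ} (hρ : 0 < ρ) {y : V}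
    (hy : ‖y‖ ≤ ρ) (x : V) :
    ‖synth (fun ξ => delta y ξ * heat ρ ξ * φ ξ) x‖ₑ ≤
      diffConst V * ENNReal.ofReal (‖y‖ / ρ) * gaussMax (fun x => ‖synth φ x‖ₑ) x := by
  have hInt : Integrable fun ξ => heat ρ ξ * φ ξ :=
    hφ.bdd_mul (c := 1) (Continuous.aestronglyMeasurable (by unfold heat; fun_prop))
      (Eventually.of_forall fun ξ => norm_heat_le ρ ξ)
  simp_rw [mul_assoc]
  rw [synth_delta_mul y hInt, ← integral_gauss_synth ρ hφ, ← integral_gauss_synth ρ hφ,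
    integral_gauss, integral_gauss]
  set v := ρ⁻¹ • y with hv
  have hv1 : ‖v‖ = ‖y‖ / ρ := by
    rw [hv, norm_smul, norm_inv, Real.norm_of_nonneg hρ.le, inv_mul_eq_div]
  have hgi : Integrable fun z : V => (Real.exp (-Real.pi * ‖z‖ ^ 2) : ℂ) := by
    have := GaussianFourier.integrable_cexp_neg_mul_sq_norm_add (V := V) (b := Real.pi)
      (by simpa using Real.pi_pos) 0 0
    refine this.congr (Eventually.of_forall fun z => ?_)
    simp
  have hbi : ∀ w : V, Integrable fun z : V =>
      (Real.exp (-Real.pi * ‖z‖ ^ 2) : ℂ) * synth φ (w + ρ • z) := fun w =>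
    hgi.mul_bdd (c := ∫ ξ, ‖φ ξ‖)
      ((continuous_synth hφ).comp (by fun_prop)).aestronglyMeasurable
      (Eventually.of_forall fun z => norm_synth_le φ _)
  have htr : ∫ z : V, (Real.exp (-Real.pi * ‖z‖ ^ 2) : ℂ) * synth φ (x + y + ρ • z) =
      ∫ z : V, (Real.exp (-Real.pi * ‖z - v‖ ^ 2) : ℂ) * synth φ (x + ρ • z) := by
    rw [← integral_sub_right_eq_self _ v]
    congr 1; ext z
    congr 2
    rw [smul_sub, hv, smul_inv_smul₀ hρ.ne']
    abel
  have hbi' : Integrable fun z : V =>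
      (Real.exp (-Real.pi * ‖z - v‖ ^ 2) : ℂ) * synth φ (x + ρ • z) :=
    (hgi.comp_sub_right v).mul_bdd (c := ∫ ξ, ‖φ ξ‖)
      ((continuous_synth hφ).comp (by fun_prop)).aestronglyMeasurable
      (Eventually.of_forall fun z => norm_synth_le φ _)
  rw [htr, ← integral_sub hbi' (hbi x)]
  refine (enorm_integral_le_lintegral_enorm _).trans ?_
  calc _ ≤ ∫⁻ z, ENNReal.ofReal (Real.pi * Real.exp (3 * Real.pi)) * ENNReal.ofReal ‖v‖ *
        (ENNReal.ofReal (Real.exp (-Real.pi * ‖(2⁻¹ : ℝ) • z‖ ^ 2)) * ‖synth φ (x + ρ • z)‖ₑ) := by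
        refine lintegral_mono fun z => ?_
        rw [← sub_mul, enorm_mul, ← mul_assoc]
        gcongr
        rw [← Complex.ofReal_sub, ← ofReal_norm, Complex.norm_real, Real.norm_eq_abs,
          ← ENNReal.ofReal_mul (by positivity), ← ENNReal.ofReal_mul (by positivity)]
        exact ENNReal.ofReal_le_ofReal (abs_gaussian_translate_sub_le z v
          (by rwa [hv1, div_le_one hρ]))
    _ ≤ _ := by
        rw [lintegral_const_mul' _ _ (by finiteness), hv1, diffConst]
        calc _ ≤ ENNReal.ofReal (Real.pi * Real.exp (3 * Real.pi)) * ENNReal.ofReal (‖y‖ / ρ) *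
              (2 ^ Module.finrank ℝ V * gaussMax (fun x => ‖synth φ x‖ₑ) x) := by
              gcongr
              exact lintegral_gaussian_half_le (fun x => ‖synth φ x‖ₑ)
                (continuous_synth hφ).enorm.measurable x
          _ = _ := by ring

lemma enorm_synth_delta_heat_pow_le {φ : V → ℂ} (hφ : Nice φ) {ρ : ℝ} (hρ : 0 < ρ) {y : V}
    (hy : ‖y‖ ≤ ρ) (j : ℕ) (x : V) :
    ‖synth (fun ξ => (delta y ξ * heat ρ ξ) ^ j * φ ξ) x‖ₑ ≤
      (diffConst V * ENNReal.ofReal (‖y‖ / ρ)) ^ j *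
        gaussMax^[j] (fun x => ‖synth φ x‖ₑ) x := by
  induction j generalizing x with
  | zero => simp
  | succ j ih =>
    have hn : Nice fun ξ => (delta y ξ * heat ρ ξ) ^ j * φ ξ :=
      hφ.mul (Continuous.locBdd (by unfold heat; fun_prop))
    have h := enorm_synth_delta_heat_le hn.1 hρ hy x
    simp_rw [← mul_assoc, ← pow_succ'] at h
    refine h.trans ?_
    rw [Function.iterate_succ_apply', pow_succ']
    refine (mul_le_mul' le_rfl ?_).trans_eq (mul_assoc _ _ _).symm
    rw [← gaussMax_const_mul _ (by have := diffConst_ne_top V; finiteness)]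
    exact gaussMax_mono ih x

end Synthesis

/-! ### Elementary one-dimensional integrals -/

section OneDim

lemma setLIntegral_Ioc_rpow {a R : ℝ} (ha : 0 < a) (hR : 0 ≤ R) :
    ∫⁻ ρ in Ioc 0 R, ENNReal.ofReal (ρ ^ (a - 1)) = ENNReal.ofReal (R ^ a / a) := by
  have hi : IntervalIntegrable (fun ρ : ℝ => ρ ^ (a - 1)) volume 0 R :=
    intervalIntegral.intervalIntegrable_rpow' (by linarith)
  rw [← ofReal_integral_eq_lintegral_ofReal, ← intervalIntegral.integral_of_le hR,
    integral_rpow (Or.inl (by linarith))]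
  · rw [sub_add_cancel, Real.zero_rpow ha.ne', sub_zero]
  · exact (intervalIntegrable_iff_integrableOn_Ioc_of_le hR).1 hi
  · refine (ae_restrict_iff' measurableSet_Ioc).2 (Eventually.of_forall fun ρ hρ => ?_)
    exact Real.rpow_nonneg hρ.1.le _

lemma setLIntegral_Ioi_rpow {b R : ℝ} (hb : 0 < b) (hR : 0 < R) :
    ∫⁻ ρ in Ioi R, ENNReal.ofReal (ρ ^ (-b - 1)) = ENNReal.ofReal (R ^ (-b) / b) := by
  rw [← ofReal_integral_eq_lintegral_ofReal, integral_Ioi_rpow_of_lt (by linarith) hR]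
  · congr 1
    rw [sub_add_cancel, neg_div_neg_eq]
  · exact integrableOn_Ioi_rpow_of_lt (by linarith) hR
  · refine (ae_restrict_iff' measurableSet_Ioi).2 (Eventually.of_forall fun ρ hρ => ?_)
    exact Real.rpow_nonneg (hR.trans hρ).le _

lemma lintegral_min_rpow_le {a b : ℝ} (ha : 0 < a) (hb : 0 < b) (A B : ℝ≥0∞) :
    ∫⁻ ρ in Ioi (0:ℝ), min (ENNReal.ofReal (ρ ^ (a - 1)) * A) (ENNReal.ofReal (ρ ^ (-b - 1)) * B) ≤
      ENNReal.ofReal (1 / a + 1 / b) * (A ^ (b / (a + b)) * B ^ (a / (a + b))) := by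
  have hbab : 0 < b / (a + b) := by positivity
  have haab : 0 < a / (a + b) := by positivity
  rcases eq_or_ne A 0 with rfl | hA
  · simp
  rcases eq_or_ne B 0 with rfl | hB
  · simp
  have hc : ENNReal.ofReal (1 / a + 1 / b) ≠ 0 := by
    rw [ENNReal.ofReal_ne_zero_iff]
    positivity
  rcases eq_or_ne A ∞ with rfl | hA'
  · rw [ENNReal.top_rpow_of_pos hbab, ENNReal.top_mul, ENNReal.mul_top hc]
    · exact le_top
    · simp [hB, haab, not_lt_of_gt haab]
  rcases eq_or_ne B ∞ with rfl | hB'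
  · rw [ENNReal.top_rpow_of_pos haab, ENNReal.mul_top, ENNReal.mul_top hc]
    · exact le_top
    · simp [hA, hA', not_lt_of_gt hbab]
  lift A to NNReal using hA'
  lift B to NNReal using hB'
  have hA0 : (0:ℝ) < A := by
    simpa [pos_iff_ne_zero] using hA
  have hB0 : (0:ℝ) < B := by
    simpa [pos_iff_ne_zero] using hB
  set α : ℝ := (A : ℝ)
  set γ : ℝ := (B : ℝ)
  have hAe : (A : ℝ≥0∞) = ENNReal.ofReal α := by simp [α]
  have hBe : (B : ℝ≥0∞) = ENNReal.ofReal γ := by simp [γ]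
  set R : ℝ := (γ / α) ^ (1 / (a + b)) with hR
  have hR0 : 0 < R := by positivity
  have key1 : α * R ^ a = α ^ (b / (a + b)) * γ ^ (a / (a + b)) := by
    rw [hR, ← Real.rpow_mul (by positivity), Real.div_rpow hB0.le hA0.le,
      show b / (a + b) = 1 - 1 / (a + b) * a by field_simp; ring, Real.rpow_sub hA0, Real.rpow_one]
    rw [show a / (a + b) = 1 / (a + b) * a by ring]
    ring
  have key2 : γ * R ^ (-b) = α ^ (b / (a + b)) * γ ^ (a / (a + b)) := by
    rw [hR, ← Real.rpow_mul (by positivity), Real.div_rpow hB0.le hA0.le,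
      show a / (a + b) = 1 + 1 / (a + b) * (-b) by field_simp; ring, Real.rpow_add hB0,
      Real.rpow_one, show b / (a + b) = - (1 / (a + b) * (-b)) by ring, Real.rpow_neg hA0.le]
    ring
  rw [← Ioc_union_Ioi_eq_Ioi hR0.le]
  calc _ ≤ (∫⁻ ρ in Ioc 0 R, ENNReal.ofReal (ρ ^ (a - 1)) * A) +
        ∫⁻ ρ in Ioi R, ENNReal.ofReal (ρ ^ (-b - 1)) * B := by
        refine (lintegral_union_le _ _ _).trans (add_le_add ?_ ?_)
        · exact lintegral_mono fun ρ => min_le_left _ _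
        · exact lintegral_mono fun ρ => min_le_right _ _
    _ = ENNReal.ofReal (α * R ^ a / a + γ * R ^ (-b) / b) := by
        rw [lintegral_mul_const' _ _ ENNReal.coe_ne_top,
          lintegral_mul_const' _ _ ENNReal.coe_ne_top,
          setLIntegral_Ioc_rpow ha hR0.le, setLIntegral_Ioi_rpow hb hR0, hAe, hBe,
          ← ENNReal.ofReal_mul (by positivity), ← ENNReal.ofReal_mul (by positivity),
          ← ENNReal.ofReal_add (by positivity) (by positivity)]
        congr 1; ring
    _ = _ := by
        rw [key1, key2, hAe, hBe, ENNReal.ofReal_rpow_of_pos hA0, ENNReal.ofReal_rpow_of_pos hB0,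
          ← ENNReal.ofReal_mul (by positivity), ← ENNReal.ofReal_mul (by positivity)]
        congr 1; ring

end OneDim

section Differences

variable {V : Type*} [NormedAddCommGroup V] [InnerProductSpace ℝ V] [FiniteDimensional ℝ V]
  [MeasurableSpace V] [BorelSpace V]

/-! ### Pointwise bounds for iterated differences -/

/-- The normalising constant in `∫ ρ^{s-1} e^{-πρ²t²} dρ = heatConst s * t^{-s}`. -/
noncomputable def heatConst (s : ℝ) : ℝ := Real.pi ^ (-s / 2) * (1 / 2) * Real.Gamma (s / 2)

lemma heatConst_pos {s : ℝ} (hs : 0 < s) : 0 < heatConst s := by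
  have := Real.Gamma_pos_of_pos (half_pos hs)
  unfold heatConst
  positivity

lemma integral_rpow_mul_heat {s : ℝ} (hs : 0 < s) {ξ : V} (hξ : ξ ≠ 0) :
    ∫ ρ in Ioi (0:ℝ), ρ ^ (s - 1) * ‖heat ρ ξ‖ * ‖ξ‖ ^ s = heatConst s := by
  have hξ' : 0 < ‖ξ‖ := norm_pos_iff.2 hξ
  have h := _root_.integral_rpow_mul_exp_neg_mul_rpow (p := 2) (q := s - 1)
    (b := Real.pi * ‖ξ‖ ^ 2) (by norm_num) (by linarith) (by positivity)
  rw [integral_mul_const]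
  have e : ∀ ρ : ℝ, ρ ^ (s - 1) * ‖heat ρ ξ‖ =
      ρ ^ (s - 1) * Real.exp (-(Real.pi * ‖ξ‖ ^ 2) * ρ ^ (2:ℝ)) := by
    intro ρ
    rw [heat, Complex.norm_of_nonneg (by positivity), Real.rpow_two]
    congr 2; ring
  simp_rw [e]
  rw [h, sub_add_cancel, heatConst, Real.mul_rpow (by positivity) (by positivity),
    ← Real.rpow_natCast, ← Real.rpow_mul hξ'.le]
  have : ‖ξ‖ ^ (((2:ℕ):ℝ) * (-s / 2)) * ‖ξ‖ ^ s = 1 := by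
    rw [← Real.rpow_add hξ']
    convert Real.rpow_zero _ using 2
    push_cast; ring
  calc _ = Real.pi ^ (-s / 2) * (1 / 2) * Real.Gamma (s / 2) *
        (‖ξ‖ ^ (((2:ℕ):ℝ) * (-s / 2)) * ‖ξ‖ ^ s) := by ring
    _ = _ := by rw [this, mul_one]

lemma setLIntegral_rpow_mul_heat {s : ℝ} (hs : 0 < s) {ξ : V} (hξ : ξ ≠ 0) :
    ∫⁻ ρ in Ioi (0:ℝ), ENNReal.ofReal (ρ ^ (s - 1) * ‖heat ρ ξ‖ * ‖ξ‖ ^ s) =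
      ENNReal.ofReal (heatConst s) := by
  have h := integral_rpow_mul_heat hs hξ
  rw [← h, ofReal_integral_eq_lintegral_ofReal]
  · by_contra hcon
    rw [integral_undef hcon] at h
    exact (heatConst_pos hs).ne h
  · refine (ae_restrict_iff' measurableSet_Ioi).2 (Eventually.of_forall fun ρ (hρ : 0 < ρ) => ?_)
    show 0 ≤ _
    positivity

lemma Nice.norm_rpow_mul {φ : V → ℂ} (hφ : Nice φ) {s : ℝ} (hs : 0 ≤ s) :
    Nice fun ξ => ((‖ξ‖ ^ s : ℝ) : ℂ) * φ ξ :=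
  hφ.mul (Continuous.locBdd (by
    have : Continuous fun ξ : V => ‖ξ‖ ^ s := continuous_norm.rpow_const fun _ => Or.inr hs
    fun_prop))

lemma le_iterate_gaussMax (H : V → ℝ≥0∞) (n : ℕ) (x : V) : H x ≤ gaussMax^[n] H x := by
  induction n with
  | zero => exact le_rfl
  | succ n ih => rw [Function.iterate_succ_apply']; exact ih.trans (le_gaussMax _ x)

lemma gaussMax_le_iterate (H : V → ℝ≥0∞) {n : ℕ} (hn : 0 < n) (x : V) :
    gaussMax H x ≤ gaussMax^[n] H x := by
  obtain ⟨m, rfl⟩ := Nat.exists_eq_succ_of_ne_zero hn.ne'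
  rw [Function.iterate_succ_apply]
  exact le_iterate_gaussMax _ m x

lemma enorm_synth_delta_pow_le_sum {φ : V → ℂ} (hφ : Nice φ) (j : ℕ) (y x : V) :
    ‖synth (fun ξ => delta y ξ ^ j * φ ξ) x‖ₑ ≤
      2 ^ j * ∑ i ∈ Finset.range (j + 1), ‖synth φ (x + (i : ℝ) • y)‖ₑ := by
  have e : (fun ξ => delta y ξ ^ j * φ ξ) = fun ξ => ∑ i ∈ Finset.range (j + 1),
      ((-1) ^ (j - i) * (j.choose i : ℂ)) * (wave ((i : ℝ) • y) ξ * φ ξ) := by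
    ext ξ
    rw [delta, sub_eq_add_neg, add_pow, Finset.sum_mul]
    refine Finset.sum_congr rfl fun i _ => ?_
    rw [wave_natCast_smul]
    ring
  rw [e, synth_sum _ fun i _ => ((integrable_wave_mul hφ.1 _).const_mul _), Finset.mul_sum]
  refine (enorm_sum_le _ _).trans (Finset.sum_le_sum fun i _ => ?_)
  rw [synth_const_mul, synth_wave_mul, enorm_mul]
  gcongr
  rw [← ofReal_norm, norm_mul, norm_pow, norm_neg, norm_one, one_pow, one_mul, Complex.norm_natCast,
    ENNReal.ofReal_natCast]
  exact_mod_cast Nat.choose_le_two_pow j i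

variable (V) in
lemma exists_enorm_synth_delta_pow_le [Nontrivial V] {s : ℝ} {j : ℕ} (hs : 0 < s) (hsj : s < j) :
    ∃ C : ℝ≥0∞, C ≠ ∞ ∧ ∀ φ : V → ℂ, Nice φ → ∀ y x : V,
      ‖synth (fun ξ => delta y ξ ^ j * φ ξ) x‖ₑ ≤ C * ENNReal.ofReal (‖y‖ ^ s) *
        ∑ i ∈ Finset.range (j + 1),
          gaussMax^[j] (fun x => ‖synth (fun ξ => ((‖ξ‖ ^ s : ℝ) : ℂ) * φ ξ) x‖ₑ)
            (x + (i : ℝ) • y) := by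
  have hj : 0 < j := by
    have : (0:ℝ) < j := hs.trans hsj
    exact_mod_cast this
  have hj' : (0:ℝ) < j := by exact_mod_cast hj
  have hc := heatConst_pos hs
  refine ⟨(ENNReal.ofReal (heatConst s))⁻¹ * (2 ^ j * ENNReal.ofReal (√j ^ s / s) +
    diffConst V ^ j * ENNReal.ofReal (√j ^ s / (j - s))), ?_, fun φ hφ y x => ?_⟩
  · have h1 : ENNReal.ofReal (heatConst s) ≠ 0 := by simpa using hc
    have := diffConst_ne_top V
    finiteness
  rcases eq_or_ne y 0 with rfl | hy
  · simp [delta, synth, hj.ne']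
  have hy' : 0 < ‖y‖ := norm_pos_iff.2 hy
  set φs : V → ℂ := fun ξ => ((‖ξ‖ ^ s : ℝ) : ℂ) * φ ξ with hφs
  have hφsN : Nice φs := hφ.norm_rpow_mul hs.le
  set G := gaussMax^[j] (fun x => ‖synth φs x‖ₑ) with hG
  set Tot := ∑ i ∈ Finset.range (j + 1), G (x + (i : ℝ) • y) with hTot
  let m : ℝ → V → ℂ := fun ρ ξ => ((ρ ^ (s - 1) : ℝ) : ℂ) * heat ρ ξ * ((‖ξ‖ ^ s : ℝ) : ℂ) *
    delta y ξ ^ j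
  have hm : Measurable (Function.uncurry m) := by
    have h1 : Measurable fun p : ℝ × V => ((p.1 ^ (s - 1) : ℝ) : ℂ) := by fun_prop
    have h2 : Measurable fun p : ℝ × V => ((‖p.2‖ ^ s : ℝ) : ℂ) := by fun_prop
    have h3 : Measurable fun p : ℝ × V => delta y p.2 ^ j := Continuous.measurable (by fun_prop)
    exact ((h1.mul continuous_heat.measurable).mul h2).mul h3
  have hae : ∀ᵐ ξ : V, ξ ≠ 0 := by
    rw [ae_iff]; simp
  have hmn : ∀ ρ ∈ Ioi (0:ℝ), ∀ ξ, ‖m ρ ξ‖ₑ =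
      ENNReal.ofReal (ρ ^ (s - 1) * ‖heat ρ ξ‖ * ‖ξ‖ ^ s) * ‖delta y ξ ^ j‖ₑ := by
    intro ρ (hρ : 0 < ρ) ξ
    simp only [m, enorm_mul]
    rw [ENNReal.ofReal_mul (by have := le_of_lt hρ; positivity),
      ENNReal.ofReal_mul (Real.rpow_nonneg (le_of_lt hρ) _)]
    congr 2
    · congr 1
      · rw [← ofReal_norm, Complex.norm_of_nonneg (Real.rpow_nonneg (le_of_lt hρ) _)]
      · rw [ofReal_norm]
    · rw [← ofReal_norm, Complex.norm_of_nonneg (by positivity)]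
  have hfin : ∫⁻ ξ, (∫⁻ ρ in Ioi (0:ℝ), ‖m ρ ξ‖ₑ) * ‖φ ξ‖ₑ ≠ ∞ := by
    have hd : ∀ ξ : V, ‖delta y ξ ^ j‖ₑ ≤ 2 ^ j := by
      intro ξ
      rw [enorm_pow]
      gcongr
      rw [← ofReal_norm]
      exact (ENNReal.ofReal_le_ofReal (norm_delta_le y ξ)).trans (by simp)
    have : ∫⁻ ξ, (∫⁻ ρ in Ioi (0:ℝ), ‖m ρ ξ‖ₑ) * ‖φ ξ‖ₑ ≤
        ∫⁻ ξ, (ENNReal.ofReal (heatConst s) * 2 ^ j) * ‖φ ξ‖ₑ := by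
      refine lintegral_mono_ae (hae.mono fun ξ hξ => ?_)
      gcongr
      rw [setLIntegral_congr_fun measurableSet_Ioi fun ρ hρ => hmn ρ hρ ξ,
        lintegral_mul_const' _ _ enorm_ne_top, setLIntegral_rpow_mul_heat hs hξ]
      gcongr
      exact hd ξ
    refine (this.trans_lt ?_).ne
    rw [lintegral_const_mul' _ _ (by finiteness)]
    have := hφ.1.2.ne
    exact ENNReal.mul_lt_top (by finiteness) hφ.1.2
  have hmi : ∀ ξ : V, ξ ≠ 0 → ∫ ρ in Ioi (0:ℝ), m ρ ξ = heatConst s * delta y ξ ^ j := by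
    intro ξ hξ
    rw [integral_mul_const]
    congr 1
    rw [← integral_rpow_mul_heat hs hξ, ← integral_complex_ofReal]
    congr 1; ext ρ
    push_cast
    congr 2
    rw [heat, Complex.norm_of_nonneg (by positivity)]
  have step := enorm_synth_integral_mul_le (μ := volume.restrict (Ioi (0:ℝ))) hm hφ.1 hfin x
  have e1 : synth (fun ξ => (∫ ρ in Ioi (0:ℝ), m ρ ξ) * φ ξ) x =
      heatConst s * synth (fun ξ => delta y ξ ^ j * φ ξ) x := by
    rw [← synth_const_mul]
    refine synth_congr_ae (hae.mono fun ξ hξ => ?_) x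
    simp only [hmi ξ hξ]
    ring
  rw [e1, enorm_mul, ← ofReal_norm, Complex.norm_of_nonneg hc.le] at step
  have small : ∀ ρ : ℝ, ‖synth (fun ξ => heat ρ ξ * (delta y ξ ^ j * φs ξ)) x‖ₑ ≤ 2 ^ j * Tot := by
    intro ρ
    have h := enorm_synth_delta_pow_le_sum (hφsN.mul (locBdd_heat ρ)) j y x
    have e : (fun ξ => heat ρ ξ * (delta y ξ ^ j * φs ξ)) =
      fun ξ => delta y ξ ^ j * (heat ρ ξ * φs ξ) := by ext ξ; ring
    rw [e]
    refine h.trans ?_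
    refine mul_le_mul' le_rfl (Finset.sum_le_sum fun i _ => ?_)
    exact (enorm_synth_heat_le ρ hφsN.1 _).trans (gaussMax_le_iterate _ hj _)
  have large : ∀ ρ : ℝ, √j * ‖y‖ < ρ →
      ‖synth (fun ξ => heat ρ ξ * (delta y ξ ^ j * φs ξ)) x‖ₑ ≤
        (diffConst V * ENNReal.ofReal (√j * ‖y‖ / ρ)) ^ j * G x := by
    intro ρ hρ
    have hsj0 : 0 < √(j:ℝ) := Real.sqrt_pos.2 hj'
    have hρ0 : 0 < ρ := lt_trans (by positivity) hρ
    have h := enorm_synth_delta_heat_pow_le hφsN (ρ := ρ / √j) (y := y) (by positivity)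
      (by rw [le_div_iff₀ hsj0]; linarith) j x
    have e : (fun ξ => heat ρ ξ * (delta y ξ ^ j * φs ξ)) =
      fun ξ => (delta y ξ * heat (ρ / √j) ξ) ^ j * φs ξ := by
      ext ξ
      rw [mul_pow, heat_pow, mul_div_cancel₀ _ hsj0.ne']
      ring
    rw [e]
    refine h.trans (le_of_eq ?_)
    rw [div_div_eq_mul_div, mul_comm ‖y‖]
  have e2 : ∀ ρ ∈ Ioi (0:ℝ), ‖synth (fun ξ => m ρ ξ * φ ξ) x‖ₑ = ENNReal.ofReal (ρ ^ (s - 1)) *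
      ‖synth (fun ξ => heat ρ ξ * (delta y ξ ^ j * φs ξ)) x‖ₑ := by
    intro ρ (hρ : 0 < ρ)
    have : (fun ξ => m ρ ξ * φ ξ) = fun ξ => ((ρ ^ (s - 1) : ℝ) : ℂ) *
        (heat ρ ξ * (delta y ξ ^ j * φs ξ)) := by
      ext ξ; simp only [m, hφs]; ring
    rw [this, synth_const_mul, enorm_mul, ← ofReal_norm,
      Complex.norm_of_nonneg (Real.rpow_nonneg (le_of_lt hρ) _)]
  rw [setLIntegral_congr_fun measurableSet_Ioi e2] at step
  set R := √j * ‖y‖ with hR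
  have hR0 : 0 < R := by
    have := Real.sqrt_pos.2 hj'
    positivity
  have hGTot : G x ≤ Tot := by
    have := Finset.single_le_sum (f := fun i : ℕ => G (x + (i : ℝ) • y)) (fun i _ => zero_le)
      (Finset.mem_range.2 (Nat.succ_pos j))
    simpa using this
  have bound : ∫⁻ ρ in Ioi (0:ℝ), ENNReal.ofReal (ρ ^ (s - 1)) *
      ‖synth (fun ξ => heat ρ ξ * (delta y ξ ^ j * φs ξ)) x‖ₑ ≤
      (2 ^ j * ENNReal.ofReal (√j ^ s / s) +
        diffConst V ^ j * ENNReal.ofReal (√j ^ s / (j - s))) * ENNReal.ofReal (‖y‖ ^ s) * Tot := by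
    rw [← Ioc_union_Ioi_eq_Ioi hR0.le]
    refine (lintegral_union_le _ _ _).trans ?_
    rw [add_mul, add_mul]
    refine add_le_add ?_ ?_
    · calc _ ≤ ∫⁻ ρ in Ioc 0 R, ENNReal.ofReal (ρ ^ (s - 1)) * (2 ^ j * Tot) :=
            lintegral_mono fun ρ => mul_le_mul' le_rfl (small ρ)
        _ = ENNReal.ofReal (R ^ s / s) * (2 ^ j * Tot) := by
            rw [lintegral_mul_const _ (by fun_prop), setLIntegral_Ioc_rpow hs hR0.le]
        _ = _ := by
            rw [hR, Real.mul_rpow (by positivity) (by positivity), mul_div_right_comm,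
              ENNReal.ofReal_mul (by positivity)]
            ring
    · calc _ ≤ ∫⁻ ρ in Ioi R, ENNReal.ofReal (ρ ^ (-(j - s) - 1)) *
              (diffConst V ^ j * ENNReal.ofReal (R ^ j) * Tot) := by
            refine setLIntegral_mono' measurableSet_Ioi fun ρ (hρ : R < ρ) => ?_
            have hρ0 : 0 < ρ := hR0.trans hρ
            refine (mul_le_mul' le_rfl ((large ρ hρ).trans (mul_le_mul' le_rfl hGTot))).trans
              (le_of_eq ?_)
            have : ENNReal.ofReal (ρ ^ (s - 1)) * ENNReal.ofReal (R / ρ) ^ j =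
                ENNReal.ofReal (ρ ^ (-(j - s) - 1)) * ENNReal.ofReal (R ^ j) := by
              rw [← ENNReal.ofReal_pow (by positivity), ← ENNReal.ofReal_mul (by positivity),
                ← ENNReal.ofReal_mul (by positivity), div_pow,
                show (-((j:ℝ) - s) - 1) = (s - 1) - j by ring, Real.rpow_sub hρ0 (s - 1),
                Real.rpow_natCast]
              congr 1; ring
            calc _ = (ENNReal.ofReal (ρ ^ (s - 1)) * ENNReal.ofReal (R / ρ) ^ j) *
                  (diffConst V ^ j * Tot) := by ring
              _ = _ := by rw [this]; ring
        _ = ENNReal.ofReal (R ^ (-((j:ℝ) - s)) / (j - s)) *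
              (diffConst V ^ j * ENNReal.ofReal (R ^ j) * Tot) := by
            rw [lintegral_mul_const _ (by fun_prop), setLIntegral_Ioi_rpow (by linarith) hR0]
        _ = _ := by
            have hjs : 0 < (j:ℝ) - s := by linarith
            have : ENNReal.ofReal (R ^ (-((j:ℝ) - s)) / (j - s)) * ENNReal.ofReal (R ^ j) =
                ENNReal.ofReal (√j ^ s / (j - s)) * ENNReal.ofReal (‖y‖ ^ s) := by
              rw [← ENNReal.ofReal_mul (by positivity), ← ENNReal.ofReal_mul (by positivity)]
              congr 1
              rw [← Real.rpow_natCast R j, div_mul_eq_mul_div, ← Real.rpow_add hR0,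
                show -((j:ℝ) - s) + j = s by ring, hR,
                Real.mul_rpow (by positivity) (by positivity)]
              ring
            calc _ = (ENNReal.ofReal (R ^ (-((j:ℝ) - s)) / (j - s)) * ENNReal.ofReal (R ^ j)) *
                  (diffConst V ^ j * Tot) := by ring
              _ = _ := by rw [this]; ring
  have hc0 : ENNReal.ofReal (heatConst s) ≠ 0 := by simpa using hc
  have := step.trans bound
  rw [ENNReal.mul_le_iff_le_inv hc0 ENNReal.ofReal_ne_top] at this
  refine this.trans (le_of_eq ?_)
  ring

end Differences

section Interpolation

variable {V : Type*} [NormedAddCommGroup V] [InnerProductSpace ℝ V] [FiniteDimensional ℝ V]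
  [MeasurableSpace V] [BorelSpace V]

/-! ### Averaged differences -/

lemma rpow_le_exp_add {r t : ℝ} (hr : 0 ≤ r) (ht : 0 ≤ t) :
    t ^ r ≤ Real.exp (r ^ 2 + t ^ 2 / 4) := by
  rcases ht.eq_or_lt with rfl | ht
  · exact (Real.zero_rpow_le_one r).trans (Real.one_le_exp (by positivity))
  · rw [Real.rpow_def_of_pos ht, Real.exp_le_exp]
    have := Real.log_le_self ht.le
    nlinarith [sq_nonneg (r - t / 2)]

lemma lintegral_gauss_rpow_mul_le {r : ℝ} (hr : 0 ≤ r) {H : V → ℝ≥0∞} (hH : Measurable H)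
    (ρ : ℝ) (x : V) :
    ∫⁻ y, ENNReal.ofReal (‖y‖ ^ r) * H (x + ρ • y) ∂(gauss V) ≤
      ENNReal.ofReal (Real.exp (r ^ 2)) * 2 ^ Module.finrank ℝ V * gaussMax H x := by
  rw [lintegral_gauss, mul_assoc]
  refine le_trans ?_ (mul_le_mul' le_rfl (lintegral_gaussian_half_le H hH (ρ := ρ) x))
  rw [← lintegral_const_mul _ (by fun_prop)]
  refine lintegral_mono fun y => ?_
  show _ * (_ * _) ≤ _
  rw [← mul_assoc, ← mul_assoc, ← ENNReal.ofReal_mul (by positivity),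
    ← ENNReal.ofReal_mul (by positivity)]
  refine mul_le_mul' (ENNReal.ofReal_le_ofReal ?_) le_rfl
  refine (mul_le_mul_of_nonneg_left (rpow_le_exp_add hr (norm_nonneg y))
    (Real.exp_pos _).le).trans ?_
  rw [← Real.exp_add, ← Real.exp_add, Real.exp_le_exp, norm_smul, mul_pow]
  norm_num
  nlinarith [Real.pi_gt_three, sq_nonneg ‖y‖]

/-- `‖ξ‖^s φ`, the symbol side of the fractional derivative of order `s`. -/
noncomputable def riesz (s : ℝ) (φ : V → ℂ) (ξ : V) : ℂ := ((‖ξ‖ ^ s : ℝ) : ℂ) * φ ξ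

lemma Nice.riesz {φ : V → ℂ} (hφ : Nice φ) {s : ℝ} (hs : 0 ≤ s) : Nice (riesz s φ) :=
  hφ.norm_rpow_mul hs

@[simp] lemma riesz_zero (φ : V → ℂ) : riesz 0 φ = φ := by
  ext ξ; simp [riesz]

variable (V) in
lemma exists_enorm_synth_delta_pow_le' [Nontrivial V] {s : ℝ} {j : ℕ} (hs : 0 ≤ s) (hsj : s < j) :
    ∃ C : ℝ≥0∞, C ≠ ∞ ∧ ∀ φ : V → ℂ, Nice φ → ∀ y x : V,
      ‖synth (fun ξ => delta y ξ ^ j * φ ξ) x‖ₑ ≤ C * ENNReal.ofReal (‖y‖ ^ s) *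
        ∑ i ∈ Finset.range (j + 1),
          gaussMax^[j] (fun x => ‖synth (riesz s φ) x‖ₑ) (x + (i : ℝ) • y) := by
  rcases hs.eq_or_lt with rfl | hs
  · refine ⟨2 ^ j, by finiteness, fun φ hφ y x => (enorm_synth_delta_pow_le_sum hφ j y x).trans ?_⟩
    simp only [Real.rpow_zero, ENNReal.ofReal_one, mul_one, riesz_zero]
    exact mul_le_mul' le_rfl (Finset.sum_le_sum fun i _ => le_iterate_gaussMax _ _ _)
  · exact exists_enorm_synth_delta_pow_le V hs hsj

variable (V) in
lemma exists_lintegral_synth_delta_pow_le [Nontrivial V] {s r : ℝ} {j : ℕ} (hs : 0 ≤ s)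
    (hsj : s < j) (hr : 1 ≤ r) :
    ∃ C : ℝ≥0∞, C ≠ ∞ ∧ ∀ φ : V → ℂ, Nice φ → ∀ (a : ℝ) (x : V), ∀ ρ > 0,
      ∫⁻ y, ‖synth (fun ξ => delta (ρ • y) ξ ^ j * φ ξ) (x + (a * ρ) • y)‖ₑ ^ r ∂(gauss V) ≤
        C * ENNReal.ofReal (ρ ^ (s * r)) *
          gaussMax (fun x => gaussMax^[j] (fun x => ‖synth (riesz s φ) x‖ₑ) x ^ r) x := by
  obtain ⟨C, hC, hCb⟩ := exists_enorm_synth_delta_pow_le' V hs hsj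
  have hr0 : 0 ≤ r := by linarith
  refine ⟨C ^ r * ((j + 1 : ℕ) ^ (r - 1) * ((j + 1 : ℕ) *
    (ENNReal.ofReal (Real.exp ((s * r) ^ 2)) * 2 ^ Module.finrank ℝ V))), ?_, ?_⟩
  · have : (0:ℝ) ≤ r - 1 := by linarith
    finiteness
  intro φ hφ a x ρ hρ
  set U := gaussMax^[j] (fun x => ‖synth (riesz s φ) x‖ₑ) with hU
  have hUm : Measurable U := (lowerSemicontinuous_iterate_gaussMax
    (lowerSemicontinuous_enorm_synth (hφ.riesz hs).1) j).measurable
  have hpt : ∀ y : V, ‖synth (fun ξ => delta (ρ • y) ξ ^ j * φ ξ) (x + (a * ρ) • y)‖ₑ ^ r ≤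
      C ^ r * ENNReal.ofReal (ρ ^ (s * r)) * ((j + 1 : ℕ) ^ (r - 1) *
        ∑ i ∈ Finset.range (j + 1), ENNReal.ofReal (‖y‖ ^ (s * r)) *
          U (x + ((a + i) * ρ) • y) ^ r) := by
    intro y
    refine (ENNReal.rpow_le_rpow (hCb φ hφ (ρ • y) _) hr0).trans ?_
    rw [ENNReal.mul_rpow_of_nonneg _ _ hr0, ENNReal.mul_rpow_of_nonneg _ _ hr0,
      ENNReal.ofReal_rpow_of_nonneg (by positivity) hr0, ← Real.rpow_mul (norm_nonneg _),
      norm_smul, Real.norm_of_nonneg hρ.le, Real.mul_rpow hρ.le (norm_nonneg _),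
      ENNReal.ofReal_mul (by positivity), ← Finset.mul_sum]
    have h := ENNReal.rpow_sum_le_const_mul_sum_rpow (Finset.range (j + 1))
      (fun i : ℕ => U (x + (a * ρ) • y + (i : ℝ) • ρ • y)) hr
    rw [Finset.card_range] at h
    refine (mul_le_mul' le_rfl h).trans (le_of_eq ?_)
    have e : ∀ i : ℕ, x + (a * ρ) • y + (i : ℝ) • ρ • y = x + ((a + i) * ρ) • y := by
      intro i; rw [smul_smul, add_assoc, ← add_smul, add_mul]
    simp_rw [e]
    ring
  refine (lintegral_mono hpt).trans ?_
  rw [lintegral_const_mul _ (by fun_prop), lintegral_const_mul _ (by fun_prop),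
    lintegral_finsetSum _ (fun i _ => by fun_prop)]
  have hs' : ∑ i ∈ Finset.range (j + 1), ∫⁻ y, ENNReal.ofReal (‖y‖ ^ (s * r)) *
      U (x + ((a + i) * ρ) • y) ^ r ∂(gauss V) ≤ (j + 1 : ℕ) *
      (ENNReal.ofReal (Real.exp ((s * r) ^ 2)) * 2 ^ Module.finrank ℝ V *
        gaussMax (fun x => U x ^ r) x) := by
    refine (Finset.sum_le_card_nsmul _ _ _ fun i _ => lintegral_gauss_rpow_mul_le (by positivity)
      (hUm.pow_const r) _ x).trans (le_of_eq ?_)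
    rw [Finset.card_range, nsmul_eq_mul]
  refine (mul_le_mul' le_rfl (mul_le_mul' le_rfl hs')).trans (le_of_eq ?_)
  ring

end Interpolation

section Representation

variable {V : Type*} [NormedAddCommGroup V] [InnerProductSpace ℝ V] [FiniteDimensional ℝ V]
  [MeasurableSpace V] [BorelSpace V]

/-! ### Representation of `‖ξ‖^s` by differences -/

lemma delta_smul_comm (c : ℝ) (y ξ : V) : delta (c • y) ξ = delta y (c • ξ) := by
  rw [delta, delta, wave_smul_comm]

lemma norm_delta_le_mul (y ξ : V) : ‖delta y ξ‖ ≤ 2 * Real.pi * ‖ξ‖ * ‖y‖ := by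
  rw [delta, wave, mul_comm _ Complex.I]
  refine Real.norm_exp_I_mul_ofReal_sub_one_le.trans ?_
  rw [norm_mul, Real.norm_of_nonneg (by positivity), mul_assoc (2 * Real.pi)]
  have := norm_inner_le_norm (𝕜 := ℝ) y ξ
  rw [mul_comm ‖y‖] at this
  gcongr

lemma measurable_enorm_delta_pow (n : ℕ) (ξ : V) : Measurable fun y => ‖delta y ξ‖ₑ ^ n :=
  (Continuous.measurable (by fun_prop)).enorm.pow_const n

/-- Gaussian average of `|e^{2πi⟨y,ξ⟩} - 1|^n`. -/
noncomputable def deltaMean (n : ℕ) (ξ : V) : ℝ≥0∞ := ∫⁻ y, ‖delta y ξ‖ₑ ^ n ∂(gauss V)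

lemma deltaMean_le_two_pow (n : ℕ) (ξ : V) : deltaMean n ξ ≤ 2 ^ n := by
  refine (lintegral_mono fun y => (?_ : _ ≤ (2:ℝ≥0∞) ^ n)).trans (by simp)
  gcongr
  rw [← ofReal_norm]
  exact (ENNReal.ofReal_le_ofReal (norm_delta_le y ξ)).trans (by simp)

variable (V) in
lemma lintegral_gauss_pow_ne_top (n : ℕ) :
    ∫⁻ y, ENNReal.ofReal (‖y‖ ^ (n : ℝ)) ∂(gauss V) ≠ ∞ := by
  have h := lintegral_gauss_rpow_mul_le (V := V) (r := n) (by positivity)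
    (H := fun _ => 1) (by fun_prop) 0 0
  simp only [mul_one] at h
  refine ne_top_of_le_ne_top ?_ h
  have : gaussMax (fun _ : V => (1:ℝ≥0∞)) 0 = 1 := by simp [gaussMax, gaussAvg]
  rw [this]
  finiteness

lemma deltaMean_le_mul (n : ℕ) (ξ : V) :
    deltaMean n ξ ≤ ENNReal.ofReal ((2 * Real.pi * ‖ξ‖) ^ n) *
      ∫⁻ y, ENNReal.ofReal (‖y‖ ^ (n : ℝ)) ∂(gauss V) := by
  rw [← lintegral_const_mul _ (by fun_prop)]
  refine lintegral_mono fun y => ?_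
  rw [← ENNReal.ofReal_mul (by positivity), Real.rpow_natCast, ← mul_pow, ← ofReal_norm,
    ← ENNReal.ofReal_pow (norm_nonneg _)]
  exact ENNReal.ofReal_le_ofReal (pow_le_pow_left₀ (norm_nonneg _) (norm_delta_le_mul y ξ) n)

lemma deltaMean_congr (n : ℕ) {ξ η : V} (h : ‖ξ‖ = ‖η‖) : deltaMean n ξ = deltaMean n η := by
  set L := (Submodule.span ℝ {ξ - η})ᗮ.reflection
  have hL : L ξ = η := Submodule.reflection_sub h
  unfold deltaMean
  have hm : Measurable fun y => ENNReal.ofReal (Real.exp (-Real.pi * ‖y‖ ^ 2)) * ‖delta y η‖ₑ ^ n :=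
    Measurable.mul (by fun_prop) (measurable_enorm_delta_pow n η)
  rw [lintegral_gauss, lintegral_gauss, ← L.measurePreserving.lintegral_comp hm]
  refine lintegral_congr fun y => ?_
  rw [L.norm_map, ← hL, delta, delta, wave, wave, L.inner_map_map]

lemma measurable_deltaMean (n : ℕ) : Measurable (deltaMean n : V → ℝ≥0∞) := by
  unfold deltaMean
  have : Measurable (Function.uncurry fun (ξ y : V) => ‖delta y ξ‖ₑ ^ n) :=
    (Continuous.measurable
      (by fun_prop : Continuous fun p : V × V => delta p.2 p.1)).enorm.pow_const n
  exact this.lintegral_prod_right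

/-- `∫ ρ^{-1-s} ⨍ |e^{2πiρ⟨y,ξ⟩} - 1|^n dγ(y) dρ`. -/
noncomputable def deltaIntegral (s : ℝ) (n : ℕ) (ξ : V) : ℝ≥0∞ :=
  ∫⁻ ρ in Ioi (0:ℝ), ENNReal.ofReal (ρ ^ (-1 - s)) * deltaMean n (ρ • ξ)

lemma deltaIntegral_smul (s : ℝ) (n : ℕ) {t : ℝ} (ht : 0 < t) (ξ : V) :
    deltaIntegral s n (t • ξ) = ENNReal.ofReal (t ^ s) * deltaIntegral s n ξ := by
  have hmeas : Measurable ((Ioi (0:ℝ)).indicator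
      fun ρ : ℝ => ENNReal.ofReal (ρ ^ (-1 - s)) * deltaMean n (ρ • ξ)) := by
    have := (measurable_deltaMean n (V := V)).comp (by fun_prop : Measurable fun ρ : ℝ => ρ • ξ)
    exact Measurable.indicator (Measurable.mul (by fun_prop) this) measurableSet_Ioi
  have h := lintegral_comp_add_smul hmeas (0:ℝ) ht.ne'
  rw [lintegral_indicator measurableSet_Ioi] at h
  change _ = _ * deltaIntegral s n ξ at h
  simp only [Module.finrank_self, pow_one, zero_add, smul_eq_mul] at h
  have e : ∀ ρ : ℝ, (Ioi (0:ℝ)).indicator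
      (fun ρ : ℝ => ENNReal.ofReal (ρ ^ (-1 - s)) * deltaMean n (ρ • t • ξ)) ρ =
      ENNReal.ofReal (t ^ (1 + s)) * (Ioi (0:ℝ)).indicator
      (fun ρ : ℝ => ENNReal.ofReal (ρ ^ (-1 - s)) * deltaMean n (ρ • ξ)) (t * ρ) := by
    intro ρ
    by_cases hρ : 0 < ρ
    · rw [indicator_of_mem (by exact hρ), indicator_of_mem (by exact mul_pos ht hρ), ← mul_assoc,
        ← ENNReal.ofReal_mul (by positivity), Real.mul_rpow ht.le hρ.le, ← mul_assoc,
        ← Real.rpow_add ht, smul_smul, mul_comm t ρ]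
      simp
    · have h2 : ¬ 0 < t * ρ := fun h => hρ (pos_of_mul_pos_right h ht.le)
      rw [indicator_of_notMem (by exact hρ), indicator_of_notMem (by exact h2), mul_zero]
  rw [deltaIntegral, ← lintegral_indicator measurableSet_Ioi, lintegral_congr e,
    lintegral_const_mul' _ _ ENNReal.ofReal_ne_top, h, ← mul_assoc,
    ← ENNReal.ofReal_mul (by positivity), abs_of_pos (by positivity)]
  congr 2
  rw [Real.rpow_add ht, Real.rpow_one]
  field_simp

lemma deltaIntegral_ne_top {s : ℝ} {n : ℕ} (hs : 0 < s) (hsn : s < n) (ξ : V) :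
    deltaIntegral s n ξ ≠ ∞ := by
  set M := ∫⁻ y, ENNReal.ofReal (‖y‖ ^ (n : ℝ)) ∂(gauss V)
  have hM : M ≠ ∞ := lintegral_gauss_pow_ne_top V n
  refine ne_top_of_le_ne_top ?_ ((setLIntegral_mono' measurableSet_Ioi fun ρ (hρ : 0 < ρ) =>
    (?_ : _ ≤ min (ENNReal.ofReal (ρ ^ ((n - s) - 1)) *
        (ENNReal.ofReal ((2 * Real.pi * ‖ξ‖) ^ n) * M))
      (ENNReal.ofReal (ρ ^ (-s - 1)) * 2 ^ n))).trans
      (lintegral_min_rpow_le (sub_pos.2 hsn) hs _ _))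
  · have h1 : 0 ≤ s / (n - s + s) := by rw [sub_add_cancel]; positivity
    have h2 : 0 ≤ (n - s) / (n - s + s) := by
      rw [sub_add_cancel]; exact div_nonneg (by linarith) (by positivity)
    finiteness
  · refine le_min ?_ ?_
    · refine (mul_le_mul' le_rfl (deltaMean_le_mul n _)).trans (le_of_eq ?_)
      rw [← mul_assoc, ← mul_assoc, ← ENNReal.ofReal_mul (by positivity),
        ← ENNReal.ofReal_mul (by positivity), norm_smul, Real.norm_of_nonneg hρ.le,
        show (n:ℝ) - s - 1 = (-1 - s) + n by ring, Real.rpow_add hρ, Real.rpow_natCast]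
      congr 2; ring
    · rw [show -s - 1 = -1 - s by ring]
      exact mul_le_mul' le_rfl (deltaMean_le_two_pow n _)

lemma deltaIntegral_ne_zero {s : ℝ} {n : ℕ} {ξ : V} (hξ : ξ ≠ 0) :
    deltaIntegral s n ξ ≠ 0 := by
  intro h
  have hmeas : Measurable fun ρ : ℝ => ENNReal.ofReal (ρ ^ (-1 - s)) * deltaMean n (ρ • ξ) := by
    have := (measurable_deltaMean n (V := V)).comp (by fun_prop : Measurable fun ρ : ℝ => ρ • ξ)
    exact Measurable.mul (by fun_prop) this
  rw [deltaIntegral, lintegral_eq_zero_iff hmeas, EventuallyEq,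
    ae_restrict_iff' measurableSet_Ioi] at h
  have hne : (volume.restrict (Ioi (0:ℝ))) ≠ 0 := by simp
  rw [← ae_restrict_iff' measurableSet_Ioi] at h
  have : (ae (volume.restrict (Ioi (0:ℝ)))).NeBot := ae_neBot.2 hne
  obtain ⟨ρ, hρ, hρ0⟩ := (h.and (ae_restrict_mem measurableSet_Ioi)).exists
  have hρ0 : 0 < ρ := hρ0
  have hp : ENNReal.ofReal (ρ ^ (-1 - s)) ≠ 0 := by
    simpa using Real.rpow_pos_of_pos hρ0 _
  have h0 : deltaMean n (ρ • ξ) = 0 := by simpa [hp] using hρ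
  rw [deltaMean, lintegral_eq_zero_iff (measurable_enorm_delta_pow n _)] at h0
  have hw : (fun y => wave (ρ • y) ξ) =ᵐ[gauss V] fun _ => 1 := by
    refine h0.mono fun y hy => ?_
    have : delta y (ρ • ξ) = 0 := by
      by_contra hcon
      simp [hcon] at hy
    rwa [← delta_smul_comm, delta, sub_eq_zero] at this
  have h1 := integral_gauss_wave_smul ρ ξ
  rw [integral_congr_ae hw] at h1
  simp only [integral_const, probReal_univ, one_smul, heat] at h1
  have h2 : (1:ℝ) = Real.exp (-Real.pi * ‖ρ • ξ‖ ^ 2) := by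
    rw [norm_smul, mul_pow, Real.norm_eq_abs, sq_abs]
    exact_mod_cast h1
  have h3 : Real.exp (-Real.pi * ‖ρ • ξ‖ ^ 2) < 1 := by
    rw [Real.exp_lt_one_iff]
    have : 0 < ‖ρ • ξ‖ := norm_pos_iff.2 (smul_ne_zero hρ0.ne' hξ)
    have := Real.pi_pos
    nlinarith [mul_pos this (pow_pos ‹0 < ‖ρ • ξ‖› 2)]
  exact h3.ne h2.symm

variable (V) in
lemma exists_deltaIntegral_eq [Nontrivial V] {s : ℝ} {n : ℕ} (hs : 0 < s) (hsn : s < n) :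
    ∃ c : ℝ, 0 < c ∧ ∀ ξ : V, deltaIntegral s n ξ = ENNReal.ofReal (c * ‖ξ‖ ^ s) := by
  obtain ⟨e, he⟩ := exists_norm_eq V (zero_le_one)
  have he0 : e ≠ 0 := by rintro rfl; simp at he
  have hn : n ≠ 0 := by
    rintro rfl
    simp only [Nat.cast_zero] at hsn
    linarith
  refine ⟨(deltaIntegral s n e).toReal, ENNReal.toReal_pos (deltaIntegral_ne_zero he0)
    (deltaIntegral_ne_top hs hsn e), fun ξ => ?_⟩
  rcases eq_or_ne ξ 0 with rfl | hξ
  · simp [deltaIntegral, deltaMean, delta, hn, Real.zero_rpow hs.ne']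
  · have h0 : 0 < ‖ξ‖ := norm_pos_iff.2 hξ
    have : deltaIntegral s n ξ = deltaIntegral s n (‖ξ‖ • e) := by
      unfold deltaIntegral
      congr 1; ext ρ; congr 1
      refine deltaMean_congr n ?_
      rw [norm_smul, norm_smul, norm_smul, norm_norm, he, mul_one]
    rw [this, deltaIntegral_smul s n h0, ENNReal.ofReal_mul ENNReal.toReal_nonneg,
      ENNReal.ofReal_toReal (deltaIntegral_ne_top hs hsn e), mul_comm]

end Representation

section GagliardoNirenberg

variable {V : Type*} [NormedAddCommGroup V] [InnerProductSpace ℝ V] [FiniteDimensional ℝ V]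
  [MeasurableSpace V] [BorelSpace V]

/-! ### Interpolation of fractional derivatives -/

variable (V) in
/-- The measure `ρ^{-1-s} dρ dγ(y)` on `(0,∞) × V`. -/
noncomputable def diffMeasure (s : ℝ) : Measure (ℝ × V) :=
  ((volume.restrict (Ioi (0:ℝ))).withDensity fun ρ => ENNReal.ofReal (ρ ^ (-1 - s))).prod (gauss V)

instance (s : ℝ) : SFinite (diffMeasure V s) := by
  unfold diffMeasure; infer_instance

lemma lintegral_diffMeasure (s : ℝ) {f : ℝ × V → ℝ≥0∞} (hf : Measurable f) :
    ∫⁻ t, f t ∂(diffMeasure V s) = ∫⁻ ρ in Ioi (0:ℝ), ENNReal.ofReal (ρ ^ (-1 - s)) *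
      ∫⁻ y, f (ρ, y) ∂(gauss V) := by
  rw [diffMeasure, lintegral_prod _ hf.aemeasurable,
    lintegral_withDensity_eq_lintegral_mul _ (by fun_prop) hf.lintegral_prod_right']
  rfl

lemma measurable_delta_smul (ξ : V) : Measurable fun t : ℝ × V => delta (t.1 • t.2) ξ :=
  Continuous.measurable (by fun_prop)

lemma lintegral_diffMeasure_delta_pow (s : ℝ) (n : ℕ) (ξ : V) :
    ∫⁻ t, ‖delta (t.1 • t.2) ξ‖ₑ ^ n ∂(diffMeasure V s) = deltaIntegral s n ξ := by
  rw [lintegral_diffMeasure s ((measurable_delta_smul ξ).enorm.pow_const n)]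
  simp_rw [delta_smul_comm]
  rfl

variable (V) in
lemma exists_integral_diffMeasure_eq [Nontrivial V] {s : ℝ} {n : ℕ} (hs : 0 < s) (hsn : s < n) :
    ∃ c : ℝ, 0 < c ∧ ∀ ξ : V,
      Integrable (fun t : ℝ × V => ((‖delta (t.1 • t.2) ξ‖ ^ n : ℝ) : ℂ)) (diffMeasure V s) ∧
      ∫⁻ t, ‖delta (t.1 • t.2) ξ‖ₑ ^ n ∂(diffMeasure V s) = ENNReal.ofReal (c * ‖ξ‖ ^ s) ∧
      ∫ t, ((‖delta (t.1 • t.2) ξ‖ ^ n : ℝ) : ℂ) ∂(diffMeasure V s) = ((c * ‖ξ‖ ^ s : ℝ) : ℂ) := by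
  obtain ⟨c, hc, h⟩ := exists_deltaIntegral_eq V hs hsn
  refine ⟨c, hc, fun ξ => ?_⟩
  have hl : ∫⁻ t, ‖delta (t.1 • t.2) ξ‖ₑ ^ n ∂(diffMeasure V s) = ENNReal.ofReal (c * ‖ξ‖ ^ s) := by
    rw [lintegral_diffMeasure_delta_pow, h]
  have hm : Measurable fun t : ℝ × V => ‖delta (t.1 • t.2) ξ‖ ^ n :=
    (measurable_delta_smul ξ).norm.pow_const n
  have he : ∀ t : ℝ × V, ENNReal.ofReal (‖delta (t.1 • t.2) ξ‖ ^ n) =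
      ‖delta (t.1 • t.2) ξ‖ₑ ^ n := fun t => by
    rw [← ofReal_norm, ENNReal.ofReal_pow (norm_nonneg _)]
  refine ⟨⟨(Complex.measurable_ofReal.comp hm).aestronglyMeasurable, ?_⟩, hl, ?_⟩
  · have he' : ∀ t : ℝ × V, ‖((‖delta (t.1 • t.2) ξ‖ ^ n : ℝ) : ℂ)‖ₑ =
        ‖delta (t.1 • t.2) ξ‖ₑ ^ n := fun t => by
      rw [← he, ← ofReal_norm, Complex.norm_of_nonneg (by positivity)]
    rw [hasFiniteIntegral_iff_enorm, lintegral_congr he', hl]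
    exact ENNReal.ofReal_lt_top
  · rw [integral_complex_ofReal, integral_eq_lintegral_of_nonneg_ae
      (Eventually.of_forall fun t => by positivity) hm.aestronglyMeasurable, lintegral_congr he, hl,
      ENNReal.toReal_ofReal (by positivity)]

lemma norm_delta_pow_eq (k : ℕ) (y ξ : V) :
    ((‖delta y ξ‖ ^ (2 * k) : ℝ) : ℂ) =
      (-1) ^ k * (delta y ξ ^ (2 * k) * wave ((-k : ℝ) • y) ξ) := by
  have h1 : wave ((-k : ℝ) • y) ξ = (wave y ξ)⁻¹ ^ k := by
    have := wave_intCast_smul (-(k:ℤ)) y ξ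
    push_cast at this
    rw [this, zpow_neg, zpow_natCast, inv_pow]
  have hw : wave y ξ * (wave y ξ)⁻¹ = 1 := mul_inv_cancel₀ (wave_ne_zero y ξ)
  have h2 : ((‖delta y ξ‖ ^ 2 : ℝ) : ℂ) = -(delta y ξ ^ 2 * (wave y ξ)⁻¹) := by
    have hi : (wave y ξ)⁻¹ = (starRingEnd ℂ) (wave y ξ) := by
      rw [Complex.inv_def, Complex.normSq_eq_norm_sq, norm_wave]; simp
    push_cast
    rw [← Complex.mul_conj', delta, map_sub, map_one, ← hi]
    linear_combination (wave y ξ - 1) * hw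
  rw [pow_mul, Complex.ofReal_pow, h2, h1, pow_mul (delta y ξ)]
  rw [neg_pow, mul_pow]

lemma measurable_synth_mul {T : Type*} [MeasurableSpace T] {m : T → V → ℂ}
    (hm : Measurable (Function.uncurry m)) {φ : V → ℂ} (hφ : AEStronglyMeasurable φ)
    {X : T → V} (hX : Measurable X) :
    Measurable fun t => synth (fun ξ => m t ξ * φ ξ) (X t) := by
  have e : (fun t => synth (fun ξ => m t ξ * φ ξ) (X t)) =
      fun t => ∫ ξ, wave (X t) ξ * (m t ξ * hφ.mk φ ξ) := by
    ext t
    refine synth_congr_ae (hφ.ae_eq_mk.mono fun ξ hξ => ?_) _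
    simp only [hξ]
  rw [e]
  have hw : Measurable fun p : T × V => wave (X p.1) p.2 := by
    have : Continuous fun p : V × V => wave p.1 p.2 := by fun_prop
    exact this.measurable.comp (by fun_prop : Measurable fun p : T × V => (X p.1, p.2))
  have : Measurable fun p : T × V => wave (X p.1) p.2 * (m p.1 p.2 * hφ.mk φ p.2) :=
    hw.mul (hm.mul (hφ.stronglyMeasurable_mk.measurable.comp measurable_snd))
  exact (this.stronglyMeasurable.integral_prod_right (f := fun t ξ =>
    wave (X t) ξ * (m t ξ * hφ.mk φ ξ))).measurable

variable (V) in
lemma exists_enorm_synth_riesz_le [Nontrivial V] {s β : ℝ} (hs : 0 < s) (hsβ : s < β) :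
    ∃ (C : ℝ≥0∞) (n : ℕ), C ≠ ∞ ∧ ∀ φ : V → ℂ, Nice φ → ∀ x : V,
      ‖synth (riesz s φ) x‖ₑ ≤ C *
        ((gaussMax^[n] (fun x => ‖synth φ x‖ₑ) x) ^ (1 - s / β) *
          (gaussMax^[n] (fun x => ‖synth (riesz β φ) x‖ₑ) x) ^ (s / β)) := by
  obtain ⟨k, hk⟩ := exists_nat_gt β
  have hβ : 0 < β := hs.trans hsβ
  have hβn : β < (2 * k : ℕ) := by push_cast; linarith
  obtain ⟨c, hc, hcs⟩ := exists_integral_diffMeasure_eq V hs (hsβ.trans hβn)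
  obtain ⟨C₀, hC₀, h₀⟩ := exists_lintegral_synth_delta_pow_le V le_rfl (hβ.trans hβn) le_rfl
  obtain ⟨C₁, hC₁, h₁⟩ := exists_lintegral_synth_delta_pow_le V hβ.le hβn le_rfl
  have hc0 : ENNReal.ofReal c ≠ 0 := by simpa using hc
  have hsβ' : 0 < 1 - s / β := by rw [sub_pos, div_lt_one hβ]; exact hsβ
  refine ⟨(ENNReal.ofReal c)⁻¹ * (ENNReal.ofReal (1 / (β - s) + 1 / s) *
    (C₁ ^ (s / β) * C₀ ^ (1 - s / β))), 2 * k + 1, ?_, fun φ hφ x => ?_⟩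
  · have : 0 ≤ s / β := by positivity
    finiteness
  set A := gaussMax^[2 * k + 1] (fun x => ‖synth φ x‖ₑ) x with hA
  set B := gaussMax^[2 * k + 1] (fun x => ‖synth (riesz β φ) x‖ₑ) x with hB
  have hm : Measurable (Function.uncurry fun (t : ℝ × V) (ξ : V) =>
      ((‖delta (t.1 • t.2) ξ‖ ^ (2 * k) : ℝ) : ℂ)) :=
    Continuous.measurable (by
      show Continuous fun p : (ℝ × V) × V => ((‖delta (p.1.1 • p.1.2) p.2‖ ^ (2 * k) : ℝ) : ℂ)
      fun_prop)
  have hen : ∀ (t : ℝ × V) (ξ : V), ‖((‖delta (t.1 • t.2) ξ‖ ^ (2 * k) : ℝ) : ℂ)‖ₑ =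
      ‖delta (t.1 • t.2) ξ‖ₑ ^ (2 * k) := fun t ξ => by
    rw [← ofReal_norm, Complex.norm_of_nonneg (by positivity), ← ofReal_norm,
      ENNReal.ofReal_pow (norm_nonneg _)]
  have hfin : ∫⁻ ξ, (∫⁻ t, ‖((‖delta (t.1 • t.2) ξ‖ ^ (2 * k) : ℝ) : ℂ)‖ₑ ∂(diffMeasure V s)) *
      ‖φ ξ‖ₑ ≠ ∞ := by
    have e : ∀ ξ : V, (∫⁻ t, ‖((‖delta (t.1 • t.2) ξ‖ ^ (2 * k) : ℝ) : ℂ)‖ₑ ∂(diffMeasure V s)) *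
        ‖φ ξ‖ₑ = ENNReal.ofReal c * ‖riesz s φ ξ‖ₑ := by
      intro ξ
      simp_rw [hen]
      rw [(hcs ξ).2.1, riesz, enorm_mul, ENNReal.ofReal_mul hc.le, mul_assoc,
        ← ofReal_norm ((‖ξ‖ ^ s : ℝ) : ℂ), Complex.norm_of_nonneg (by positivity)]
    rw [lintegral_congr e, lintegral_const_mul' _ _ ENNReal.ofReal_ne_top]
    exact ENNReal.mul_ne_top ENNReal.ofReal_ne_top (hφ.riesz hs.le).1.2.ne
  have step := enorm_synth_integral_mul_le hm hφ.1 hfin x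
  have e1 : (fun ξ => (∫ t, ((‖delta (t.1 • t.2) ξ‖ ^ (2 * k) : ℝ) : ℂ) ∂(diffMeasure V s)) * φ ξ) =
      fun ξ => (c : ℂ) * riesz s φ ξ := by
    ext ξ
    rw [(hcs ξ).2.2, riesz]; push_cast; ring
  have e2 : ∀ t : ℝ × V,
      ‖synth (fun ξ => ((‖delta (t.1 • t.2) ξ‖ ^ (2 * k) : ℝ) : ℂ) * φ ξ) x‖ₑ =
      ‖synth (fun ξ => delta (t.1 • t.2) ξ ^ (2 * k) * φ ξ) (x + ((-k : ℝ) * t.1) • t.2)‖ₑ := by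
    intro t
    rw [mul_smul, ← synth_wave_mul]
    have : (fun ξ => ((‖delta (t.1 • t.2) ξ‖ ^ (2 * k) : ℝ) : ℂ) * φ ξ) = fun ξ => (-1) ^ k *
        (wave ((-k : ℝ) • t.1 • t.2) ξ * (delta (t.1 • t.2) ξ ^ (2 * k) * φ ξ)) := by
      ext ξ; rw [norm_delta_pow_eq]; ring
    rw [this, synth_const_mul, enorm_mul, enorm_pow]
    simp
  have hmeas : Measurable fun t : ℝ × V =>
      ‖synth (fun ξ => delta (t.1 • t.2) ξ ^ (2 * k) * φ ξ) (x + ((-k : ℝ) * t.1) • t.2)‖ₑ := by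
    refine (measurable_synth_mul (Continuous.measurable ?_) hφ.1.1 (by fun_prop)).enorm
    show Continuous fun p : (ℝ × V) × V => delta (p.1.1 • p.1.2) p.2 ^ (2 * k)
    fun_prop
  rw [e1, synth_const_mul, enorm_mul, ← ofReal_norm, Complex.norm_of_nonneg hc.le,
    lintegral_congr e2, lintegral_diffMeasure s hmeas] at step
  have bound : ∀ ρ ∈ Ioi (0:ℝ), ENNReal.ofReal (ρ ^ (-1 - s)) * ∫⁻ y,
      ‖synth (fun ξ => delta (ρ • y) ξ ^ (2 * k) * φ ξ) (x + ((-k : ℝ) * ρ) • y)‖ₑ ∂(gauss V) ≤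
      min (ENNReal.ofReal (ρ ^ ((β - s) - 1)) * (C₁ * B))
        (ENNReal.ofReal (ρ ^ (-s - 1)) * (C₀ * A)) := by
    intro ρ (hρ : 0 < ρ)
    have b₀ := h₀ φ hφ (-k) x ρ hρ
    have b₁ := h₁ φ hφ (-k) x ρ hρ
    simp only [ENNReal.rpow_one, mul_one, riesz_zero, Real.rpow_zero, ENNReal.ofReal_one] at b₀ b₁
    rw [← Function.iterate_succ_apply' gaussMax] at b₀ b₁
    refine le_min ?_ ?_
    · refine (mul_le_mul' le_rfl b₁).trans (le_of_eq ?_)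
      rw [show β - s - 1 = (-1 - s) + β by ring, Real.rpow_add hρ,
        ENNReal.ofReal_mul (by positivity)]
      ring
    · refine (mul_le_mul' le_rfl b₀).trans (le_of_eq ?_)
      rw [show -s - 1 = -1 - s by ring]
  have := step.trans ((setLIntegral_mono' measurableSet_Ioi bound).trans
    (lintegral_min_rpow_le (sub_pos.2 hsβ) hs _ _))
  rw [ENNReal.mul_le_iff_le_inv hc0 ENNReal.ofReal_ne_top, sub_add_cancel,
    ENNReal.mul_rpow_of_nonneg _ _ (by positivity),
    show (β - s) / β = 1 - s / β by field_simp, ENNReal.mul_rpow_of_nonneg _ _ hsβ'.le] at this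
  refine this.trans (le_of_eq ?_)
  ring

variable (V) in
lemma exists_recipNorm_riesz_le [Nontrivial V] {s β θ₀ θ₁ : ℝ} (hs : 0 < s) (hsβ : s < β)
    (h₀ : 0 < θ₀) (h₀' : θ₀ < 1) (h₁ : 0 < θ₁) (h₁' : θ₁ < 1) :
    ∃ C : ℝ≥0∞, C ≠ ∞ ∧ ∀ φ : V → ℂ, Nice φ →
      recipNorm ((1 - s / β) * θ₀ + s / β * θ₁) (fun x => ‖synth (riesz s φ) x‖ₑ) ≤
        C * (recipNorm θ₀ (fun x => ‖synth φ x‖ₑ) ^ (1 - s / β) *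
          recipNorm θ₁ (fun x => ‖synth (riesz β φ) x‖ₑ) ^ (s / β)) := by
  obtain ⟨C, n, hC, h⟩ := exists_enorm_synth_riesz_le V hs hsβ
  obtain ⟨C₀, hC₀, hb₀⟩ := exists_recipNorm_iterate_gaussMax_le V h₀ h₀' n
  obtain ⟨C₁, hC₁, hb₁⟩ := exists_recipNorm_iterate_gaussMax_le V h₁ h₁' n
  have hβ : 0 < β := hs.trans hsβ
  have ht : 0 < s / β := by positivity
  have ht1 : s / β < 1 := by rwa [div_lt_one hβ]
  have hθ : 0 < (1 - s / β) * θ₀ + s / β * θ₁ := by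
    have := mul_pos (sub_pos.2 ht1) h₀
    positivity
  refine ⟨C * (C₀ ^ (1 - s / β) * C₁ ^ (s / β)), ?_, fun φ hφ => ?_⟩
  · have := (sub_pos.2 ht1).le
    finiteness
  have l₀ := lowerSemicontinuous_enorm_synth hφ.1
  have l₁ := lowerSemicontinuous_enorm_synth (hφ.riesz hβ.le).1
  refine (recipNorm_mono hθ (h φ hφ)).trans ?_
  rw [recipNorm_const_mul hθ _ hC, mul_assoc]
  refine mul_le_mul' le_rfl ((recipNorm_geom_le h₀ h₁ ht ht1
    (lowerSemicontinuous_iterate_gaussMax l₀ n).measurable.aemeasurable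
    (lowerSemicontinuous_iterate_gaussMax l₁ n).measurable.aemeasurable).trans ?_)
  refine (mul_le_mul' (ENNReal.rpow_le_rpow (hb₀ _ l₀) (sub_pos.2 ht1).le)
    (ENNReal.rpow_le_rpow (hb₁ _ l₁) ht.le)).trans (le_of_eq ?_)
  rw [ENNReal.mul_rpow_of_nonneg _ _ (sub_pos.2 ht1).le, ENNReal.mul_rpow_of_nonneg _ _ ht.le]
  ring

end GagliardoNirenberg

section DifferenceProducts

variable {V : Type*} [NormedAddCommGroup V] [InnerProductSpace ℝ V] [FiniteDimensional ℝ V]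
  [MeasurableSpace V] [BorelSpace V]

/-! ### Products of differences -/

/-- The majorant `(N((N^j |D^s φ|)^{1/κ}))^κ` of an `L^{1/κ}(γ)` mean of differences. -/
noncomputable def diffMajorant (s κ : ℝ) (j : ℕ) (φ : V → ℂ) (x : V) : ℝ≥0∞ :=
  gaussMax (fun x => gaussMax^[j] (fun x => ‖synth (riesz s φ) x‖ₑ) x ^ (1 / κ)) x ^ κ

lemma lowerSemicontinuous_rpow {H : V → ℝ≥0∞} (hH : LowerSemicontinuous H) {r : ℝ} (hr : 0 ≤ r) :
    LowerSemicontinuous fun x => H x ^ r :=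
  Continuous.comp_lowerSemicontinuous (ENNReal.continuous_rpow_const) hH
    (ENNReal.monotone_rpow_of_nonneg hr)

lemma measurable_diffMajorant {s κ : ℝ} (hs : 0 ≤ s) (hκ : 0 < κ) (j : ℕ) {φ : V → ℂ}
    (hφ : Nice φ) : Measurable (diffMajorant s κ j φ) :=
  (lowerSemicontinuous_gaussMax (lowerSemicontinuous_rpow (lowerSemicontinuous_iterate_gaussMax
    (lowerSemicontinuous_enorm_synth (hφ.riesz hs).1) j) (by positivity))).measurable.pow_const κ

variable (V) in
lemma exists_lintegral_synth_delta_le_diffMajorant [Nontrivial V] {s κ : ℝ} {j : ℕ} (hs : 0 ≤ s)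
    (hsj : s < j) (hκ : 0 < κ) (hκ1 : κ ≤ 1) :
    ∃ C : ℝ≥0∞, C ≠ ∞ ∧ ∀ φ : V → ℂ, Nice φ → ∀ (a : ℝ) (x : V), ∀ ρ > 0,
      (∫⁻ y, ‖synth (fun ξ => delta (ρ • y) ξ ^ j * φ ξ) (x + (a * ρ) • y)‖ₑ ^ (1 / κ)
        ∂(gauss V)) ^ κ ≤ C * (ENNReal.ofReal (ρ ^ s) * diffMajorant s κ j φ x) := by
  obtain ⟨C, hC, h⟩ := exists_lintegral_synth_delta_pow_le V hs hsj (one_le_one_div hκ hκ1)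
  refine ⟨C ^ κ, by finiteness, fun φ hφ a x ρ hρ => ?_⟩
  refine (ENNReal.rpow_le_rpow (h φ hφ a x ρ hρ) hκ.le).trans (le_of_eq ?_)
  rw [ENNReal.mul_rpow_of_nonneg _ _ hκ.le, ENNReal.mul_rpow_of_nonneg _ _ hκ.le,
    ENNReal.ofReal_rpow_of_nonneg (by positivity) hκ.le, ← Real.rpow_mul hρ.le, mul_assoc s,
    one_div_mul_cancel hκ.ne', mul_one, mul_assoc, diffMajorant]

variable (V) in
lemma exists_recipNorm_diffMajorant_le [Nontrivial V] {s β θ₀ θ₁ κ : ℝ} (hs : 0 < s) (hsβ : s < β)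
    (h₀ : 0 < θ₀) (h₀' : θ₀ < 1) (h₁ : 0 < θ₁) (h₁' : θ₁ < 1)
    (hκ : (1 - s / β) * θ₀ + s / β * θ₁ < κ) (j : ℕ) :
    ∃ C : ℝ≥0∞, C ≠ ∞ ∧ ∀ φ : V → ℂ, Nice φ →
      recipNorm ((1 - s / β) * θ₀ + s / β * θ₁) (diffMajorant s κ j φ) ≤
        C * (recipNorm θ₀ (fun x => ‖synth φ x‖ₑ) ^ (1 - s / β) *
          recipNorm θ₁ (fun x => ‖synth (riesz β φ) x‖ₑ) ^ (s / β)) := by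
  have hβ : 0 < β := hs.trans hsβ
  have ht : 0 < s / β := by positivity
  have ht1 : 0 < 1 - s / β := by rw [sub_pos, div_lt_one hβ]; exact hsβ
  obtain ⟨C₁, hC₁, hb₁⟩ := exists_recipNorm_riesz_le V hs hsβ h₀ h₀' h₁ h₁'
  have hθ0 : 0 < (1 - s / β) * θ₀ + s / β * θ₁ := by positivity
  have hθ1 : (1 - s / β) * θ₀ + s / β * θ₁ < 1 := by nlinarith
  set θ := (1 - s / β) * θ₀ + s / β * θ₁ with hθ
  have hκ0 : 0 < κ := hθ0.trans hκ
  obtain ⟨C₂, hC₂, hb₂⟩ := exists_recipNorm_iterate_gaussMax_le V hθ0 hθ1 j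
  obtain ⟨C₃, hC₃, hb₃⟩ := exists_recipNorm_gaussMax_le V (div_pos hθ0 hκ0)
    ((div_lt_one hκ0).2 hκ)
  refine ⟨C₃ ^ κ * C₂ * C₁, by finiteness, fun φ hφ => ?_⟩
  have l := lowerSemicontinuous_enorm_synth (hφ.riesz hs.le).1
  have l' := lowerSemicontinuous_iterate_gaussMax l j
  unfold diffMajorant
  rw [recipNorm_rpow hκ0]
  refine (ENNReal.rpow_le_rpow (hb₃ _ (lowerSemicontinuous_rpow l'
    (by positivity : 0 ≤ 1 / κ))) hκ0.le).trans ?_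
  rw [recipNorm_rpow (by positivity), div_div, mul_one_div_cancel hκ0.ne', div_one,
    ENNReal.mul_rpow_of_nonneg _ _ hκ0.le, ← ENNReal.rpow_mul, one_div_mul_cancel hκ0.ne',
    ENNReal.rpow_one, mul_assoc, mul_assoc]
  exact mul_le_mul' le_rfl ((hb₂ _ l).trans (mul_le_mul' le_rfl (hb₁ φ hφ)))

lemma ENNReal_rpow_mul_rpow_le_add {t : ℝ} (ht : 0 ≤ t) (ht1 : t ≤ 1) (a b : ℝ≥0∞) :
    a ^ (1 - t) * b ^ t ≤ a + b := by
  have h1 : a ^ (1 - t) ≤ (a + b) ^ (1 - t) :=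
    ENNReal.rpow_le_rpow le_self_add (by linarith)
  have h2 : b ^ t ≤ (a + b) ^ t := ENNReal.rpow_le_rpow le_add_self ht
  refine (mul_le_mul' h1 h2).trans (le_of_eq ?_)
  rw [← ENNReal.rpow_add_of_nonneg _ _ (by linarith) ht, sub_add_cancel, ENNReal.rpow_one]

variable (V) in
lemma exists_majorant_product [Nontrivial V] {β θ θ₀ θ₁ τ₀ τ₁ : ℝ} {j l : ℕ} (hβ : 0 < β)
    (hj : 0 < j) (hl : 0 < l) (hjl : β < j + l) (hθ1 : θ < 1)
    (h₀ : 0 < θ₀) (h₁ : 0 < θ₁) (k₀ : 0 < τ₀) (k₁ : 0 < τ₁)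
    (e₁ : θ₁ + τ₀ = θ) (e₂ : θ₀ + τ₁ = θ) :
    ∃ C : ℝ≥0∞, C ≠ ∞ ∧ ∀ φ ψ : V → ℂ, Nice φ → Nice ψ → ∃ H : V → ℝ≥0∞, Measurable H ∧
      (∀ (a b : ℝ) (x : V),
        ∫⁻ t, ‖synth (fun ξ => delta (t.1 • t.2) ξ ^ j * φ ξ) (x + (a * t.1) • t.2)‖ₑ *
          ‖synth (fun ξ => delta (t.1 • t.2) ξ ^ l * ψ ξ) (x + (b * t.1) • t.2)‖ₑ
            ∂(diffMeasure V β) ≤ H x) ∧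
      recipNorm θ H ≤ C *
        (recipNorm θ₁ (fun x => ‖synth (riesz β φ) x‖ₑ) * recipNorm τ₀ (fun x => ‖synth ψ x‖ₑ) +
        recipNorm θ₀ (fun x => ‖synth φ x‖ₑ) * recipNorm τ₁ (fun x => ‖synth (riesz β ψ) x‖ₑ)) := by
  have hj' : (0:ℝ) < j := by exact_mod_cast hj
  have hl' : (0:ℝ) < l := by exact_mod_cast hl
  obtain ⟨σ, hσ1, hσ2⟩ : ∃ σ, max 0 (β - l) < σ ∧ σ < min (j:ℝ) β :=
    exists_between (max_lt (lt_min hj' hβ) (lt_min (by linarith) (by linarith)))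
  obtain ⟨hσ0, hσl⟩ := max_lt_iff.1 hσ1
  obtain ⟨hσj, hσβ⟩ := lt_min_iff.1 hσ2
  obtain ⟨ε, hε0, hε⟩ : ∃ ε, 0 < ε ∧ ε < min (min σ (j - σ)) (min (β - σ) (β * ((1 - θ) / 2))) :=
    exists_between (by
      refine lt_min (lt_min hσ0 ?_) (lt_min ?_ ?_) <;> first | linarith | skip
      have : 0 < 1 - θ := by linarith
      positivity)
  obtain ⟨⟨hεσ, hεj⟩, hεβ, hεθ⟩ : (ε < σ ∧ ε < j - σ) ∧ ε < β - σ ∧ ε < β * ((1 - θ) / 2) := by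
    simpa only [lt_min_iff] using hε
  set ϑ : ℝ → ℝ := fun s => (1 - s / β) * θ₀ + s / β * θ₁ with hϑ
  set ς : ℝ := (1 - (β - σ) / β) * τ₀ + (β - σ) / β * τ₁ with hς
  have hsum : ϑ σ + ς = θ := by
    simp only [hϑ, hς]
    have : (β - σ) / β = 1 - σ / β := by field_simp
    rw [this]
    linear_combination (σ / β) * e₁ + (1 - σ / β) * e₂
  have hσβ' : 0 < 1 - σ / β := by rw [sub_pos, div_lt_one hβ]; exact hσβ
  have hς0 : 0 < ς := by
    have : (β - σ) / β = 1 - σ / β := by field_simp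
    simp only [hς, this, sub_sub_cancel]
    positivity
  have hϑ0 : ∀ s, 0 < s → s < β → 0 < ϑ s := fun s h h' => by
    have : 0 < 1 - s / β := by rw [sub_pos, div_lt_one hβ]; exact h'
    simp only [hϑ]
    positivity
  set κ := ϑ σ + (1 - θ) / 2 with hκ
  have hκ0 : 0 < κ := by have := hϑ0 σ hσ0 hσβ; simp only [hκ]; linarith
  have hκκ : 1 - κ = ς + (1 - θ) / 2 := by rw [← hsum] at *; simp only [hκ]; ring
  have hκ1 : 0 < 1 - κ := by rw [hκκ]; linarith
  have hϑε : ∀ s, |s - σ| = ε → ϑ s < κ := by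
    intro s hs
    have e : ϑ s - ϑ σ = (s - σ) / β * (θ₁ - θ₀) := by simp only [hϑ]; ring
    have h1 : |θ₁ - θ₀| ≤ 1 := by rw [abs_le]; constructor <;> linarith
    have h2 : |ϑ s - ϑ σ| ≤ ε / β := by
      rw [e, abs_mul, abs_div, hs, abs_of_pos hβ]
      exact mul_le_of_le_one_right (by positivity) h1
    have h3 : ε / β < (1 - θ) / 2 := by rw [div_lt_iff₀ hβ]; linarith
    have := (abs_le.1 h2).2
    simp only [hκ]; linarith
  have e2 : (1 - 1 / 2 : ℝ) * ϑ (σ + ε) + 1 / 2 * ϑ (σ - ε) = ϑ σ := by simp only [hϑ]; ring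
  have hp : |σ + ε - σ| = ε := by rw [add_sub_cancel_left, abs_of_pos hε0]
  have hm : |σ - ε - σ| = ε := by rw [sub_sub_cancel_left, abs_neg, abs_of_pos hε0]
  obtain ⟨P₁, hP₁, p₁⟩ := exists_lintegral_synth_delta_le_diffMajorant V (s := σ + ε) (j := j)
    (by linarith) (by linarith) hκ0 (by linarith)
  obtain ⟨P₂, hP₂, p₂⟩ := exists_lintegral_synth_delta_le_diffMajorant V (s := σ - ε) (j := j)
    (by linarith) (by linarith) hκ0 (by linarith)
  obtain ⟨P₃, hP₃, p₃⟩ := exists_lintegral_synth_delta_le_diffMajorant V (s := β - σ) (j := l)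
    (by linarith) (by linarith) hκ1 (by linarith)
  obtain ⟨Q₁, hQ₁, q₁⟩ := exists_recipNorm_diffMajorant_le V (s := σ + ε) (β := β) (by linarith)
    (by linarith) h₀ (by linarith) h₁ (by linarith) (hϑε _ hp) j
  obtain ⟨Q₂, hQ₂, q₂⟩ := exists_recipNorm_diffMajorant_le V (s := σ - ε) (β := β) (by linarith)
    (by linarith) h₀ (by linarith) h₁ (by linarith) (hϑε _ hm) j
  obtain ⟨Q₃, hQ₃, q₃⟩ := exists_recipNorm_diffMajorant_le V (s := β - σ) (β := β) (κ := 1 - κ)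
    (by linarith) (by linarith) k₀ (by linarith) k₁ (by linarith) (by rw [hκκ]; linarith) l
  set K : ℝ≥0∞ :=
    ENNReal.ofReal (1 / ε + 1 / ε) * (P₁ ^ (1 / 2 : ℝ) * P₂ ^ (1 / 2 : ℝ)) * P₃ with hK
  have hKt : K ≠ ∞ := by finiteness
  refine ⟨K * (Q₁ ^ (1 / 2 : ℝ) * Q₂ ^ (1 / 2 : ℝ) * Q₃), by finiteness, fun φ ψ hφ hψ => ?_⟩
  set X₁ := diffMajorant (σ + ε) κ j φ with hX₁
  set X₂ := diffMajorant (σ - ε) κ j φ with hX₂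
  set Y := diffMajorant (β - σ) (1 - κ) l ψ with hY
  have mX₁ : Measurable X₁ := measurable_diffMajorant (by linarith) hκ0 j hφ
  have mX₂ : Measurable X₂ := measurable_diffMajorant (by linarith) hκ0 j hφ
  have mY : Measurable Y := measurable_diffMajorant (by linarith) hκ1 l hψ
  refine ⟨fun x => K * (X₁ x ^ (1 - 1 / 2 : ℝ) * X₂ x ^ (1 / 2 : ℝ) * Y x), by fun_prop, ?_, ?_⟩
  · intro a b x
    have hcont : ∀ n : ℕ, Measurable (Function.uncurry fun (t : ℝ × V) (ξ : V) =>
        delta (t.1 • t.2) ξ ^ n) := fun n => Continuous.measurable (by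
      show Continuous fun p : (ℝ × V) × V => delta (p.1.1 • p.1.2) p.2 ^ n
      fun_prop)
    have mF : Measurable fun t : ℝ × V =>
        ‖synth (fun ξ => delta (t.1 • t.2) ξ ^ j * φ ξ) (x + (a * t.1) • t.2)‖ₑ :=
      (measurable_synth_mul (hcont j) hφ.1.1 (by fun_prop)).enorm
    have mG : Measurable fun t : ℝ × V =>
        ‖synth (fun ξ => delta (t.1 • t.2) ξ ^ l * ψ ξ) (x + (b * t.1) • t.2)‖ₑ :=
      (measurable_synth_mul (hcont l) hψ.1.1 (by fun_prop)).enorm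
    refine (lintegral_diffMeasure β (mF.mul mG)).le.trans ?_
    simp only [Pi.mul_apply]
    have hold : ∀ ρ ∈ Ioi (0:ℝ), ENNReal.ofReal (ρ ^ (-1 - β)) *
        ∫⁻ y, ‖synth (fun ξ => delta (ρ • y) ξ ^ j * φ ξ) (x + (a * ρ) • y)‖ₑ *
        ‖synth (fun ξ => delta (ρ • y) ξ ^ l * ψ ξ) (x + (b * ρ) • y)‖ₑ ∂(gauss V) ≤
        min (ENNReal.ofReal (ρ ^ (ε - 1)) * (P₁ * X₁ x))
          (ENNReal.ofReal (ρ ^ (-ε - 1)) * (P₂ * X₂ x)) * (P₃ * Y x) := by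
      intro ρ (hρ : 0 < ρ)
      have hc : (1 / κ).HolderConjugate (1 / (1 - κ)) := by
        rw [Real.holderConjugate_iff]
        constructor
        · rw [one_lt_div hκ0]; linarith
        · simp
      have mF' := mF.comp (measurable_prodMk_left (x := ρ) (β := V))
      have mG' := mG.comp (measurable_prodMk_left (x := ρ) (β := V))
      have h := ENNReal.lintegral_mul_le_Lp_mul_Lq (gauss V) hc mF'.aemeasurable mG'.aemeasurable
      simp only [one_div_one_div, Pi.mul_apply, Function.comp_def] at h
      have g := p₃ ψ hψ b x ρ hρ
      refine (mul_le_mul' le_rfl (h.trans (mul_le_mul' le_rfl g))).trans ?_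
      have hpow : ENNReal.ofReal (ρ ^ (-1 - β)) * ENNReal.ofReal (ρ ^ (β - σ)) =
          ENNReal.ofReal (ρ ^ (-1 - σ)) := by
        rw [← ENNReal.ofReal_mul (by positivity), ← Real.rpow_add hρ]
        congr 2; ring
      set I := (∫⁻ y, ‖synth (fun ξ => delta (ρ • y) ξ ^ j * φ ξ) (x + (a * ρ) • y)‖ₑ ^ (1 / κ)
        ∂(gauss V)) ^ κ with hI
      calc ENNReal.ofReal (ρ ^ (-1 - β)) * (I * (P₃ * (ENNReal.ofReal (ρ ^ (β - σ)) * Y x)))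
          = ENNReal.ofReal (ρ ^ (-1 - β)) * ENNReal.ofReal (ρ ^ (β - σ)) * I * (P₃ * Y x) := by ring
        _ = ENNReal.ofReal (ρ ^ (-1 - σ)) * I * (P₃ * Y x) := by rw [hpow]
        _ ≤ _ := by
          refine mul_le_mul' (le_min ?_ ?_) le_rfl
          · refine (mul_le_mul' le_rfl (p₁ φ hφ a x ρ hρ)).trans (le_of_eq ?_)
            rw [show ε - 1 = (-1 - σ) + (σ + ε) by ring, Real.rpow_add hρ (-1 - σ),
              ENNReal.ofReal_mul (by positivity)]
            ring
          · refine (mul_le_mul' le_rfl (p₂ φ hφ a x ρ hρ)).trans (le_of_eq ?_)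
            rw [show -ε - 1 = (-1 - σ) + (σ - ε) by ring, Real.rpow_add hρ,
              ENNReal.ofReal_mul (by positivity)]
            ring
    refine (setLIntegral_mono' measurableSet_Ioi hold).trans ?_
    rw [lintegral_mul_const _ (by fun_prop)]
    refine (mul_le_mul' (lintegral_min_rpow_le hε0 hε0 _ _) le_rfl).trans (le_of_eq ?_)
    have : ε / (ε + ε) = 1 / 2 := by field_simp; norm_num
    rw [this, ENNReal.mul_rpow_of_nonneg _ _ (by norm_num),
      ENNReal.mul_rpow_of_nonneg _ _ (by norm_num), hK]
    norm_num
    ring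
  · have hθ0 : 0 < θ := by linarith
    rw [recipNorm_const_mul hθ0 _ hKt]
    refine le_trans (mul_le_mul' le_rfl ?_) (le_of_eq (mul_assoc K _ _).symm)
    have hσε := hϑ0 (σ + ε) (by linarith) (by linarith)
    have hσε' := hϑ0 (σ - ε) (by linarith) (by linarith)
    have g := recipNorm_geom_le (t := 1 / 2) hσε hσε' (by norm_num) (by norm_num)
      mX₁.aemeasurable mX₂.aemeasurable
    rw [e2] at g
    have hm := recipNorm_mul_le (hϑ0 σ hσ0 hσβ) hς0 (H := fun x => X₁ x ^ (1 - 1 / 2 : ℝ) *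
      X₂ x ^ (1 / 2 : ℝ)) (K := Y) (by fun_prop) mY.aemeasurable
    rw [hsum] at hm
    set A₀ := recipNorm θ₀ (fun x => ‖synth φ x‖ₑ)
    set A₁ := recipNorm θ₁ (fun x => ‖synth (riesz β φ) x‖ₑ)
    set B₀ := recipNorm τ₀ (fun x => ‖synth ψ x‖ₑ)
    set B₁ := recipNorm τ₁ (fun x => ‖synth (riesz β ψ) x‖ₑ)
    refine hm.trans ((mul_le_mul' (g.trans (mul_le_mul'
      (ENNReal.rpow_le_rpow (q₁ φ hφ) (by norm_num))
      (ENNReal.rpow_le_rpow (q₂ φ hφ) (by norm_num)))) (q₃ ψ hψ)).trans ?_)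
    have ht : (β - σ) / β = 1 - σ / β := by field_simp
    have y := ENNReal_rpow_mul_rpow_le_add (t := 1 - σ / β) hσβ'.le (by
      have : 0 < σ / β := by positivity
      linarith) (A₁ * B₀) (A₀ * B₁)
    rw [sub_sub_cancel] at y
    refine le_trans (le_of_eq ?_) (mul_le_mul' le_rfl y)
    have n1 : 0 ≤ 1 - (σ + ε) / β := by rw [sub_nonneg, div_le_one hβ]; linarith
    have n2 : 0 ≤ 1 - (σ - ε) / β := by rw [sub_nonneg, div_le_one hβ]; linarith
    have n3 : 0 ≤ (σ + ε) / β := by positivity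
    have n4 : 0 ≤ (σ - ε) / β := div_nonneg (by linarith) hβ.le
    have n5 : 0 ≤ σ / β := by positivity
    have c1 : A₀ ^ ((1 - (σ + ε) / β) * (1 / 2)) * A₀ ^ ((1 - (σ - ε) / β) * (1 / 2)) =
        A₀ ^ (1 - σ / β) := by
      rw [← ENNReal.rpow_add_of_nonneg _ _ (by positivity) (by positivity)]
      congr 1; field_simp; ring
    have c2 : A₁ ^ ((σ + ε) / β * (1 / 2)) * A₁ ^ ((σ - ε) / β * (1 / 2)) = A₁ ^ (σ / β) := by
      rw [← ENNReal.rpow_add_of_nonneg _ _ (by positivity) (by positivity)]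
      congr 1; field_simp; ring
    rw [show (1 - 1 / 2 : ℝ) = 1 / 2 by norm_num, ht, sub_sub_cancel]
    simp only [ENNReal.mul_rpow_of_nonneg _ _ (by norm_num : (0:ℝ) ≤ 1 / 2),
      ENNReal.mul_rpow_of_nonneg _ _ hσβ'.le, ENNReal.mul_rpow_of_nonneg _ _ n5, ← ENNReal.rpow_mul]
    rw [← c1, ← c2]
    ring

end DifferenceProducts

/-! ### Bilinear Fourier synthesis -/

section Bilinear

variable {V : Type*} [NormedAddCommGroup V] [InnerProductSpace ℝ V] [FiniteDimensional ℝ V]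
  [MeasurableSpace V] [BorelSpace V]

/-- The bilinear Fourier multiplier operator with symbol `Q`. -/
noncomputable def bisynth (Q : V × V → ℂ) (φ ψ : V → ℂ) (x : V) : ℂ :=
  ∫ p : V × V, Q p * ((wave x p.1 * φ p.1) * (wave x p.2 * ψ p.2))

lemma integrable_wave_mul_prod {φ ψ : V → ℂ} (hφ : Integrable φ) (hψ : Integrable ψ) (x : V) :
    Integrable fun p : V × V => (wave x p.1 * φ p.1) * (wave x p.2 * ψ p.2) :=
  (integrable_wave_mul hφ x).mul_prod (integrable_wave_mul hψ x)

lemma bisynth_mul (m n φ ψ : V → ℂ) (x : V) :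
    bisynth (fun p => m p.1 * n p.2) φ ψ x =
      synth (fun ξ => m ξ * φ ξ) x * synth (fun ξ => n ξ * ψ ξ) x := by
  simp only [bisynth, synth]
  rw [← integral_prod_mul]
  congr 1; ext p; ring

lemma continuous_bisynth {φ ψ : V → ℂ} (hφ : Integrable φ) (hψ : Integrable ψ)
    {Q : V → V × V → ℂ} (hQ : Continuous (Function.uncurry Q)) {C : ℝ} (hC : ∀ y p, ‖Q y p‖ ≤ C)
    (x : V) : Continuous fun y => bisynth (Q y) φ ψ x := by
  have hi := integrable_wave_mul_prod hφ hψ x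
  refine continuous_of_dominated
    (bound := fun p => C * ‖(wave x p.1 * φ p.1) * (wave x p.2 * ψ p.2)‖)
    (fun y => ?_) (fun y => Eventually.of_forall fun p => ?_) (hi.norm.const_mul C)
    (Eventually.of_forall fun p => ?_)
  · exact (Continuous.aestronglyMeasurable (by fun_prop)).mul hi.1
  · rw [norm_mul]; exact mul_le_mul_of_nonneg_right (hC y p) (norm_nonneg _)
  · fun_prop

lemma bisynth_add {φ ψ : V → ℂ} (hφ : Integrable φ) (hψ : Integrable ψ) {P Q : V × V → ℂ}
    (hP : Continuous P) (hQ : Continuous Q) {C D : ℝ} (hC : ∀ p, ‖P p‖ ≤ C) (hD : ∀ p, ‖Q p‖ ≤ D)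
    (x : V) : bisynth (P + Q) φ ψ x = bisynth P φ ψ x + bisynth Q φ ψ x := by
  have hi := integrable_wave_mul_prod hφ hψ x
  simp only [bisynth, Pi.add_apply, add_mul]
  exact integral_add (hi.bdd_mul hP.aestronglyMeasurable (Eventually.of_forall hC))
    (hi.bdd_mul hQ.aestronglyMeasurable (Eventually.of_forall hD))

lemma bisynth_smul (c : ℂ) (Q : V × V → ℂ) (φ ψ : V → ℂ) (x : V) :
    bisynth (c • Q) φ ψ x = c * bisynth Q φ ψ x := by
  simp only [bisynth, Pi.smul_apply, smul_eq_mul, mul_assoc]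
  exact integral_const_mul _ _

/-- A product of finite differences of orders `j` and `l`, as a bilinear symbol. -/
noncomputable def diffProd (j l : ℕ) (a b : ℝ) (y : V) (p : V × V) : ℂ :=
  (delta y p.1 ^ j * wave (a • y) p.1) * (delta y p.2 ^ l * wave (b • y) p.2)

lemma continuous_diffProd (j l : ℕ) (a b : ℝ) :
    Continuous (Function.uncurry (diffProd j l a b : V → V × V → ℂ)) := by
  unfold Function.uncurry diffProd
  fun_prop

lemma norm_diffProd_le (j l : ℕ) (a b : ℝ) (y : V) (p : V × V) :
    ‖diffProd j l a b y p‖ ≤ 2 ^ j * 2 ^ l := by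
  simp only [diffProd, norm_mul, norm_pow, norm_wave, mul_one]
  gcongr <;> exact norm_delta_le _ _

lemma bisynth_diffProd (j l : ℕ) (a b : ℝ) (y : V) (φ ψ : V → ℂ) (x : V) :
    bisynth (diffProd j l a b y) φ ψ x =
      synth (fun ξ => delta y ξ ^ j * φ ξ) (x + a • y) *
        synth (fun ξ => delta y ξ ^ l * ψ ξ) (x + b • y) := by
  rw [← synth_wave_mul, ← synth_wave_mul]
  refine (bisynth_mul (fun ξ => delta y ξ ^ j * wave (a • y) ξ)
    (fun ξ => delta y ξ ^ l * wave (b • y) ξ) φ ψ x).trans ?_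
  congr 2 <;> (ext ξ; ring)

variable (V) in
/-- The span of the symbols `diffProd j l a b` with `j, l ≥ 1` and `j + l ≥ n`. -/
def diffSpan (n : ℕ) : Submodule ℂ (V → V × V → ℂ) :=
  Submodule.span ℂ {Q | ∃ (j l : ℕ) (a b : ℝ), 0 < j ∧ 0 < l ∧ n ≤ j + l ∧ Q = diffProd j l a b}

lemma diffProd_mem {n j l : ℕ} (hj : 0 < j) (hl : 0 < l) (h : n ≤ j + l) (a b : ℝ) :
    diffProd j l a b ∈ diffSpan V n :=
  Submodule.subset_span ⟨j, l, a, b, hj, hl, h, rfl⟩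

/-- The defect of the Leibniz rule for `‖delta y ξ‖ ^ n`. -/
noncomputable def leibnizDefect (n : ℕ) (y : V) (p : V × V) : ℂ :=
  ((‖delta y (p.1 + p.2)‖ ^ n : ℝ) : ℂ) - ((‖delta y p.1‖ ^ n : ℝ) : ℂ) -
    ((‖delta y p.2‖ ^ n : ℝ) : ℂ)

lemma leibnizDefect_identity {z w Z W : ℂ} (N k : ℕ) (hk : N + 1 = 2 * k) (hz : z ^ k * Z = 1)
    (hw : w ^ k * W = 1) :
    (z * w - 1) ^ (N + 1) * (Z * W) - (z - 1) ^ (N + 1) * Z - (w - 1) ^ (N + 1) * W =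
      ∑ m ∈ Finset.range N, ((N + 1).choose (m + 1) : ℂ) * (((z - 1) ^ (m + 1) *
        (z ^ (N + 1 - (m + 1)) * Z)) * ((w - 1) ^ (N + 1 - (m + 1)) * W)) +
      ∑ i ∈ Finset.range k, ((z - 1) ^ 1 * z ^ i) * ((w - 1) ^ (N + 1) * W) -
      ∑ i ∈ Finset.range k, ((z - 1) ^ (N + 1) * Z) * ((w - 1) ^ 1 * (w ^ i * W)) := by
  have h1 : z * w - 1 = (z - 1) + z * (w - 1) := by ring
  rw [h1, add_pow, Finset.sum_range_succ, Finset.sum_range_succ']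
  have e1 : ∑ i ∈ Finset.range k, ((z - 1) ^ 1 * z ^ i) * ((w - 1) ^ (N + 1) * W) =
      (z ^ k - 1) * ((w - 1) ^ (N + 1) * W) := by
    rw [← Finset.sum_mul, ← Finset.mul_sum, pow_one, mul_comm (z - 1), geom_sum_mul]
  have e2 : ∑ i ∈ Finset.range k, ((z - 1) ^ (N + 1) * Z) * ((w - 1) ^ 1 * (w ^ i * W)) =
      ((z - 1) ^ (N + 1) * Z) * ((w ^ k - 1) * W) := by
    rw [← Finset.mul_sum, ← Finset.mul_sum, ← Finset.sum_mul, ← geom_sum_mul]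
    ring
  have e3 : z ^ (N + 1) * Z = z ^ k := by
    rw [hk, two_mul, pow_add, mul_assoc, hz, mul_one]
  rw [e1, e2]
  simp only [Nat.sub_self, pow_zero, Nat.choose_self, Nat.choose_zero_right, Nat.sub_zero,
    add_mul, Finset.sum_mul, mul_pow, Nat.cast_one, mul_one, one_mul]
  have e4 : ∀ m ∈ Finset.range N, (z - 1) ^ (m + 1) * (z ^ (N + 1 - (m + 1)) *
      (w - 1) ^ (N + 1 - (m + 1))) * ((N + 1).choose (m + 1) : ℂ) * (Z * W) =
      ((N + 1).choose (m + 1) : ℂ) * (((z - 1) ^ (m + 1) *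
        (z ^ (N + 1 - (m + 1)) * Z)) * ((w - 1) ^ (N + 1 - (m + 1)) * W)) := fun m _ => by ring
  rw [Finset.sum_congr rfl e4]
  linear_combination ((w - 1) ^ (N + 1) * W) * e3 + ((z - 1) ^ (N + 1) * Z) * hw

lemma leibnizDefect_mem {k : ℕ} (hk : 0 < k) :
    (leibnizDefect (2 * k) : V → V × V → ℂ) ∈ diffSpan V (2 * k) := by
  obtain ⟨N, hN⟩ : ∃ N, N + 1 = 2 * k := ⟨2 * k - 1, by omega⟩
  have key : (leibnizDefect (2 * k) : V → V × V → ℂ) = ((-1 : ℂ) ^ k) •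
      (∑ m ∈ Finset.range N, ((N + 1).choose (m + 1) : ℂ) •
          diffProd (m + 1) (N + 1 - (m + 1)) (((N + 1 - (m + 1) : ℕ) : ℝ) + (-k : ℝ)) (-k) +
        ∑ i ∈ Finset.range k, diffProd 1 (N + 1) i (-k) -
        ∑ i ∈ Finset.range k, diffProd (N + 1) 1 (-k) ((i : ℝ) + (-k : ℝ))) := by
    ext y p
    have hinv : ∀ ξ : V, wave y ξ ^ k * wave ((-k : ℝ) • y) ξ = 1 := fun ξ => by
      rw [← wave_natCast_smul, ← wave_add_left, ← add_smul]; simp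
    have := leibnizDefect_identity N k hN (hinv p.1) (hinv p.2)
    simp only [leibnizDefect, norm_delta_pow_eq, Pi.smul_apply, Pi.sub_apply, Pi.add_apply,
      Finset.sum_apply, smul_eq_mul, diffProd, add_smul, wave_add_left, wave_natCast_smul,
      wave_add_right]
    simp only [← hN]
    rw [← mul_sub, ← mul_sub]
    congr 1
    simp only [delta, wave_add_right]
    convert this using 2
  rw [key]
  refine Submodule.smul_mem _ _ (Submodule.sub_mem _ (Submodule.add_mem _ ?_ ?_) ?_)
  · refine Submodule.sum_mem _ fun m hm => Submodule.smul_mem _ _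
      (diffProd_mem (by omega) ?_ ?_ _ _)
    · have := Finset.mem_range.1 hm; omega
    · have := Finset.mem_range.1 hm; omega
  · exact Submodule.sum_mem _ fun m hm => diffProd_mem (by omega) (by omega) (by omega) _ _
  · exact Submodule.sum_mem _ fun m hm => diffProd_mem (by omega) (by omega) (by omega) _ _

/-- The right-hand side of the Kato–Ponce inequality. -/
noncomputable def katoPonce (β θ₀ θ₁ τ₀ τ₁ : ℝ) (φ ψ : V → ℂ) : ℝ≥0∞ :=
  recipNorm θ₁ (fun x => ‖synth (riesz β φ) x‖ₑ) * recipNorm τ₀ (fun x => ‖synth ψ x‖ₑ) +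
    recipNorm θ₀ (fun x => ‖synth φ x‖ₑ) * recipNorm τ₁ (fun x => ‖synth (riesz β ψ) x‖ₑ)

lemma exists_majorant_of_mem_diffSpan [Nontrivial V] {β θ θ₀ θ₁ τ₀ τ₁ : ℝ} {n : ℕ} (hβ : 0 < β)
    (hn : β < n) (hθ1 : θ < 1) (h₀ : 0 < θ₀) (h₁ : 0 < θ₁) (k₀ : 0 < τ₀) (k₁ : 0 < τ₁)
    (e₁ : θ₁ + τ₀ = θ) (e₂ : θ₀ + τ₁ = θ) {Q : V → V × V → ℂ} (hQ : Q ∈ diffSpan V n) :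
    Continuous (Function.uncurry Q) ∧ (∃ C, ∀ y p, ‖Q y p‖ ≤ C) ∧
    ∃ C : ℝ≥0∞, C ≠ ∞ ∧ ∀ φ ψ : V → ℂ, Nice φ → Nice ψ → ∃ H : V → ℝ≥0∞, Measurable H ∧
      (∀ x, ∫⁻ t, ‖bisynth (Q (t.1 • t.2)) φ ψ x‖ₑ ∂(diffMeasure V β) ≤ H x) ∧
      recipNorm θ H ≤ C * katoPonce β θ₀ θ₁ τ₀ τ₁ φ ψ := by
  have hθ : 0 < θ := by linarith
  induction hQ using Submodule.span_induction with
  | mem Q h =>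
    obtain ⟨j, l, a, b, hj, hl, hjl, rfl⟩ := h
    refine ⟨continuous_diffProd _ _ _ _, ⟨_, norm_diffProd_le _ _ _ _⟩, ?_⟩
    obtain ⟨C, hC, h⟩ := exists_majorant_product V hβ hj hl
      (hn.trans_le (by exact_mod_cast hjl)) hθ1 h₀ h₁ k₀ k₁ e₁ e₂
    refine ⟨C, hC, fun φ ψ hφ hψ => ?_⟩
    obtain ⟨H, hH, h1, h2⟩ := h φ ψ hφ hψ
    refine ⟨H, hH, fun x => (le_of_eq ?_).trans (h1 a b x), h2⟩
    simp only [bisynth_diffProd, enorm_mul, smul_smul]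
  | zero =>
    refine ⟨continuous_const, ⟨0, fun y p => by simp⟩, 0, by simp, fun φ ψ _ _ =>
      ⟨0, measurable_const, fun x => ?_, ?_⟩⟩
    · simp [bisynth]
    · simp [recipNorm, hθ]
  | add P Q _ _ hP hQ =>
    obtain ⟨cP, ⟨C, hC⟩, A, hA, hP⟩ := hP
    obtain ⟨cQ, ⟨D, hD⟩, B, hB, hQ⟩ := hQ
    refine ⟨cP.add cQ, ⟨C + D, fun y p => norm_add_le_of_le (hC y p) (hD y p)⟩, A + B,
      by finiteness, fun φ ψ hφ hψ => ?_⟩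
    obtain ⟨H, mH, hH, hH'⟩ := hP φ ψ hφ hψ
    obtain ⟨K, mK, hK, hK'⟩ := hQ φ ψ hφ hψ
    refine ⟨H + K, mH.add mK, fun x => ?_, ?_⟩
    · refine le_trans ?_ (add_le_add (hH x) (hK x))
      rw [← lintegral_add_left]
      · refine lintegral_mono fun t => ?_
        rw [Pi.add_apply, bisynth_add hφ.1 hψ.1 (by fun_prop) (by fun_prop) (hC _) (hD _)]
        exact enorm_add_le _ _
      · exact ((continuous_bisynth hφ.1 hψ.1 cP hC x).measurable.comp
          (by fun_prop : Measurable fun t : ℝ × V => t.1 • t.2)).enorm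
    · rw [add_mul]
      exact (recipNorm_add_le hθ hθ1.le mH.aemeasurable mK.aemeasurable).trans
        (add_le_add hH' hK')
  | smul c Q _ hQ =>
    obtain ⟨cQ, ⟨D, hD⟩, B, hB, hQ⟩ := hQ
    refine ⟨cQ.const_smul c, ⟨‖c‖ * D, fun y p => ?_⟩, ‖c‖ₑ * B, by finiteness,
      fun φ ψ hφ hψ => ?_⟩
    · simp only [Pi.smul_apply, norm_smul]
      exact mul_le_mul_of_nonneg_left (hD y p) (norm_nonneg _)
    obtain ⟨K, mK, hK, hK'⟩ := hQ φ ψ hφ hψ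
    refine ⟨fun x => ‖c‖ₑ * K x, mK.const_mul _, fun x => ?_, ?_⟩
    · simp only [Pi.smul_apply, bisynth_smul, enorm_mul]
      rw [lintegral_const_mul' _ _ enorm_ne_top]
      exact mul_le_mul' le_rfl (hK x)
    · rw [recipNorm_const_mul hθ _ enorm_ne_top, mul_assoc]
      exact mul_le_mul' le_rfl hK'

lemma enorm_integral_integral_mul_le {T P : Type*} [MeasurableSpace T] [MeasurableSpace P]
    {μ : Measure T} {ν : Measure P} [SFinite μ] [SFinite ν] {m : T → P → ℂ}
    (hm : Measurable (Function.uncurry m)) {Φ : P → ℂ} (hΦ : Integrable Φ ν)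
    (hfin : ∫⁻ p, (∫⁻ t, ‖m t p‖ₑ ∂μ) * ‖Φ p‖ₑ ∂ν ≠ ∞) :
    ‖∫ p, (∫ t, m t p ∂μ) * Φ p ∂ν‖ₑ ≤ ∫⁻ t, ‖∫ p, m t p * Φ p ∂ν‖ₑ ∂μ := by
  have hi : Integrable (Function.uncurry fun (p : P) (t : T) => m t p * Φ p) (ν.prod μ) := by
    have hF : AEStronglyMeasurable (Function.uncurry fun (p : P) (t : T) => m t p * Φ p)
        (ν.prod μ) :=
      (hm.comp measurable_swap).aestronglyMeasurable.mul hΦ.1.comp_fst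
    refine ⟨hF, ?_⟩
    rw [hasFiniteIntegral_iff_enorm, lintegral_prod _ hF.enorm]
    refine lt_of_le_of_lt (le_of_eq (lintegral_congr fun p => ?_)) (lt_top_iff_ne_top.2 hfin)
    simp only [Function.uncurry, enorm_mul]
    rw [lintegral_mul_const' _ _ enorm_ne_top]
  have : ∫ p, (∫ t, m t p ∂μ) * Φ p ∂ν = ∫ t, ∫ p, m t p * Φ p ∂ν ∂μ := by
    rw [← integral_integral_swap hi]
    simp only [integral_mul_const]
  rw [this]
  exact enorm_integral_le_lintegral_enorm _

set_option maxHeartbeats 800000 in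
variable (V) in
/-- The Kato–Ponce inequality for the Riesz potential. -/
theorem exists_recipNorm_bisynth_le [Nontrivial V] {β θ θ₀ θ₁ τ₀ τ₁ : ℝ} (hβ : 0 ≤ β)
    (hθ1 : θ < 1) (h₀ : 0 < θ₀) (h₁ : 0 < θ₁) (k₀ : 0 < τ₀) (k₁ : 0 < τ₁)
    (e₁ : θ₁ + τ₀ = θ) (e₂ : θ₀ + τ₁ = θ) :
    ∃ C : ℝ≥0∞, C ≠ ∞ ∧ ∀ φ ψ : V → ℂ, Nice φ → Nice ψ →
      recipNorm θ (fun x => ‖bisynth (fun p => ((‖p.1 + p.2‖ ^ β : ℝ) : ℂ)) φ ψ x‖ₑ) ≤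
        C * katoPonce β θ₀ θ₁ τ₀ τ₁ φ ψ := by
  have hθ : 0 < θ := by linarith
  rcases hβ.eq_or_lt with rfl | hβ
  · refine ⟨1, by simp, fun φ ψ hφ hψ => ?_⟩
    have := bisynth_mul (fun _ => 1) (fun _ => 1) φ ψ
    simp only [one_mul] at this
    simp only [Real.rpow_zero, Complex.ofReal_one]
    simp only [one_mul, this, katoPonce, riesz_zero, enorm_mul]
    refine le_trans ?_ le_self_add
    have h := recipNorm_mul_le h₁ k₀ (lowerSemicontinuous_enorm_synth hφ.1).measurable.aemeasurable
      (lowerSemicontinuous_enorm_synth hψ.1).measurable.aemeasurable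
    rwa [e₁] at h
  obtain ⟨k, hk⟩ := exists_nat_gt β
  have hk0 : 0 < k := by exact_mod_cast hβ.trans hk
  have hk2 : β < (2 * k : ℕ) := by push_cast; linarith
  obtain ⟨c, hc, hdiff⟩ := exists_integral_diffMeasure_eq V hβ hk2
  obtain ⟨cQ, -, C, hC, hmaj⟩ := exists_majorant_of_mem_diffSpan hβ hk2 hθ1 h₀ h₁ k₀ k₁ e₁ e₂
    (leibnizDefect_mem (V := V) hk0)
  refine ⟨(ENNReal.ofReal c)⁻¹ * C + 1, ?_, fun φ ψ hφ hψ => ?_⟩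
  · have : ENNReal.ofReal c ≠ 0 := by simpa using hc
    finiteness
  obtain ⟨H, mH, hH, hH'⟩ := hmaj φ ψ hφ hψ
  have hr := hφ.riesz hβ.le
  have hs := hψ.riesz hβ.le
  have hInt : ∀ p : V × V, ∫ t, leibnizDefect (2 * k) (t.1 • t.2) p ∂(diffMeasure V β) =
      (c : ℂ) * (((‖p.1 + p.2‖ ^ β : ℝ) : ℂ) - ((‖p.1‖ ^ β : ℝ) : ℂ) - ((‖p.2‖ ^ β : ℝ) : ℂ)) := by
    intro p
    have h := integral_sub ((hdiff (p.1 + p.2)).1.sub (hdiff p.1).1) (hdiff p.2).1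
    have h' := integral_sub (hdiff (p.1 + p.2)).1 (hdiff p.1).1
    refine h.trans ?_
    simp only [Pi.sub_apply]
    rw [h', (hdiff _).2.2, (hdiff _).2.2, (hdiff _).2.2]
    push_cast; ring
  have hlint : ∀ p : V × V, ∫⁻ t, ‖leibnizDefect (2 * k) (t.1 • t.2) p‖ₑ ∂(diffMeasure V β) ≤
      ENNReal.ofReal (c * ‖p.1 + p.2‖ ^ β + c * ‖p.1‖ ^ β + c * ‖p.2‖ ^ β) := by
    intro p
    rw [ENNReal.ofReal_add (by positivity) (by positivity),
      ENNReal.ofReal_add (by positivity) (by positivity), ← (hdiff _).2.1, ← (hdiff _).2.1,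
      ← (hdiff _).2.1, ← lintegral_add_left ((measurable_delta_smul _).enorm.pow_const _),
      ← lintegral_add_left (f := fun t : ℝ × V => ‖delta (t.1 • t.2) (p.1 + p.2)‖ₑ ^ (2 * k) +
        ‖delta (t.1 • t.2) p.1‖ₑ ^ (2 * k)) (((measurable_delta_smul _).enorm.pow_const _).add
        ((measurable_delta_smul _).enorm.pow_const _))]
    refine lintegral_mono fun t => ?_
    have e : ∀ ξ : V, ‖((‖delta (t.1 • t.2) ξ‖ ^ (2 * k) : ℝ) : ℂ)‖ₑ =
        ‖delta (t.1 • t.2) ξ‖ₑ ^ (2 * k) := fun ξ => by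
      rw [← enorm_pow, ← ofReal_norm, ← ofReal_norm]; simp
    refine (enorm_sub_le.trans (add_le_add enorm_sub_le le_rfl)).trans (le_of_eq ?_)
    simp only [e]
  have hrpow : Continuous fun r : ℝ => r ^ β := Real.continuous_rpow_const hβ.le
  obtain ⟨R, hR0, hR⟩ : ∃ R : ℝ, 0 ≤ R ∧ ∀ (x : V) (p : V × V),
      (wave x p.1 * φ p.1) * (wave x p.2 * ψ p.2) = 0 ∨ ‖p.1‖ ≤ R ∧ ‖p.2‖ ≤ R := by
    obtain ⟨-, R, hR⟩ := hφ
    obtain ⟨-, S, hS⟩ := hψ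
    refine ⟨max 0 (max R S), le_max_left _ _, fun x p => ?_⟩
    by_cases h1 : R < ‖p.1‖
    · left; simp [hR _ h1]
    by_cases h2 : S < ‖p.2‖
    · left; simp [hS _ h2]
    right
    exact ⟨(not_lt.1 h1).trans (by simp), (not_lt.1 h2).trans (by simp)⟩
  have hsub : ∀ x, bisynth (fun p => ∫ t, leibnizDefect (2 * k) (t.1 • t.2) p ∂(diffMeasure V β))
      φ ψ x = c * bisynth (fun p => ((‖p.1 + p.2‖ ^ β : ℝ) : ℂ)) φ ψ x -
        (c * (synth (riesz β φ) x * synth ψ x) + c * (synth φ x * synth (riesz β ψ) x)) := by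
    intro x
    have i1 := integrable_wave_mul_prod hr.1 hψ.1 x
    have i2 := integrable_wave_mul_prod hφ.1 hs.1 x
    have i0 : Integrable fun p : V × V => ((‖p.1 + p.2‖ ^ β : ℝ) : ℂ) *
        ((wave x p.1 * φ p.1) * (wave x p.2 * ψ p.2)) := by
      have hi := integrable_wave_mul_prod hφ.1 hψ.1 x
      refine (hi.norm.const_mul ((R + R) ^ β)).mono'
        ((Continuous.aestronglyMeasurable (by fun_prop)).mul hi.1)
        (Eventually.of_forall fun p => ?_)
      rcases hR x p with h | ⟨h, h'⟩
      · rw [h]; simp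
      rw [norm_mul]
      refine mul_le_mul_of_nonneg_right ?_ (norm_nonneg _)
      rw [Complex.norm_of_nonneg (by positivity)]
      exact Real.rpow_le_rpow (norm_nonneg _) (norm_add_le_of_le h h') hβ.le
    have b1 : synth (riesz β φ) x * synth ψ x =
        ∫ p : V × V, (wave x p.1 * riesz β φ p.1) * (wave x p.2 * ψ p.2) :=
      (integral_prod_mul (fun ξ => wave x ξ * riesz β φ ξ) (fun ξ => wave x ξ * ψ ξ)).symm
    have b2 : synth φ x * synth (riesz β ψ) x =
        ∫ p : V × V, (wave x p.1 * φ p.1) * (wave x p.2 * riesz β ψ p.2) :=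
      (integral_prod_mul (fun ξ => wave x ξ * φ ξ) (fun ξ => wave x ξ * riesz β ψ ξ)).symm
    rw [b1, b2, ← mul_add, ← integral_add i1 i2, bisynth, bisynth, ← mul_sub,
      ← integral_sub (g := fun p : V × V => (wave x p.1 * riesz β φ p.1) * (wave x p.2 * ψ p.2) +
        (wave x p.1 * φ p.1) * (wave x p.2 * riesz β ψ p.2)) i0 (i1.add i2), ← integral_const_mul]
    refine integral_congr_ae (Eventually.of_forall fun p => ?_)
    simp only [hInt, riesz]
    ring
  have hle : ∀ x, ‖bisynth (fun p => ((‖p.1 + p.2‖ ^ β : ℝ) : ℂ)) φ ψ x‖ₑ ≤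
      (ENNReal.ofReal c)⁻¹ * H x + (‖synth (riesz β φ) x‖ₑ * ‖synth ψ x‖ₑ +
        ‖synth φ x‖ₑ * ‖synth (riesz β ψ) x‖ₑ) := by
    intro x
    have hi := integrable_wave_mul_prod hφ.1 hψ.1 x
    have hmeas : Measurable (Function.uncurry fun (t : ℝ × V) (p : V × V) =>
        leibnizDefect (2 * k) (t.1 • t.2) p) := by
      have hc : Continuous fun q : (ℝ × V) × (V × V) => (q.1.1 • q.1.2, q.2) := by fun_prop
      exact (cQ.comp hc).measurable
    have hF := enorm_integral_integral_mul_le (μ := diffMeasure V β) hmeas hi (by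
      refine ((lintegral_mono
        (g := fun p => ENNReal.ofReal (c * (R + R) ^ β + c * R ^ β + c * R ^ β) *
        ‖(wave x p.1 * φ p.1) * (wave x p.2 * ψ p.2)‖ₑ) fun p => ?_).trans_lt ?_).ne
      · rcases hR x p with h | ⟨h, h'⟩
        · simp only [h]; simp
        refine mul_le_mul' ((hlint p).trans (ENNReal.ofReal_le_ofReal ?_)) le_rfl
        have := norm_add_le_of_le h h'
        gcongr
      · rw [lintegral_const_mul' _ _ ENNReal.ofReal_ne_top]
        exact ENNReal.mul_lt_top ENNReal.ofReal_lt_top hi.2)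
    have hF' := hF.trans (hH x)
    change ‖bisynth _ φ ψ x‖ₑ ≤ _ at hF'
    rw [hsub] at hF'
    have hcE : ‖(c : ℂ)‖ₑ = ENNReal.ofReal c := by
      rw [← ofReal_norm, Complex.norm_of_nonneg hc.le]
    have hc0 : ENNReal.ofReal c ≠ 0 := by simpa using hc
    set X := bisynth (fun p => ((‖p.1 + p.2‖ ^ β : ℝ) : ℂ)) φ ψ x
    set Y := synth (riesz β φ) x * synth ψ x with hY
    set Z := synth φ x * synth (riesz β ψ) x with hZ
    have h1 : ENNReal.ofReal c * ‖X‖ₑ ≤ H x + ENNReal.ofReal c * (‖Y‖ₑ + ‖Z‖ₑ) := by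
      rw [← hcE, ← enorm_mul]
      calc ‖(c : ℂ) * X‖ₑ = ‖(c * X - (c * Y + c * Z)) + c * (Y + Z)‖ₑ := by congr 1; ring
        _ ≤ ‖c * X - (c * Y + c * Z)‖ₑ + ‖c * (Y + Z)‖ₑ := enorm_add_le _ _
        _ ≤ _ := by
          refine add_le_add hF' ?_
          rw [enorm_mul]
          exact mul_le_mul' le_rfl (enorm_add_le _ _)
    rw [← enorm_mul, ← enorm_mul, ← hY, ← hZ]
    calc ‖X‖ₑ = (ENNReal.ofReal c)⁻¹ * (ENNReal.ofReal c * ‖X‖ₑ) := by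
          rw [← mul_assoc, ENNReal.inv_mul_cancel hc0 ENNReal.ofReal_ne_top, one_mul]
      _ ≤ (ENNReal.ofReal c)⁻¹ * (H x + ENNReal.ofReal c * (‖Y‖ₑ + ‖Z‖ₑ)) :=
          mul_le_mul' le_rfl h1
      _ = _ := by
          rw [mul_add, ← mul_assoc (ENNReal.ofReal c)⁻¹ (ENNReal.ofReal c),
            ENNReal.inv_mul_cancel hc0 ENNReal.ofReal_ne_top, one_mul]
  have m1 := (lowerSemicontinuous_enorm_synth hφ.1).measurable
  have m2 := (lowerSemicontinuous_enorm_synth hψ.1).measurable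
  have m3 := (lowerSemicontinuous_enorm_synth hr.1).measurable
  have m4 := (lowerSemicontinuous_enorm_synth hs.1).measurable
  refine (recipNorm_mono hθ hle).trans ((recipNorm_add_le hθ hθ1.le (by fun_prop)
    (by fun_prop)).trans ?_)
  rw [add_mul, one_mul, recipNorm_const_mul hθ _ (by simpa using hc), mul_assoc]
  refine add_le_add (mul_le_mul' le_rfl hH') ((recipNorm_add_le hθ hθ1.le (by fun_prop)
    (by fun_prop)).trans (add_le_add ?_ ?_))
  · have h := recipNorm_mul_le h₁ k₀ m3.aemeasurable m2.aemeasurable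
    rwa [e₁] at h
  · have h := recipNorm_mul_le h₀ k₁ m1.aemeasurable m4.aemeasurable
    rwa [e₂] at h

end Bilinear

/-! ### Cauchy integrals of positive functions -/

section CauchyPositive

/-- The Cauchy integral `∫ g(t) i / (z - t) dt`. -/
noncomputable def cauchyUp (g : ℝ → ℝ) (z : ℂ) : ℂ := ∫ t : ℝ, (g t : ℂ) * (Complex.I / (z - t))

lemma exists_norm_rpow_le {p : ℝ} (hp : 1 < p) (hp2 : p ≤ 2) :
    ∃ A B : ℝ, 0 ≤ A ∧ 0 ≤ B ∧ ∀ z : ℂ, 0 < z.re →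
      ‖z‖ ^ p ≤ A * z.re ^ p - B * (z ^ (p : ℂ)).re := by
  have hπ := Real.pi_pos
  set θ₀ := Real.pi / 4 * (1 + 1 / p) with hθ₀
  have hp0 : 0 < p := by linarith
  have hp1 : 1 / p < 1 := by rw [div_lt_one hp0]; exact hp
  have hpp : 0 < 1 / p := by positivity
  have hθpos : 0 < θ₀ := by positivity
  have hθlt : θ₀ < Real.pi / 2 := by
    have := mul_lt_mul_of_pos_left hp1 (show 0 < Real.pi / 4 by positivity)
    simp only [hθ₀]; linarith
  have hpθ : θ₀ * p = Real.pi / 4 * (p + 1) := by simp only [hθ₀]; field_simp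
  have hb : Real.cos (θ₀ * p) < 0 := by
    apply Real.cos_neg_of_pi_div_two_lt_of_lt
    · rw [hpθ]; nlinarith
    · rw [hpθ]; nlinarith
  have ha : 0 < Real.cos θ₀ := Real.cos_pos_of_mem_Ioo ⟨by linarith, hθlt⟩
  set B := -1 / Real.cos (θ₀ * p) with hB
  have hB0 : 0 ≤ B := div_nonneg_of_nonpos (by norm_num) hb.le
  have hBc : B * Real.cos (θ₀ * p) = -1 := div_mul_cancel₀ _ hb.ne
  set A := (1 + B) / Real.cos θ₀ ^ p with hA
  have hcp : 0 < Real.cos θ₀ ^ p := by positivity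
  have hAc : A * Real.cos θ₀ ^ p = 1 + B := div_mul_cancel₀ _ hcp.ne'
  refine ⟨A, B, by positivity, hB0, fun z hz => ?_⟩
  have harg : |z.arg| < Real.pi / 2 := Complex.abs_arg_lt_pi_div_two_iff.2 (Or.inl hz)
  have hcos : Real.cos z.arg = Real.cos |z.arg| := (Real.cos_abs _).symm
  have hcos' : Real.cos (z.arg * p) = Real.cos (|z.arg| * p) := by
    rw [← Real.cos_abs, abs_mul, abs_of_pos hp0]
  have hcn : 0 ≤ Real.cos |z.arg| := Real.cos_nonneg_of_mem_Icc
    ⟨by linarith [abs_nonneg z.arg], harg.le⟩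
  rw [Complex.cpow_ofReal_re, ← Complex.norm_mul_cos_arg, hcos, hcos',
    Real.mul_rpow (norm_nonneg _) hcn]
  have key : 1 ≤ A * Real.cos |z.arg| ^ p - B * Real.cos (|z.arg| * p) := by
    rcases le_total |z.arg| θ₀ with h | h
    · have h1 : Real.cos θ₀ ^ p ≤ Real.cos |z.arg| ^ p :=
        Real.rpow_le_rpow ha.le (Real.cos_le_cos_of_nonneg_of_le_pi (abs_nonneg _)
          (by linarith) h) hp0.le
      have h2 : A * Real.cos θ₀ ^ p ≤ A * Real.cos |z.arg| ^ p :=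
        mul_le_mul_of_nonneg_left h1 (by positivity)
      have h3 : B * Real.cos (|z.arg| * p) ≤ B * 1 :=
        mul_le_mul_of_nonneg_left (Real.cos_le_one _) hB0
      linarith
    · have h1 : Real.cos (|z.arg| * p) ≤ Real.cos (θ₀ * p) := by
        apply Real.cos_le_cos_of_nonneg_of_le_pi (by positivity)
        · nlinarith
        · exact mul_le_mul_of_nonneg_right h hp0.le
      have h2 : B * Real.cos (|z.arg| * p) ≤ B * Real.cos (θ₀ * p) :=
        mul_le_mul_of_nonneg_left h1 hB0
      have h3 : 0 ≤ A * Real.cos |z.arg| ^ p := by positivity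
      linarith
  have hn : 0 ≤ ‖z‖ ^ p := by positivity
  nlinarith [mul_le_mul_of_nonneg_left key hn]

lemma im_le_norm_sub_ofReal (z : ℂ) (t : ℝ) : z.im ≤ ‖z - t‖ := by
  have := Complex.abs_im_le_norm (z - t)
  simp only [Complex.sub_im, Complex.ofReal_im, sub_zero] at this
  exact (le_abs_self _).trans this

lemma integrable_cauchyUp {g : ℝ → ℝ} (hg : Integrable g) {z : ℂ} (hz : 0 < z.im) :
    Integrable fun t : ℝ => (g t : ℂ) * (Complex.I / (z - t)) := by
  refine (hg.ofReal (𝕜 := ℂ)).mul_bdd (c := 1 / z.im) ?_ (Eventually.of_forall fun t => ?_)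
  · exact (Measurable.aestronglyMeasurable (by fun_prop))
  · rw [norm_div, Complex.norm_I]
    exact one_div_le_one_div_of_le hz (im_le_norm_sub_ofReal z t)

lemma norm_cauchyUp_le {g : ℝ → ℝ} (hg : Integrable g) (hg0 : ∀ t, 0 ≤ g t) {z : ℂ} {δ : ℝ}
    (hδ : 0 < δ) (h : ∀ t, g t ≠ 0 → δ ≤ ‖z - t‖) : ‖cauchyUp g z‖ ≤ (∫ t, g t) / δ := by
  rw [div_eq_mul_inv, ← integral_mul_const]
  refine norm_integral_le_of_norm_le (hg.mul_const _) (Eventually.of_forall fun t => ?_)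
  by_cases ht : g t = 0
  · simp [ht]
  rw [norm_mul, norm_div, Complex.norm_I, Complex.norm_of_nonneg (hg0 t), one_div]
  exact mul_le_mul_of_nonneg_left (inv_anti₀ hδ (h t ht)) (hg0 t)

lemma differentiableAt_cauchyUp {g : ℝ → ℝ} (hg : Integrable g) {z : ℂ} (hz : 0 < z.im) :
    DifferentiableAt ℂ (cauchyUp g) z := by
  have hball : ∀ w ∈ Metric.ball z (z.im / 2), z.im / 2 < w.im := by
    intro w hw
    rw [Metric.mem_ball, dist_eq_norm] at hw
    have := (Complex.abs_im_le_norm (w - z)).trans_lt hw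
    rw [Complex.sub_im, abs_lt] at this
    linarith
  have hne : ∀ w ∈ Metric.ball z (z.im / 2), ∀ t : ℝ, w - t ≠ 0 := by
    intro w hw t h
    have := im_le_norm_sub_ofReal w t
    rw [h, norm_zero] at this
    linarith [hball w hw]
  have h := hasDerivAt_integral_of_dominated_loc_of_deriv_le (μ := volume)
    (F := fun (w : ℂ) (t : ℝ) => (g t : ℂ) * (Complex.I / (w - t)))
    (F' := fun (w : ℂ) (t : ℝ) => (g t : ℂ) * (-Complex.I / (w - t) ^ 2))
    (bound := fun t => |g t| * (1 / (z.im / 2) ^ 2)) (x₀ := z)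
    (Metric.ball_mem_nhds z (half_pos hz))
    (Filter.eventually_of_mem (Metric.ball_mem_nhds z (half_pos hz)) fun w hw =>
      (integrable_cauchyUp hg (by linarith [hball w hw])).1)
    (integrable_cauchyUp hg hz)
    ((hg.ofReal (𝕜 := ℂ)).1.mul (Measurable.aestronglyMeasurable (by fun_prop)))
    (Eventually.of_forall fun t w hw => ?_) (hg.abs.mul_const _)
    (Eventually.of_forall fun t w hw => ?_)
  · exact h.2.differentiableAt
  · rw [norm_mul, Complex.norm_real, Real.norm_eq_abs, norm_div, norm_neg, Complex.norm_I, norm_pow]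
    refine mul_le_mul_of_nonneg_left (one_div_le_one_div_of_le (by positivity) ?_) (abs_nonneg _)
    exact pow_le_pow_left₀ (by positivity) ((hball w hw).le.trans (im_le_norm_sub_ofReal w t)) 2
  · have h1 : HasDerivAt (fun w : ℂ => w - t) 1 w := (hasDerivAt_id w).sub_const _
    have := ((hasDerivAt_const w Complex.I).div h1 (hne w hw t)).const_mul (g t : ℂ)
    simpa using this

lemma re_cauchyUp {g : ℝ → ℝ} (hg : Integrable g) {z : ℂ} (hz : 0 < z.im) :
    (cauchyUp g z).re = ∫ t, g t * (z.im / Complex.normSq (z - t)) := by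
  have h := integral_re (integrable_cauchyUp hg hz)
  simp only [RCLike.re_to_complex] at h
  rw [cauchyUp, ← h]
  congr 1; ext t
  rw [Complex.re_ofReal_mul, Complex.div_re]
  simp

lemma re_cauchyUp_pos {g : ℝ → ℝ} (hg : Integrable g) (hg0 : ∀ t, 0 ≤ g t)
    (hpos : ∫ t, g t ≠ 0) {z : ℂ} (hz : 0 < z.im) : 0 < (cauchyUp g z).re := by
  rw [re_cauchyUp hg hz]
  have hn : ∀ t : ℝ, 0 < z.im / Complex.normSq (z - t) := fun t => by
    refine div_pos hz (Complex.normSq_pos.2 fun h => ?_)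
    have := im_le_norm_sub_ofReal z t
    rw [h, norm_zero] at this
    linarith
  have h0 : ∀ t, 0 ≤ g t * (z.im / Complex.normSq (z - t)) := fun t =>
    mul_nonneg (hg0 t) (hn t).le
  refine lt_of_le_of_ne (integral_nonneg h0) fun h => hpos ?_
  have hi : Integrable fun t => g t * (z.im / Complex.normSq (z - t)) := by
    have := (integrable_cauchyUp hg hz).re
    refine this.congr (Eventually.of_forall fun t => ?_)
    simp only [RCLike.re_to_complex]
    rw [Complex.re_ofReal_mul, Complex.div_re]
    simp
  have := (integral_eq_zero_iff_of_nonneg (fun t => h0 t) hi).1 h.symm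
  refine integral_eq_zero_of_ae (this.mono fun t ht => ?_)
  simp only [Pi.zero_apply, mul_eq_zero, (hn t).ne', or_false] at ht
  exact ht

/-- The contour argument of M. Riesz. -/
lemma norm_integral_cauchyUp_cpow_le {p : ℝ} (hp : 1 < p) {g : ℝ → ℝ} (hg : Integrable g)
    (hg0 : ∀ t, 0 ≤ g t) (hpos : ∫ t, g t ≠ 0) {S : ℝ} (hS : ∀ t, S < |t| → g t = 0) {y R : ℝ}
    (hy : 0 < y) (hR : 0 < R) (hSR : 2 * S ≤ R) :
    ‖∫ x in (-R)..R, cauchyUp g (x + y * Complex.I) ^ (p : ℂ)‖ ≤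
      (2 * ∫ t, g t) ^ p * (4 * R ^ (1 - p)) := by
  set G := ∫ t, g t with hG
  have hGpos : 0 ≤ G := integral_nonneg hg0
  set f : ℂ → ℂ := fun z => cauchyUp g z ^ (p : ℂ) with hf
  have hd : ∀ z : ℂ, 0 < z.im → DifferentiableAt ℂ f z := fun z hz =>
    (differentiableAt_cauchyUp hg hz).cpow_const (Or.inl (re_cauchyUp_pos hg hg0 hpos hz))
  have hrect := Complex.integral_boundary_rect_eq_zero_of_differentiableOn f (-R + y * Complex.I)
    (R + (y + R : ℝ) * Complex.I) (by
      intro z hz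
      refine (hd z ?_).differentiableWithinAt
      have := hz.2
      simp only [Complex.add_im, Complex.neg_im, Complex.ofReal_im, Complex.mul_im,
        Complex.ofReal_re, Complex.I_im, Complex.I_re, mem_preimage] at this
      rw [uIcc_of_le (by linarith)] at this
      have := this.1
      linarith)
  have hbound : ∀ z : ℂ, 0 < z.im → (∀ t, g t ≠ 0 → R / 2 ≤ ‖z - t‖) →
      ‖f z‖ ≤ (2 * G / R) ^ p := by
    intro z hz h
    have hw := re_cauchyUp_pos hg hg0 hpos hz
    have hw0 : cauchyUp g z ≠ 0 := fun h => by rw [h] at hw; simp at hw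
    simp only [hf]
    rw [Complex.norm_cpow_real]
    refine Real.rpow_le_rpow (norm_nonneg _) ((norm_cauchyUp_le hg hg0 (half_pos hR) h).trans
      (le_of_eq ?_)) (by linarith)
    rw [← hG]
    field_simp
  have hside : ∀ x : ℝ, |x| = R → ∀ η : ℝ, ∀ t, g t ≠ 0 →
      R / 2 ≤ ‖(x + η * Complex.I : ℂ) - t‖ := by
    intro x hx η t ht
    have h1 : |t| ≤ S := not_lt.1 fun h => ht (hS t h)
    have h2 := Complex.abs_re_le_norm ((x + η * Complex.I : ℂ) - t)
    simp only [Complex.sub_re, Complex.add_re, Complex.ofReal_re, Complex.mul_re, Complex.I_re,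
      Complex.ofReal_im, Complex.I_im, mul_zero, mul_one, sub_zero, add_zero] at h2
    have h3 := abs_sub_abs_le_abs_sub x t
    linarith
  simp only [Complex.add_im, Complex.neg_im, Complex.ofReal_im, Complex.mul_im, Complex.ofReal_re,
    Complex.I_im, Complex.I_re, Complex.add_re, Complex.neg_re, Complex.mul_re, mul_zero, mul_one,
    neg_zero, add_zero, zero_add, sub_self] at hrect
  have hT : ‖∫ x in (-R)..R, f (x + (y + R : ℝ) * Complex.I)‖ ≤ (2 * G / R) ^ p * |R - -R| := by
    refine intervalIntegral.norm_integral_le_of_norm_le_const fun x _ => ?_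
    refine hbound _ (by simp; linarith) fun t _ => ?_
    refine le_trans ?_ (im_le_norm_sub_ofReal _ t)
    simp; linarith
  have hV : ∀ s : ℝ, |s| = R → ‖∫ η in y..(y + R), f (s + η * Complex.I)‖ ≤
      (2 * G / R) ^ p * |y + R - y| := by
    intro s hs
    refine intervalIntegral.norm_integral_le_of_norm_le_const fun η hη => ?_
    rw [uIoc_of_le (by linarith)] at hη
    refine hbound _ (by simp; linarith [hη.1]) (hside s hs η)
  have hV1 := hV R (abs_of_pos hR)
  have hV2 := hV (-R) (by rw [abs_neg, abs_of_pos hR])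
  have e : ∫ x in (-R)..R, cauchyUp g (x + y * Complex.I) ^ (p : ℂ) =
      (∫ x in (-R)..R, f (x + (y + R : ℝ) * Complex.I)) -
        Complex.I • (∫ η in y..(y + R), f (R + η * Complex.I)) +
        Complex.I • (∫ η in y..(y + R), f (((-R : ℝ) : ℂ) + η * Complex.I)) := by
    linear_combination hrect
  have hI : ∀ u : ℂ, ‖Complex.I • u‖ = ‖u‖ := fun u => by rw [norm_smul, Complex.norm_I, one_mul]
  rw [← hI] at hV1 hV2
  rw [e]
  refine (norm_add_le_of_le (norm_sub_le_of_le hT hV1) hV2).trans (le_of_eq ?_)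
  rw [Real.div_rpow (by positivity) hR.le, Real.rpow_sub hR, Real.rpow_one,
    show R - -R = 2 * R by ring, abs_of_pos (by linarith : 0 < 2 * R),
    show y + R - y = R by ring, abs_of_pos hR]
  ring

end CauchyPositive

/-! ### Young's inequality -/

section Young

lemma recipNorm_lconvolution_le {θ : ℝ} (hθ : 0 < θ) (hθ1 : θ < 1) {k H : ℝ → ℝ≥0∞}
    (hk : Measurable k) (hH : Measurable H) :
    recipNorm θ (fun x => ∫⁻ s, k s * H (x - s)) ≤ (∫⁻ s, k s) * recipNorm θ H := by
  have h1 : 0 < 1 - θ := by linarith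
  set M := ∫⁻ s, k s with hM
  have hc : (1 / (1 - θ)).HolderConjugate (1 / θ) := by
    rw [Real.holderConjugate_iff]
    constructor
    · rw [one_lt_div h1]; linarith
    · simp
  have hpt : ∀ x, (∫⁻ s, k s * H (x - s)) ^ (1 / θ) ≤
      M ^ ((1 - θ) / θ) * ∫⁻ s, k s * H (x - s) ^ (1 / θ) := by
    intro x
    have h := ENNReal.lintegral_mul_le_Lp_mul_Lq volume hc (f := fun s => k s ^ (1 - θ))
      (g := fun s => k s ^ θ * H (x - s)) (by fun_prop) (by fun_prop)
    have e1 : ∀ s, ((fun s => k s ^ (1 - θ)) * fun s => k s ^ θ * H (x - s)) s =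
        k s * H (x - s) := fun s => by
      simp only [Pi.mul_apply]
      rw [← mul_assoc, ← ENNReal.rpow_add_of_nonneg _ _ h1.le hθ.le, sub_add_cancel,
        ENNReal.rpow_one]
    have e2 : ∀ s, (k s ^ (1 - θ)) ^ (1 / (1 - θ)) = k s := fun s => by
      rw [← ENNReal.rpow_mul, mul_one_div_cancel h1.ne', ENNReal.rpow_one]
    have e3 : ∀ s, (k s ^ θ * H (x - s)) ^ (1 / θ) = k s * H (x - s) ^ (1 / θ) := fun s => by
      rw [ENNReal.mul_rpow_of_nonneg _ _ (by positivity), ← ENNReal.rpow_mul,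
        mul_one_div_cancel hθ.ne', ENNReal.rpow_one]
    simp only [e1, e2, e3, one_div_one_div] at h
    refine (ENNReal.rpow_le_rpow h (by positivity)).trans (le_of_eq ?_)
    rw [ENNReal.mul_rpow_of_nonneg _ _ (by positivity), ← ENNReal.rpow_mul, ← ENNReal.rpow_mul,
      mul_one_div_cancel hθ.ne', ENNReal.rpow_one, ← hM, mul_one_div]
  have hmeas : Measurable (Function.uncurry fun (x s : ℝ) => k s * H (x - s) ^ (1 / θ)) := by
    unfold Function.uncurry; fun_prop
  have htot : ∫⁻ x, (∫⁻ s, k s * H (x - s)) ^ (1 / θ) ≤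
      M ^ (1 / θ) * ∫⁻ x, H x ^ (1 / θ) := by
    refine (lintegral_mono hpt).trans (le_of_eq ?_)
    rw [lintegral_const_mul _ hmeas.lintegral_prod_right,
      lintegral_lintegral_swap hmeas.aemeasurable]
    have : ∀ s, ∫⁻ x, k s * H (x - s) ^ (1 / θ) = k s * ∫⁻ x, H x ^ (1 / θ) := fun s => by
      rw [lintegral_const_mul _ (by fun_prop), lintegral_sub_right_eq_self (fun x => H x ^ (1 / θ))]
    simp only [this]
    rw [lintegral_mul_const _ hk, ← mul_assoc, ← hM]
    congr 1
    nth_rewrite 2 [← ENNReal.rpow_one M]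
    rw [← ENNReal.rpow_add_of_nonneg _ _ (by positivity) zero_le_one]
    congr 1; field_simp; ring
  refine (ENNReal.rpow_le_rpow htot hθ.le).trans (le_of_eq ?_)
  rw [ENNReal.mul_rpow_of_nonneg _ _ hθ.le, ← ENNReal.rpow_mul, one_div_mul_cancel hθ.ne',
    ENNReal.rpow_one, recipNorm]

end Young

/-! ### Bounds for Cauchy integrals at positive height -/

section RieszPositive

lemma lintegral_poisson {y : ℝ} (hy : 0 < y) :
    ∫⁻ s : ℝ, ENNReal.ofReal (y / (s ^ 2 + y ^ 2)) = ENNReal.ofReal Real.pi := by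
  have e : (fun s : ℝ => y / (s ^ 2 + y ^ 2)) = fun s => y⁻¹ * (1 + (y⁻¹ * s) ^ 2)⁻¹ := by
    ext s; field_simp; ring
  have hi : Integrable fun s : ℝ => y / (s ^ 2 + y ^ 2) := by
    rw [e]
    exact ((integrable_inv_one_add_sq.comp_mul_left' (inv_ne_zero hy.ne')).const_mul _)
  rw [← ofReal_integral_eq_lintegral_ofReal hi (Eventually.of_forall fun s => by positivity), e,
    integral_const_mul, Measure.integral_comp_mul_left (fun s : ℝ => (1 + s ^ 2)⁻¹),
    integral_univ_inv_one_add_sq]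
  congr 1
  rw [inv_inv, abs_of_pos hy, smul_eq_mul, inv_mul_cancel_left₀ hy.ne']

lemma recipNorm_re_cauchyUp_le {θ : ℝ} (hθ : 0 < θ) (hθ1 : θ < 1) {g : ℝ → ℝ} (hm : Measurable g)
    (hg : Integrable g) (hg0 : ∀ t, 0 ≤ g t) {y : ℝ} (hy : 0 < y) :
    recipNorm θ (fun x : ℝ => ENNReal.ofReal (cauchyUp g (x + y * Complex.I)).re) ≤
      ENNReal.ofReal Real.pi * recipNorm θ (fun t => ENNReal.ofReal (g t)) := by
  rw [← lintegral_poisson hy]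
  refine le_trans (le_of_eq ?_) (recipNorm_lconvolution_le hθ hθ1 (by fun_prop) (by fun_prop))
  congr 1; ext x
  have him : (x + y * Complex.I : ℂ).im = y := by simp
  have hz : 0 < (x + y * Complex.I : ℂ).im := by rw [him]; exact hy
  have hi : Integrable fun t => g t * ((x + y * Complex.I : ℂ).im /
      Complex.normSq ((x + y * Complex.I : ℂ) - t)) := by
    refine (integrable_cauchyUp hg hz).re.congr (Eventually.of_forall fun t => ?_)
    simp only [RCLike.re_to_complex]
    rw [Complex.re_ofReal_mul, Complex.div_re]
    simp
  rw [re_cauchyUp hg hz, ofReal_integral_eq_lintegral_ofReal hi (Eventually.of_forall fun t =>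
    mul_nonneg (hg0 t) (div_nonneg hz.le (Complex.normSq_nonneg _))),
    ← lintegral_sub_left_eq_self _ x]
  refine lintegral_congr fun s => ?_
  rw [← ENNReal.ofReal_mul (by positivity), him, mul_comm]
  congr 3
  simp only [Complex.normSq_apply, Complex.sub_re, Complex.sub_im, Complex.add_re, Complex.add_im,
    Complex.ofReal_re, Complex.ofReal_im, Complex.mul_re, Complex.mul_im, Complex.I_re,
    Complex.I_im]
  ring

lemma exists_recipNorm_cauchyUp_le {θ : ℝ} (hθ : 1 / 2 ≤ θ) (hθ1 : θ < 1) :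
    ∃ C : ℝ≥0∞, C ≠ ∞ ∧ ∀ g : ℝ → ℝ, Measurable g → Integrable g → (∀ t, 0 ≤ g t) →
      (∃ S : ℝ, ∀ t, S < |t| → g t = 0) → ∀ y : ℝ, 0 < y →
      recipNorm θ (fun x : ℝ => ‖cauchyUp g (x + y * Complex.I)‖ₑ) ≤
        C * recipNorm θ (fun t => ENNReal.ofReal (g t)) := by
  have hθ0 : 0 < θ := by linarith
  set p := 1 / θ with hp
  have hp0 : 0 < p := by positivity
  have hp1 : 1 < p := by rw [hp, one_lt_div hθ0]; exact hθ1
  have hp2 : p ≤ 2 := by rw [hp, div_le_iff₀ hθ0]; linarith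
  obtain ⟨A, B, hA, hB, hAB⟩ := exists_norm_rpow_le hp1 hp2
  refine ⟨ENNReal.ofReal A ^ θ * ENNReal.ofReal Real.pi, by finiteness, ?_⟩
  rintro g hm hg hg0 ⟨S, hS⟩ y hy
  by_cases hpos : ∫ t, g t = 0
  · have h0 : g =ᵐ[volume] 0 := (integral_eq_zero_iff_of_nonneg hg0 hg).1 hpos
    have hw : ∀ z, cauchyUp g z = 0 := fun z => by
      refine integral_eq_zero_of_ae (h0.mono fun t ht => ?_)
      simp [ht]
    simp only [hw, enorm_zero]
    simp [recipNorm, hθ0]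
  set w : ℝ → ℂ := fun x => cauchyUp g (x + y * Complex.I) with hw
  have him : ∀ x : ℝ, 0 < (x + y * Complex.I : ℂ).im := fun x => by simpa using hy
  have hre : ∀ x, 0 < (w x).re := fun x => re_cauchyUp_pos hg hg0 hpos (him x)
  have cw : Continuous w := by
    rw [continuous_iff_continuousAt]
    intro x
    exact ContinuousAt.comp (f := fun x : ℝ => (x + y * Complex.I : ℂ))
      (differentiableAt_cauchyUp hg (him x)).continuousAt (by fun_prop)
  have c1 : Continuous fun x => ‖w x‖ ^ p := cw.norm.rpow_const fun _ => Or.inr hp0.le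
  have c2 : Continuous fun x => (w x).re ^ p :=
    (Complex.continuous_re.comp cw).rpow_const fun _ => Or.inr hp0.le
  have c3 : Continuous fun x => w x ^ (p : ℂ) := by
    rw [continuous_iff_continuousAt]
    exact fun x => cw.continuousAt.cpow continuousAt_const (Or.inl (hre x))
  set G := ∫ t, g t with hG
  set I := ∫⁻ x, ENNReal.ofReal (w x).re ^ p with hI
  have hofp : ∀ r : ℝ, 0 ≤ r → ENNReal.ofReal (r ^ p) = ENNReal.ofReal r ^ p := fun r hr =>
    (ENNReal.ofReal_rpow_of_nonneg hr hp0.le).symm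
  have hR : ∀ R : ℝ, 0 < R → 2 * S ≤ R → ∫⁻ x in Ioc (-R) R, ‖w x‖ₑ ^ p ≤
      ENNReal.ofReal A * I + ENNReal.ofReal (B * ((2 * G) ^ p * (4 * R ^ (1 - p)))) := by
    intro R hR hSR
    have hle : -R ≤ R := by linarith
    have i1 : IntegrableOn (fun x => ‖w x‖ ^ p) (Ioc (-R) R) := c1.integrableOn_Ioc
    have i2 : IntegrableOn (fun x => (w x).re ^ p) (Ioc (-R) R) := c2.integrableOn_Ioc
    have i3 : IntegrableOn (fun x => w x ^ (p : ℂ)) (Ioc (-R) R) := c3.integrableOn_Ioc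
    have s1 : ∫⁻ x in Ioc (-R) R, ‖w x‖ₑ ^ p = ENNReal.ofReal (∫ x in Ioc (-R) R, ‖w x‖ ^ p) := by
      rw [ofReal_integral_eq_lintegral_ofReal i1 (Eventually.of_forall fun x => by positivity)]
      simp only [hofp _ (norm_nonneg _), ofReal_norm]
    have s2 : ENNReal.ofReal (∫ x in Ioc (-R) R, (w x).re ^ p) ≤ I := by
      rw [ofReal_integral_eq_lintegral_ofReal i2 (Eventually.of_forall fun x =>
        Real.rpow_nonneg (hre x).le _)]
      simp only [hofp _ (hre _).le]
      exact setLIntegral_le_lintegral _ _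
    have s3 : ∫ x in Ioc (-R) R, ‖w x‖ ^ p ≤ A * (∫ x in Ioc (-R) R, (w x).re ^ p) -
        B * (∫ x in Ioc (-R) R, w x ^ (p : ℂ)).re := by
      have i4 : IntegrableOn (fun x => (w x ^ (p : ℂ)).re) (Ioc (-R) R) := i3.re
      have hre' : ∫ x in Ioc (-R) R, (w x ^ (p : ℂ)).re =
        (∫ x in Ioc (-R) R, w x ^ (p : ℂ)).re := integral_re i3
      rw [← hre', ← integral_const_mul, ← integral_const_mul,
        ← integral_sub (i2.const_mul A) (i4.const_mul B)]
      exact integral_mono i1 ((i2.const_mul A).sub (i4.const_mul B)) fun x => hAB _ (hre x)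
    have s4 := norm_integral_cauchyUp_cpow_le hp1 hg hg0 hpos hS hy hR hSR
    rw [intervalIntegral.integral_of_le hle] at s4
    have s5 : -(B * (∫ x in Ioc (-R) R, w x ^ (p : ℂ)).re) ≤
        B * ((2 * G) ^ p * (4 * R ^ (1 - p))) := by
      rw [← mul_neg]
      refine mul_le_mul_of_nonneg_left (le_trans ?_ s4) hB
      exact (neg_le_abs _).trans (Complex.abs_re_le_norm _)
    rw [s1]
    have s6 : ∫ x in Ioc (-R) R, ‖w x‖ ^ p ≤ A * (∫ x in Ioc (-R) R, (w x).re ^ p) +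
        B * ((2 * G) ^ p * (4 * R ^ (1 - p))) := by linarith
    refine (ENNReal.ofReal_le_ofReal s6).trans
      (ENNReal.ofReal_add_le.trans (add_le_add ?_ le_rfl))
    rw [ENNReal.ofReal_mul hA]
    exact mul_le_mul' le_rfl s2
  have hlim : ∫⁻ x, ‖w x‖ₑ ^ p ≤ ENNReal.ofReal A * I := by
    have t1 := (aecover_Ioc (μ := volume) tendsto_neg_atTop_atBot
      tendsto_id).lintegral_tendsto_of_countably_generated (f := fun x => ‖w x‖ₑ ^ p)
      (cw.enorm.measurable.pow_const p).aemeasurable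
    have t2 : Tendsto (fun R : ℝ => ENNReal.ofReal A * I +
        ENNReal.ofReal (B * ((2 * G) ^ p * (4 * R ^ (1 - p))))) atTop
        (𝓝 (ENNReal.ofReal A * I + ENNReal.ofReal (B * ((2 * G) ^ p * (4 * 0))))) := by
      refine tendsto_const_nhds.add (ENNReal.tendsto_ofReal ?_)
      have := tendsto_rpow_neg_atTop (y := p - 1) (by linarith)
      rw [neg_sub] at this
      exact ((this.const_mul 4).const_mul _).const_mul _
    have := le_of_tendsto_of_tendsto t1 t2 (by
      filter_upwards [eventually_gt_atTop 0, eventually_ge_atTop (2 * S)] with R h1 h2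
      exact hR R h1 h2)
    simpa using this
  have hrp := recipNorm_re_cauchyUp_le hθ0 hθ1 hm hg hg0 hy
  rw [mul_assoc]
  refine le_trans ?_ (mul_le_mul' le_rfl hrp)
  unfold recipNorm
  rw [← ENNReal.mul_rpow_of_nonneg _ _ hθ0.le]
  exact ENNReal.rpow_le_rpow hlim hθ0.le

end RieszPositive

lemma measurable_integral_mul_sub {K u : ℝ → ℂ} (hK : Measurable K) (hu : Measurable u) :
    Measurable fun x => ∫ s, K s * u (x - s) := by
  have : Measurable (Function.uncurry fun (x s : ℝ) => K s * u (x - s)) := by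
    unfold Function.uncurry; fun_prop
  exact this.stronglyMeasurable.integral_prod_right.measurable

lemma recipNorm_le_of_tendsto {X : Type*} [MeasureSpace X] {θ : ℝ} (hθ : 0 < θ) {f : ℕ → X → ℂ}
    {g : X → ℂ} (hf : ∀ n, Measurable (f n)) (hfg : ∀ x, Tendsto (fun n => f n x) atTop (𝓝 (g x)))
    {A : ℝ≥0∞} (hA : ∀ n, recipNorm θ (fun x => ‖f n x‖ₑ) ≤ A) :
    recipNorm θ (fun x => ‖g x‖ₑ) ≤ A := by
  have h1 : ∀ n, ∫⁻ x, ‖f n x‖ₑ ^ (1 / θ) ≤ A ^ (1 / θ) := fun n => by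
    have := ENNReal.rpow_le_rpow (hA n) (z := 1 / θ) (by positivity)
    rwa [recipNorm, ← ENNReal.rpow_mul, mul_one_div_cancel hθ.ne', ENNReal.rpow_one] at this
  have h2 : ∫⁻ x, ‖g x‖ₑ ^ (1 / θ) ≤ A ^ (1 / θ) := by
    have e : ∀ x, ‖g x‖ₑ ^ (1 / θ) = liminf (fun n => ‖f n x‖ₑ ^ (1 / θ)) atTop := fun x =>
      (((ENNReal.continuous_rpow_const (y := 1 / θ)).tendsto _).comp
        ((continuous_enorm.tendsto _).comp (hfg x))).liminf_eq.symm
    simp only [e]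
    refine (lintegral_liminf_le fun n => (hf n).enorm.pow_const _).trans ?_
    exact (liminf_le_liminf (Eventually.of_forall h1)).trans (by simp)
  have := ENNReal.rpow_le_rpow h2 hθ.le
  rwa [← ENNReal.rpow_mul, one_div_mul_cancel hθ.ne', ENNReal.rpow_one] at this

lemma recipNorm_sub_le {X : Type*} [MeasureSpace X] {θ : ℝ} (hθ : 0 < θ) (hθ1 : θ ≤ 1)
    {f g : X → ℂ} (hf : Measurable f) (hg : Measurable g) :
    recipNorm θ (fun x => ‖f x - g x‖ₑ) ≤
      recipNorm θ (fun x => ‖f x‖ₑ) + recipNorm θ (fun x => ‖g x‖ₑ) :=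
  (recipNorm_mono hθ fun _ => enorm_sub_le).trans
    (recipNorm_add_le hθ hθ1 hf.enorm.aemeasurable hg.enorm.aemeasurable)

/-- The kernel whose Fourier transform is `(e^{-bτ} - e^{-Nτ}) 1_{τ > 0}`. -/
noncomputable def halfKernel (b N s : ℝ) : ℂ :=
  1 / ((b : ℂ) - 2 * Real.pi * s * Complex.I) - 1 / ((N : ℂ) - 2 * Real.pi * s * Complex.I)

/-! ### The kernel of a half-line symbol -/

section Kernel

variable {b N : ℝ}

lemma sub_two_pi_mul_I_ne_zero (hb : 0 < b) (s : ℝ) :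
    (b : ℂ) - 2 * Real.pi * s * Complex.I ≠ 0 := by
  intro h
  have := congrArg Complex.re h
  simp at this
  exact hb.ne' this

lemma continuous_halfKernel (hb : 0 < b) (hN : 0 < N) : Continuous (halfKernel b N) := by
  unfold halfKernel
  exact (Continuous.div (by fun_prop) (by fun_prop) (sub_two_pi_mul_I_ne_zero hb)).sub
    (Continuous.div (by fun_prop) (by fun_prop) (sub_two_pi_mul_I_ne_zero hN))

lemma halfKernel_neg (s : ℝ) : halfKernel b N (-s) = starRingEnd ℂ (halfKernel b N s) := by
  simp only [halfKernel, map_sub, map_div₀, map_one, map_mul, Complex.conj_ofReal, Complex.conj_I,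
    map_ofNat]
  push_cast
  ring_nf

lemma integrable_halfKernel (hb : 0 < b) (hN : 0 < N) : Integrable (halfKernel b N) := by
  set c := min 1 (min b N) with hc
  have hc0 : 0 < c := by positivity
  have hcN : c ≤ N := (min_le_right _ _).trans (min_le_right _ _)
  have hcb : c ≤ b := (min_le_right _ _).trans (min_le_left _ _)
  have hc1 : c ≤ 1 := min_le_left _ _
  have key : ∀ a : ℝ, c ≤ a → ∀ s : ℝ,
      c * √(1 + s ^ 2) ≤ ‖(a : ℂ) - 2 * Real.pi * s * Complex.I‖ := by
    intro a ha s
    rw [← Real.sqrt_sq hc0.le, ← Real.sqrt_mul (by positivity), Complex.norm_def]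
    refine Real.sqrt_le_sqrt ?_
    have e : Complex.normSq ((a : ℂ) - 2 * Real.pi * s * Complex.I) =
        a ^ 2 + (2 * Real.pi) ^ 2 * s ^ 2 := by
      simp [Complex.normSq_apply]; ring
    rw [e]
    have h1 : c ^ 2 ≤ a ^ 2 := by gcongr
    have h2 : c ^ 2 ≤ (2 * Real.pi) ^ 2 := by
      have := Real.pi_gt_three
      gcongr; linarith
    nlinarith [mul_le_mul_of_nonneg_right h2 (sq_nonneg s)]
  have h1 : Integrable fun s : ℝ => |N - b| / c ^ 2 * (1 + s ^ 2)⁻¹ :=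
    integrable_inv_one_add_sq.const_mul _
  refine h1.mono' (continuous_halfKernel hb hN).aestronglyMeasurable
    (Eventually.of_forall fun s => ?_)
  have e : halfKernel b N s = ((N - b : ℝ) : ℂ) / (((b : ℂ) - 2 * Real.pi * s * Complex.I) *
      ((N : ℂ) - 2 * Real.pi * s * Complex.I)) := by
    have := sub_two_pi_mul_I_ne_zero hb s
    have := sub_two_pi_mul_I_ne_zero hN s
    unfold halfKernel; push_cast
    field_simp
    ring
  rw [e, norm_div, norm_mul, Complex.norm_real, Real.norm_eq_abs, ← div_eq_mul_inv, div_div]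
  refine div_le_div_of_nonneg_left (abs_nonneg _) (by positivity) ?_
  calc c ^ 2 * (1 + s ^ 2) = (c * √(1 + s ^ 2)) * (c * √(1 + s ^ 2)) := by
        rw [mul_mul_mul_comm, Real.mul_self_sqrt (by positivity)]; ring
    _ ≤ _ := mul_le_mul (key b hcb s) (key N hcN s) (by positivity) (norm_nonneg _)

lemma integrable_halfKernel_mul (hb : 0 < b) (hN : 0 < N) {u : ℝ → ℂ} (hu : Measurable u)
    {M : ℝ} (hM : ∀ x, ‖u x‖ ≤ M) (x : ℝ) : Integrable fun s => halfKernel b N s * u (x - s) :=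
  (integrable_halfKernel hb hN).mul_bdd (c := M)
    (hu.comp (measurable_const.sub measurable_id)).aestronglyMeasurable
    (Eventually.of_forall fun _ => hM _)

lemma one_div_sub_two_pi_mul_I (x t : ℝ) :
    1 / ((b : ℂ) - 2 * Real.pi * (x - t : ℝ) * Complex.I) =
      (1 / (2 * Real.pi) : ℝ) *
        (Complex.I / ((x + (b / (2 * Real.pi) : ℝ) * Complex.I : ℂ) - t)) := by
  have hpi : (Real.pi : ℂ) ≠ 0 := by exact_mod_cast Real.pi_ne_zero
  have e : (b : ℂ) - 2 * Real.pi * (x - t : ℝ) * Complex.I =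
      -(2 * Real.pi * Complex.I) * ((x + (b / (2 * Real.pi) : ℝ) * Complex.I : ℂ) - t) := by
    push_cast
    field_simp
    ring_nf
    rw [Complex.I_sq]; ring
  rw [e]
  generalize (x + (b / (2 * Real.pi) : ℝ) * Complex.I : ℂ) - t = D
  push_cast
  rw [one_div, mul_inv, inv_neg, mul_inv, Complex.inv_I, div_eq_mul_inv]
  ring

lemma integral_halfKernel_mul_ofReal (hb : 0 < b) (hN : 0 < N) {g : ℝ → ℝ} (hg : Integrable g)
    (x : ℝ) : ∫ s, halfKernel b N s * (g (x - s) : ℂ) =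
      (1 / (2 * Real.pi) : ℝ) * (cauchyUp g (x + (b / (2 * Real.pi) : ℝ) * Complex.I) -
        cauchyUp g (x + (N / (2 * Real.pi) : ℝ) * Complex.I)) := by
  have him : ∀ y : ℝ, 0 < y → 0 < (x + (y / (2 * Real.pi) : ℝ) * Complex.I : ℂ).im := fun y hy => by
    have : 0 < y / (2 * Real.pi) := by positivity
    rw [Complex.add_im, Complex.ofReal_im, Complex.im_ofReal_mul, Complex.I_im, mul_one, zero_add]
    exact this
  unfold cauchyUp
  rw [← integral_sub (integrable_cauchyUp hg (him b hb)) (integrable_cauchyUp hg (him N hN)),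
    ← integral_const_mul, ← integral_sub_left_eq_self _ _ x]
  refine integral_congr_ae (Eventually.of_forall fun t => ?_)
  simp only [halfKernel]
  rw [one_div_sub_two_pi_mul_I, one_div_sub_two_pi_mul_I, sub_sub_cancel]
  ring

lemma exists_recipNorm_halfKernel_ofReal_le {θ : ℝ} (hθ : 1 / 2 ≤ θ) (hθ1 : θ < 1) :
    ∃ C : ℝ≥0∞, C ≠ ∞ ∧ ∀ g : ℝ → ℝ, Measurable g → Integrable g → (∀ t, 0 ≤ g t) →
      (∃ S : ℝ, ∀ t, S < |t| → g t = 0) → ∀ b N : ℝ, 0 < b → 0 < N →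
      recipNorm θ (fun x : ℝ => ‖∫ s, halfKernel b N s * (g (x - s) : ℂ)‖ₑ) ≤
        C * recipNorm θ (fun t => ‖g t‖ₑ) := by
  have hθ0 : 0 < θ := by linarith
  obtain ⟨C, hC, h⟩ := exists_recipNorm_cauchyUp_le hθ hθ1
  refine ⟨‖((1 / (2 * Real.pi) : ℝ) : ℂ)‖ₑ * (C + C), by finiteness, ?_⟩
  intro g hm hg hg0 hS b N hb hN
  have hmeas : ∀ y : ℝ, Measurable fun x : ℝ => cauchyUp g (x + y * Complex.I) := fun y => by
    unfold cauchyUp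
    have : Measurable (Function.uncurry fun (x t : ℝ) =>
        (g t : ℂ) * (Complex.I / ((x + y * Complex.I : ℂ) - t))) := by
      unfold Function.uncurry; fun_prop
    exact this.stronglyMeasurable.integral_prod_right.measurable
  have e : ∀ t, ‖g t‖ₑ = ENNReal.ofReal (g t) := fun t => Real.enorm_eq_ofReal (hg0 t)
  simp only [integral_halfKernel_mul_ofReal hb hN hg, enorm_mul, e]
  rw [recipNorm_const_mul hθ0 _ (by finiteness), mul_assoc, add_mul]
  refine mul_le_mul' le_rfl ((recipNorm_sub_le hθ0 hθ1.le (hmeas _) (hmeas _)).trans ?_)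
  exact add_le_add (h g hm hg hg0 hS _ (by positivity)) (h g hm hg hg0 hS _ (by positivity))

lemma exists_recipNorm_halfKernel_le_of_support {θ : ℝ} (hθ : 1 / 2 ≤ θ) (hθ1 : θ < 1) :
    ∃ C : ℝ≥0∞, C ≠ ∞ ∧ ∀ u : ℝ → ℂ, Measurable u → (∃ M : ℝ, ∀ x, ‖u x‖ ≤ M) →
      (∃ S : ℝ, ∀ t, S < |t| → u t = 0) → ∀ b N : ℝ, 0 < b → 0 < N →
      recipNorm θ (fun x : ℝ => ‖∫ s, halfKernel b N s * u (x - s)‖ₑ) ≤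
        C * recipNorm θ (fun t => ‖u t‖ₑ) := by
  have hθ0 : 0 < θ := by linarith
  obtain ⟨C, hC, h⟩ := exists_recipNorm_halfKernel_ofReal_le hθ hθ1
  refine ⟨C + C + (C + C), by finiteness, ?_⟩
  rintro u hu ⟨M, hM⟩ ⟨S, hS⟩ b N hb hN
  have part : ∀ G : ℂ → ℝ, Continuous G → (∀ z, 0 ≤ G z) → (∀ z, G z ≤ ‖z‖) →
      Measurable (fun t => ((G (u t) : ℝ) : ℂ)) ∧ (∀ t, ‖((G (u t) : ℝ) : ℂ)‖ ≤ M) ∧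
      recipNorm θ (fun x : ℝ => ‖∫ s, halfKernel b N s * (G (u (x - s)) : ℂ)‖ₑ) ≤
        C * recipNorm θ (fun t => ‖u t‖ₑ) := by
    intro G hG hG0 hG1
    have hGm : Measurable fun t => G (u t) := hG.measurable.comp hu
    have hGM : ∀ t, ‖G (u t)‖ ≤ M := fun t => by
      rw [Real.norm_of_nonneg (hG0 _)]; exact (hG1 _).trans (hM t)
    refine ⟨Complex.measurable_ofReal.comp hGm, fun t => by rw [Complex.norm_real]; exact hGM t, ?_⟩
    have hz : ∀ t, S < |t| → G (u t) = 0 := fun t ht =>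
      le_antisymm ((hG1 _).trans (by rw [hS t ht, norm_zero])) (hG0 _)
    have hi : Integrable fun t => G (u t) := by
      have : IntegrableOn (fun t => G (u t)) (Icc (-S) S) :=
        Measure.integrableOn_of_bounded (by simp) hGm.aestronglyMeasurable
          (Eventually.of_forall hGM)
      refine (integrableOn_iff_integrable_of_support_subset fun t ht => ?_).1 this
      by_contra hc
      exact ht (hz t (by rw [mem_Icc, ← abs_le] at hc; exact not_le.1 hc))
    refine (h _ hGm hi (fun t => hG0 _) ⟨S, hz⟩ b N hb hN).trans (mul_le_mul' le_rfl ?_)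
    refine recipNorm_mono hθ0 fun t => ?_
    rw [enorm_le_iff_norm_le, Real.norm_of_nonneg (hG0 _)]
    exact hG1 _
  obtain ⟨m1, b1, r1⟩ := part (fun z => max z.re 0) (by fun_prop) (fun z => le_max_right _ _)
    fun z => max_le (Complex.re_le_norm z) (norm_nonneg z)
  obtain ⟨m2, b2, r2⟩ := part (fun z => max (-z.re) 0) (by fun_prop) (fun z => le_max_right _ _)
    fun z => max_le ((neg_le_abs _).trans (Complex.abs_re_le_norm z)) (norm_nonneg z)
  obtain ⟨m3, b3, r3⟩ := part (fun z => max z.im 0) (by fun_prop) (fun z => le_max_right _ _)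
    fun z => max_le (Complex.im_le_norm z) (norm_nonneg z)
  obtain ⟨m4, b4, r4⟩ := part (fun z => max (-z.im) 0) (by fun_prop) (fun z => le_max_right _ _)
    fun z => max_le ((neg_le_abs _).trans (Complex.abs_im_le_norm z)) (norm_nonneg z)
  have hmax : ∀ r : ℝ, ((max r 0 : ℝ) : ℂ) - (max (-r) 0 : ℝ) = r := fun r => by
    rw [← Complex.ofReal_sub]
    congr 1
    rcases le_total 0 r with hr | hr
    · simp [hr]
    · simp [hr]
  have split : ∀ x, ∫ s, halfKernel b N s * u (x - s) =
      ((∫ s, halfKernel b N s * (max (u (x - s)).re 0 : ℝ)) -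
        ∫ s, halfKernel b N s * (max (-(u (x - s)).re) 0 : ℝ)) -
      (-Complex.I) * ((∫ s, halfKernel b N s * (max (u (x - s)).im 0 : ℝ)) -
        ∫ s, halfKernel b N s * (max (-(u (x - s)).im) 0 : ℝ)) := fun x => by
    have i1 := integrable_halfKernel_mul hb hN m1 b1 x
    have i2 := integrable_halfKernel_mul hb hN m2 b2 x
    have i3 := integrable_halfKernel_mul hb hN m3 b3 x
    have i4 := integrable_halfKernel_mul hb hN m4 b4 x
    have i12 := integral_sub i1 i2
    have i34 := integral_sub i3 i4
    have i := integral_sub (i1.sub i2) ((i3.sub i4).const_mul (-Complex.I))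
    simp only [Pi.sub_apply] at i
    rw [integral_const_mul, i12, i34] at i
    rw [← i]
    refine integral_congr_ae (Eventually.of_forall fun s => ?_)
    simp only []
    rw [← mul_sub, ← mul_sub, hmax, hmax]
    nth_rewrite 1 [← Complex.re_add_im (u (x - s))]
    ring
  have mK := (continuous_halfKernel hb hN).measurable
  have n1 := measurable_integral_mul_sub mK m1
  have n2 := measurable_integral_mul_sub mK m2
  have n3 := measurable_integral_mul_sub mK m3
  have n4 := measurable_integral_mul_sub mK m4
  simp only [split]
  rw [add_mul, add_mul]
  refine (recipNorm_sub_le hθ0 hθ1.le (n1.sub n2) ((n3.sub n4).const_mul _)).trans ?_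
  refine add_le_add ((recipNorm_sub_le hθ0 hθ1.le n1 n2).trans (add_le_add r1 r2)) ?_
  have eI : ‖-Complex.I‖ₑ = 1 := by rw [enorm_neg, ← ofReal_norm, Complex.norm_I]; simp
  simp only [enorm_mul, eI, one_mul]
  exact (recipNorm_sub_le hθ0 hθ1.le n3 n4).trans (add_le_add r3 r4)

lemma tendsto_indicator_Icc (u : ℝ → ℂ) (x : ℝ) :
    Tendsto (fun n : ℕ => (Icc (-(n : ℝ)) n).indicator u x) atTop (𝓝 (u x)) := by
  refine tendsto_const_nhds.congr' ?_
  filter_upwards [eventually_ge_atTop ⌈|x|⌉₊] with n hn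
  rw [indicator_of_mem]
  exact abs_le.1 (Nat.ceil_le.1 hn)

lemma exists_recipNorm_halfKernel_le_of_half_le {θ : ℝ} (hθ : 1 / 2 ≤ θ) (hθ1 : θ < 1) :
    ∃ C : ℝ≥0∞, C ≠ ∞ ∧ ∀ u : ℝ → ℂ, Measurable u → (∃ M : ℝ, ∀ x, ‖u x‖ ≤ M) →
      ∀ b N : ℝ, 0 < b → 0 < N →
      recipNorm θ (fun x : ℝ => ‖∫ s, halfKernel b N s * u (x - s)‖ₑ) ≤
        C * recipNorm θ (fun t => ‖u t‖ₑ) := by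
  have hθ0 : 0 < θ := by linarith
  obtain ⟨C, hC, h⟩ := exists_recipNorm_halfKernel_le_of_support hθ hθ1
  refine ⟨C, hC, ?_⟩
  rintro u hu ⟨M, hM⟩ b N hb hN
  have mK := (continuous_halfKernel hb hN).measurable
  have hv : ∀ n : ℕ, Measurable ((Icc (-(n : ℝ)) n).indicator u) := fun n =>
    hu.indicator measurableSet_Icc
  have hle : ∀ (n : ℕ) x, ‖(Icc (-(n : ℝ)) n).indicator u x‖ ≤ ‖u x‖ := fun n x =>
    norm_indicator_le_norm_self _ _
  refine recipNorm_le_of_tendsto hθ0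
    (f := fun (n : ℕ) x => ∫ s, halfKernel b N s * (Icc (-(n : ℝ)) n).indicator u (x - s))
    (fun n => measurable_integral_mul_sub mK (hv n)) (fun x => ?_) fun n => ?_
  · refine tendsto_integral_of_dominated_convergence (fun s => ‖halfKernel b N s‖ * M)
      (fun n => (mK.mul ((hv n).comp (measurable_const.sub measurable_id))).aestronglyMeasurable)
      ((integrable_halfKernel hb hN).norm.mul_const M)
      (fun n => Eventually.of_forall fun s => ?_)
      (Eventually.of_forall fun s => (tendsto_indicator_Icc u (x - s)).const_mul _)
    rw [norm_mul]
    exact mul_le_mul_of_nonneg_left ((hle n _).trans (hM _)) (norm_nonneg _)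
  · refine (h _ (hv n) ⟨M, fun x => (hle n x).trans (hM x)⟩ ⟨n, fun t ht => ?_⟩ b N hb hN).trans
      (mul_le_mul' le_rfl (recipNorm_mono hθ0 fun x => ?_))
    · refine indicator_of_notMem (fun hm => ?_) _
      exact absurd (abs_le.2 hm) (not_le.2 ht)
    · rw [enorm_le_iff_norm_le]; exact hle n x

lemma integral_conv_mul_comm {K u h : ℝ → ℂ} (hK : Integrable K)
    (hu : Measurable u) {M : ℝ} (hM : ∀ x, ‖u x‖ ≤ M) (hh : Integrable h) :
    ∫ x, (∫ s, K s * u (x - s)) * h x = ∫ x, u x * ∫ s, K (-s) * h (x - s) := by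
  have i1 : Integrable (Function.uncurry fun x s : ℝ => K s * u (x - s) * h x) := by
    have := (hh.mul_prod hK).bdd_mul (c := M)
      (f := fun p : ℝ × ℝ => u (p.1 - p.2))
      (hu.comp (measurable_fst.sub measurable_snd)).aestronglyMeasurable
      (Eventually.of_forall fun _ => hM _)
    refine this.congr (Eventually.of_forall fun p => ?_)
    simp only [Function.uncurry]; ring
  have i2 : Integrable (Function.uncurry fun x s : ℝ => u x * (K (-s) * h (x - s))) := by
    have := (hK.comp_neg.convolution_integrand (ContinuousLinearMap.mul ℂ ℂ) hh).bdd_mul (c := M)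
      (f := fun p : ℝ × ℝ => u p.1)
      (hu.comp measurable_fst).aestronglyMeasurable
      (Eventually.of_forall fun _ => hM _)
    exact this
  calc ∫ x, (∫ s, K s * u (x - s)) * h x = ∫ x, ∫ s, K s * u (x - s) * h x := by
        simp only [integral_mul_const]
    _ = ∫ s, ∫ x, K s * u (x - s) * h x := integral_integral_swap i1
    _ = ∫ s, ∫ x, K s * u x * h (x + s) := by
        refine integral_congr_ae (Eventually.of_forall fun s => ?_)
        have := integral_sub_right_eq_self (μ := volume) (fun x => K s * u x * h (x + s)) s
        simpa only [sub_add_cancel] using this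
    _ = ∫ s, ∫ x, u x * (K (-s) * h (x - s)) := by
        rw [← integral_neg_eq_self]
        refine integral_congr_ae (Eventually.of_forall fun s => ?_)
        refine integral_congr_ae (Eventually.of_forall fun x => ?_)
        simp only [sub_eq_add_neg]; ring
    _ = ∫ x, ∫ s, u x * (K (-s) * h (x - s)) := (integral_integral_swap i2).symm
    _ = _ := by simp only [integral_const_mul]

lemma exists_recipNorm_halfKernel_le_of_le_half {θ : ℝ} (hθ0 : 0 < θ) (hθ : θ ≤ 1 / 2) :
    ∃ C : ℝ≥0∞, C ≠ ∞ ∧ ∀ u : ℝ → ℂ, Measurable u → (∃ M : ℝ, ∀ x, ‖u x‖ ≤ M) →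
      ∀ b N : ℝ, 0 < b → 0 < N →
      recipNorm θ (fun x : ℝ => ‖∫ s, halfKernel b N s * u (x - s)‖ₑ) ≤
        C * recipNorm θ (fun t => ‖u t‖ₑ) := by
  have hθ1 : 0 < 1 - θ := by linarith
  obtain ⟨C, hC, H⟩ := exists_recipNorm_halfKernel_le_of_half_le (θ := 1 - θ) (by linarith)
    (by linarith)
  refine ⟨C, hC, ?_⟩
  rintro u hu ⟨M, hM⟩ b N hb hN
  have mK := (continuous_halfKernel hb hN).measurable
  have iK := integrable_halfKernel hb hN
  set w : ℝ → ℂ := fun x => ∫ s, halfKernel b N s * u (x - s) with hw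
  have mw : Measurable w := measurable_integral_mul_sub mK hu
  set W := (∫ s, ‖halfKernel b N s‖) * M with hW
  have bw : ∀ x, ‖w x‖ ≤ W := fun x => by
    rw [hW, ← integral_mul_const]
    refine norm_integral_le_of_norm_le (iK.norm.mul_const M) (Eventually.of_forall fun s => ?_)
    rw [norm_mul]
    exact mul_le_mul_of_nonneg_left (hM _) (norm_nonneg _)
  set p := 1 / θ with hp
  have hp2 : 2 ≤ p := by rw [hp, le_div_iff₀ hθ0]; linarith
  refine recipNorm_le_of_tendsto hθ0 (f := fun (n : ℕ) => (Icc (-(n : ℝ)) n).indicator w)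
    (fun n => mw.indicator measurableSet_Icc) (tendsto_indicator_Icc w) fun n => ?_
  set S := Icc (-(n : ℝ)) n with hS
  have mS : MeasurableSet S := measurableSet_Icc
  set J := ∫⁻ x in S, ‖w x‖ₑ ^ p with hJ
  have eJ : recipNorm θ (fun x => ‖S.indicator w x‖ₑ) = J ^ θ := by
    rw [recipNorm, hJ, ← lintegral_indicator mS]
    congr 1
    refine lintegral_congr fun x => ?_
    by_cases hx : x ∈ S
    · simp [hx, hp]
    · simp [hx, hθ0]
  set h : ℝ → ℂ := S.indicator fun x => starRingEnd ℂ (w x) * (‖w x‖ ^ (p - 2) : ℝ) with hh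
  have nh : ∀ x, ‖h x‖ = S.indicator (fun x => ‖w x‖ ^ (p - 1)) x := fun x => by
    by_cases hx : x ∈ S
    · rw [hh, indicator_of_mem hx, indicator_of_mem hx, norm_mul, RCLike.norm_conj,
        Complex.norm_real, Real.norm_of_nonneg (by positivity)]
      rcases (norm_nonneg (w x)).eq_or_lt with h0 | h0
      · rw [← h0, zero_mul, Real.zero_rpow (by linarith)]
      · rw [← Real.rpow_one_add' h0.le (by linarith)]
        congr 1; ring
    · simp [hh, hx]
  have wh : ∀ x, w x * h x = (S.indicator (fun x => ‖w x‖ ^ p) x : ℝ) := fun x => by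
    by_cases hx : x ∈ S
    · rw [hh, indicator_of_mem hx, indicator_of_mem hx, ← mul_assoc, Complex.mul_conj,
        Complex.normSq_eq_norm_sq, ← Complex.ofReal_mul]
      congr 1
      rcases (norm_nonneg (w x)).eq_or_lt with h0 | h0
      · rw [← h0, Real.zero_rpow (x := p) (by linarith)]; simp
      · rw [← Real.rpow_natCast, ← Real.rpow_add h0]
        congr 1; push_cast; ring
    · simp [hh, hx]
  have mh : Measurable h := by
    refine Measurable.indicator ?_ mS
    exact (Complex.continuous_conj.measurable.comp mw).mul
      (Complex.measurable_ofReal.comp (mw.norm.pow_const _))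
  have bh : ∀ x, ‖h x‖ ≤ W ^ (p - 1) := fun x => by
    have hW0 : 0 ≤ W := (norm_nonneg _).trans (bw 0)
    rw [nh]
    refine (indicator_le_self' (fun _ _ => by positivity) x).trans ?_
    exact Real.rpow_le_rpow (norm_nonneg _) (bw x) (by linarith)
  have ih : Integrable h := by
    have h1 : IntegrableOn h S :=
      Measure.integrableOn_of_bounded (by simp [hS]) mh.aestronglyMeasurable
        (Eventually.of_forall bh)
    exact (integrableOn_iff_integrable_of_support_subset support_indicator_subset).1 h1
  have ehn : recipNorm (1 - θ) (fun x => ‖h x‖ₑ) = J ^ (1 - θ) := by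
    rw [recipNorm, hJ, ← lintegral_indicator mS]
    congr 1
    refine lintegral_congr fun x => ?_
    rw [← ofReal_norm, nh]
    by_cases hx : x ∈ S
    · rw [indicator_of_mem hx, indicator_of_mem hx, ← ofReal_norm,
        ENNReal.ofReal_rpow_of_nonneg (by positivity) (by positivity),
        ENNReal.ofReal_rpow_of_nonneg (by positivity) (by positivity),
        ← Real.rpow_mul (norm_nonneg _)]
      congr 2
      rw [hp]; field_simp
    · simp [hx, hθ1]
  have eI : J = ‖∫ x, w x * h x‖ₑ := by
    have hp0 : 0 ≤ p := by linarith
    have hnn : ∀ x, 0 ≤ S.indicator (fun x => ‖w x‖ ^ p) x := fun x =>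
      indicator_nonneg (fun _ _ => by positivity) x
    have hInt : Integrable (S.indicator fun x => ‖w x‖ ^ p) := by
      have := (ih.bdd_mul (c := W) mw.aestronglyMeasurable (Eventually.of_forall bw)).re
      refine this.congr (Eventually.of_forall fun x => ?_)
      simp only [wh, RCLike.re_to_complex, Complex.ofReal_re]
    simp only [wh]
    rw [integral_complex_ofReal, ← ofReal_norm, Complex.norm_real,
      Real.norm_of_nonneg (integral_nonneg hnn), ofReal_integral_eq_lintegral_ofReal hInt
        (Eventually.of_forall hnn), hJ, ← lintegral_indicator mS]
    refine lintegral_congr fun x => ?_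
    by_cases hx : x ∈ S
    · rw [indicator_of_mem hx, indicator_of_mem hx, ← ofReal_norm,
        ENNReal.ofReal_rpow_of_nonneg (norm_nonneg _) hp0]
    · simp [hx]
  have hJtop : J ≠ ∞ := by rw [eI]; finiteness
  have hdual : J ≤ recipNorm θ (fun t => ‖u t‖ₑ) * (C * J ^ (1 - θ)) := by
    have mhc : Measurable fun x => starRingEnd ℂ (h x) := Complex.continuous_conj.measurable.comp mh
    have econj : ∀ x, ‖∫ s, halfKernel b N (-s) * h (x - s)‖ₑ =
        ‖∫ s, halfKernel b N s * starRingEnd ℂ (h (x - s))‖ₑ := fun x => by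
      have : ∫ s, halfKernel b N (-s) * h (x - s) =
          starRingEnd ℂ (∫ s, halfKernel b N s * starRingEnd ℂ (h (x - s))) := by
        rw [← integral_conj]
        refine integral_congr_ae (Eventually.of_forall fun s => ?_)
        simp [halfKernel_neg]
      rw [this, ← ofReal_norm, RCLike.norm_conj, ofReal_norm]
    have hT := H _ mhc ⟨W ^ (p - 1), fun x => by rw [RCLike.norm_conj]; exact bh x⟩ b N hb hN
    have ehc : ∀ x, ‖starRingEnd ℂ (h x)‖ₑ = ‖h x‖ₑ := fun x => by
      rw [← ofReal_norm, RCLike.norm_conj, ofReal_norm]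
    simp only [← econj, ehc] at hT
    rw [ehn] at hT
    have mT : Measurable fun x => ∫ s, halfKernel b N (-s) * h (x - s) :=
      measurable_integral_mul_sub (mK.comp measurable_neg) mh
    have hmul := recipNorm_mul_le hθ0 hθ1 hu.enorm.aemeasurable mT.enorm.aemeasurable
    refine le_trans ?_ (hmul.trans (mul_le_mul' le_rfl hT))
    rw [eI, hw, integral_conv_mul_comm iK hu hM ih]
    simp only [recipNorm, add_sub_cancel, div_one, ENNReal.rpow_one, ← enorm_mul]
    exact enorm_integral_le_lintegral_enorm _
  rw [eJ]
  rcases eq_or_ne J 0 with h0 | h0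
  · rw [h0, ENNReal.zero_rpow_of_pos hθ0]; exact zero_le
  have h1 : J ^ (1 - θ) ≠ 0 := (ENNReal.rpow_pos (pos_iff_ne_zero.2 h0) hJtop).ne'
  have h2 : J ^ (1 - θ) ≠ ∞ := by finiteness
  refine (ENNReal.mul_le_mul_iff_left h1 h2).1 ?_
  rw [← ENNReal.rpow_add _ _ h0 hJtop, add_sub_cancel, ENNReal.rpow_one]
  refine hdual.trans (le_of_eq ?_)
  ring

lemma exists_recipNorm_halfKernel_le {θ : ℝ} (hθ0 : 0 < θ) (hθ1 : θ < 1) :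
    ∃ C : ℝ≥0∞, C ≠ ∞ ∧ ∀ u : ℝ → ℂ, Measurable u → (∃ M : ℝ, ∀ x, ‖u x‖ ≤ M) →
      ∀ b N : ℝ, 0 < b → 0 < N →
      recipNorm θ (fun x : ℝ => ‖∫ s, halfKernel b N s * u (x - s)‖ₑ) ≤
        C * recipNorm θ (fun t => ‖u t‖ₑ) := by
  rcases le_total θ (1 / 2) with h | h
  · exact exists_recipNorm_halfKernel_le_of_le_half hθ0 h
  · exact exists_recipNorm_halfKernel_le_of_half_le h hθ1

end Kernel

lemma fourierInv_exp_Ioi {b : ℝ} (hb : 0 < b) (s : ℝ) :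
    IntegrableOn (fun τ : ℝ => Complex.exp ((-(b : ℂ) + 2 * Real.pi * s * Complex.I) * τ)) (Ioi 0) ∧
    ∫ τ in Ioi (0 : ℝ), Complex.exp ((-(b : ℂ) + 2 * Real.pi * s * Complex.I) * τ) =
      1 / ((b : ℂ) - 2 * Real.pi * s * Complex.I) := by
  have hre : (-(b : ℂ) + 2 * Real.pi * s * Complex.I).re < 0 := by simpa using hb
  refine ⟨integrableOn_exp_mul_complex_Ioi hre 0, ?_⟩
  rw [integral_exp_mul_complex_Ioi hre]
  simp only [Complex.ofReal_zero, mul_zero, Complex.exp_zero]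
  rw [neg_div, ← div_neg]
  congr 1; ring

/-- The Fourier transform of `halfKernel b N`. -/
noncomputable def halfSymbol (b N τ : ℝ) : ℂ :=
  if 0 < τ then ((Real.exp (-(b * τ)) - Real.exp (-(N * τ)) : ℝ) : ℂ) else 0

lemma continuous_halfSymbol (b N : ℝ) : Continuous (halfSymbol b N) := by
  have e : halfSymbol b N = fun τ =>
      ((Real.exp (-(b * max τ 0)) - Real.exp (-(N * max τ 0)) : ℝ) : ℂ) := by
    ext τ
    unfold halfSymbol
    split_ifs with h
    · rw [max_eq_left h.le]
    · rw [max_eq_right (not_lt.1 h)]; simp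
  rw [e]; fun_prop

lemma fourierInv_halfSymbol {b N : ℝ} (hb : 0 < b) (hN : 0 < N) :
    𝓕⁻ (halfSymbol b N) = halfKernel b N := by
  ext s
  rw [Real.fourierInv_eq']
  obtain ⟨i1, e1⟩ := fourierInv_exp_Ioi hb s
  obtain ⟨i2, e2⟩ := fourierInv_exp_Ioi hN s
  rw [halfKernel, ← e1, ← e2, ← integral_sub i1 i2, ← integral_indicator measurableSet_Ioi]
  refine integral_congr_ae (Eventually.of_forall fun τ => ?_)
  by_cases hτ : 0 < τ
  · simp only [halfSymbol, hτ, if_true, indicator_of_mem (show τ ∈ Ioi 0 from hτ), smul_eq_mul]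
    push_cast
    rw [mul_sub, ← Complex.exp_add, ← Complex.exp_add]
    simp
    congr 2 <;> ring
  · simp [halfSymbol, hτ]

lemma integrable_halfSymbol {b N : ℝ} (hb : 0 < b) (hN : 0 < N) : Integrable (halfSymbol b N) := by
  obtain ⟨i1, -⟩ := fourierInv_exp_Ioi hb 0
  obtain ⟨i2, -⟩ := fourierInv_exp_Ioi hN 0
  have := (integrable_indicator_iff measurableSet_Ioi).2 (i1.sub i2)
  refine this.congr (Eventually.of_forall fun τ => ?_)
  by_cases hτ : 0 < τ
  · simp [halfSymbol, hτ]
  · simp [halfSymbol, hτ]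

lemma integral_halfKernel_mul_exp {b N : ℝ} (hb : 0 < b) (hN : 0 < N) (τ : ℝ) :
    ∫ s, halfKernel b N s * Complex.exp ((-(2 * Real.pi * (s * τ)) : ℝ) * Complex.I) =
      halfSymbol b N τ := by
  have h := (continuous_halfSymbol b N).fourierInv_fourier_eq (integrable_halfSymbol hb hN) (by
    have := (integrable_halfKernel hb hN).comp_neg
    refine this.congr (Eventually.of_forall fun s => ?_)
    simp only [← fourierInv_halfSymbol hb hN, Real.fourierInv_eq_fourier_neg, neg_neg])
  rw [← Real.fourierInv_comm, fourierInv_halfSymbol hb hN] at h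
  rw [← congrFun h τ, Real.fourier_eq']
  refine integral_congr_ae (Eventually.of_forall fun s => ?_)
  simp only [smul_eq_mul]
  rw [mul_comm]
  congr 3
  simp
  ring

/-! ### Half-space symbols in Euclidean space -/

section Euclidean

variable {d : ℕ}

lemma toLp_update_sub_single (x : Fin d → ℝ) (i : Fin d) (t s : ℝ) :
    (WithLp.toLp 2 (Function.update x i t) : EuclideanSpace ℝ (Fin d)) -
      EuclideanSpace.single i s = WithLp.toLp 2 (Function.update x i (t - s)) := by
  ext j
  by_cases h : j = i
  · subst h; simp
  · simp [h]

lemma wave_sub_single (x ξ : EuclideanSpace ℝ (Fin d)) (i : Fin d) (s : ℝ) :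
    wave (x - EuclideanSpace.single i s) ξ =
      wave x ξ * Complex.exp ((-(2 * Real.pi * (s * ξ i)) : ℝ) * Complex.I) := by
  rw [wave, wave, ← Complex.exp_add, inner_sub_left, EuclideanSpace.inner_single_left]
  congr 1
  simp
  ring

lemma recipNorm_le_of_line {θ : ℝ} (hθ : 0 < θ) {C : ℝ≥0∞} (i : Fin d)
    {F G : EuclideanSpace ℝ (Fin d) → ℝ≥0∞} (hF : Measurable F) (hG : Measurable G)
    (h : ∀ x : Fin d → ℝ, recipNorm θ (fun t : ℝ => F (WithLp.toLp 2 (Function.update x i t))) ≤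
      C * recipNorm θ (fun t : ℝ => G (WithLp.toLp 2 (Function.update x i t)))) :
    recipNorm θ F ≤ C * recipNorm θ G := by
  have hv := PiLp.volume_preserving_toLp (Fin d)
  have key : ∫⁻ x : Fin d → ℝ, F (WithLp.toLp 2 x) ^ (1 / θ) ≤
      ∫⁻ x : Fin d → ℝ, C ^ (1 / θ) * G (WithLp.toLp 2 x) ^ (1 / θ) := by
    refine lintegral_le_of_lmarginal_le (μ := fun _ => (volume : Measure ℝ)) {i}
      ((hF.comp hv.measurable).pow_const _) (((hG.comp hv.measurable).pow_const _).const_mul _) ?_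
    rw [lmarginal_singleton, lmarginal_singleton]
    intro x
    have := ENNReal.rpow_le_rpow (h x) (z := 1 / θ) (by positivity)
    simp only [recipNorm] at this
    rw [ENNReal.mul_rpow_of_nonneg _ _ (by positivity), ← ENNReal.rpow_mul, ← ENNReal.rpow_mul,
      mul_one_div_cancel hθ.ne', ENNReal.rpow_one, ENNReal.rpow_one] at this
    refine this.trans (le_of_eq (lintegral_const_mul _ ?_).symm)
    exact (hG.comp (hv.measurable.comp (measurable_update x))).pow_const _
  have hGm : Measurable fun x : Fin d → ℝ => G (WithLp.toLp 2 x) ^ (1 / θ) :=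
    (hG.comp hv.measurable).pow_const _
  rw [lintegral_const_mul _ hGm,
    hv.lintegral_comp (hF.pow_const _), hv.lintegral_comp (hG.pow_const _)] at key
  have := ENNReal.rpow_le_rpow key hθ.le
  rwa [ENNReal.mul_rpow_of_nonneg _ _ hθ.le, ← ENNReal.rpow_mul, one_div_mul_cancel hθ.ne',
    ENNReal.rpow_one] at this

lemma synth_halfSymbol_mul {b N : ℝ} (hb : 0 < b) (hN : 0 < N) (i : Fin d)
    {φ : EuclideanSpace ℝ (Fin d) → ℂ} (hφ : Nice φ) (x : EuclideanSpace ℝ (Fin d)) :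
    synth (fun ξ => halfSymbol b N (ξ i) * φ ξ) x =
      ∫ s, halfKernel b N s * synth φ (x - EuclideanSpace.single i s) := by
  have mK := continuous_halfKernel hb hN
  have h := synth_integral_mul (μ := volume) (m := fun (s : ℝ) (ξ : EuclideanSpace ℝ (Fin d)) =>
    halfKernel b N s * Complex.exp ((-(2 * Real.pi * (s * ξ i)) : ℝ) * Complex.I))
    (by unfold Function.uncurry; exact (Continuous.measurable (by fun_prop))) hφ.1 (by
      have e : ∀ r : ℝ, ‖Complex.exp (r * Complex.I)‖ₑ = 1 := fun r => by
        rw [← ofReal_norm, Complex.norm_exp_ofReal_mul_I, ENNReal.ofReal_one]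
      simp only [enorm_mul, e, mul_one]
      have h1 := (integrable_halfKernel hb hN).2
      have h2 := hφ.1.2
      simp only [HasFiniteIntegral] at h1 h2
      rw [lintegral_const_mul' _ _ h1.ne]
      exact (ENNReal.mul_lt_top h1 h2).ne) x
  simp only [integral_halfKernel_mul_exp hb hN] at h
  rw [h]
  refine integral_congr_ae (Eventually.of_forall fun s => ?_)
  simp only [synth]
  rw [← integral_const_mul]
  refine integral_congr_ae (Eventually.of_forall fun ξ => ?_)
  simp only [wave_sub_single]
  ring

lemma exists_recipNorm_synth_halfSymbol_le {θ : ℝ} (hθ0 : 0 < θ) (hθ1 : θ < 1) :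
    ∃ C : ℝ≥0∞, C ≠ ∞ ∧ ∀ (d : ℕ) (i : Fin d) (b N : ℝ), 0 < b → 0 < N →
      ∀ φ : EuclideanSpace ℝ (Fin d) → ℂ, Nice φ →
      recipNorm θ (fun x => ‖synth (fun ξ => halfSymbol b N (ξ i) * φ ξ) x‖ₑ) ≤
        C * recipNorm θ (fun x => ‖synth φ x‖ₑ) := by
  obtain ⟨C, hC, H⟩ := exists_recipNorm_halfKernel_le hθ0 hθ1
  refine ⟨C, hC, fun d i b N hb hN φ hφ => ?_⟩
  have hm : LocBdd fun ξ : EuclideanSpace ℝ (Fin d) => halfSymbol b N (ξ i) :=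
    ((continuous_halfSymbol b N).comp (by fun_prop)).locBdd
  refine recipNorm_le_of_line hθ0 i (continuous_synth (hφ.mul hm).1).enorm.measurable
    (continuous_synth hφ.1).enorm.measurable fun x => ?_
  have hup : Continuous fun t : ℝ =>
      (WithLp.toLp 2 (Function.update x i t) : EuclideanSpace ℝ (Fin d)) := by fun_prop
  have := H (fun t => synth φ (WithLp.toLp 2 (Function.update x i t)))
    ((continuous_synth hφ.1).comp hup).measurable ⟨_, fun t => norm_synth_le _ _⟩ b N hb hN
  simpa only [synth_halfSymbol_mul hb hN i hφ, toLp_update_sub_single] using this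

end Euclidean

/-! ### Fourier multipliers -/

section Multiplier

variable {V : Type*} [NormedAddCommGroup V] [InnerProductSpace ℝ V] [FiniteDimensional ℝ V]
  [MeasurableSpace V] [BorelSpace V]

lemma LocBdd.mul {m n : V → ℂ} (hm : LocBdd m) (hn : LocBdd n) : LocBdd fun ξ => m ξ * n ξ := by
  refine ⟨hm.1.mul hn.1, fun R => ?_⟩
  obtain ⟨A, hA⟩ := hm.2 R
  obtain ⟨B, hB⟩ := hn.2 R
  refine ⟨A * B, fun ξ hξ => ?_⟩
  rw [norm_mul]
  exact mul_le_mul (hA ξ hξ) (hB ξ hξ) (norm_nonneg _) ((norm_nonneg _).trans (hA ξ hξ))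

lemma LocBdd.add {m n : V → ℂ} (hm : LocBdd m) (hn : LocBdd n) : LocBdd fun ξ => m ξ + n ξ := by
  refine ⟨hm.1.add hn.1, fun R => ?_⟩
  obtain ⟨A, hA⟩ := hm.2 R
  obtain ⟨B, hB⟩ := hn.2 R
  exact ⟨A + B, fun ξ hξ => (norm_add_le _ _).trans (add_le_add (hA ξ hξ) (hB ξ hξ))⟩

lemma LocBdd.sub {m n : V → ℂ} (hm : LocBdd m) (hn : LocBdd n) : LocBdd fun ξ => m ξ - n ξ := by
  refine ⟨hm.1.sub hn.1, fun R => ?_⟩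
  obtain ⟨A, hA⟩ := hm.2 R
  obtain ⟨B, hB⟩ := hn.2 R
  exact ⟨A + B, fun ξ hξ => (norm_sub_le _ _).trans (add_le_add (hA ξ hξ) (hB ξ hξ))⟩

/-- `m` is an `L^{1/θ}` Fourier multiplier of norm at most `C`, tested on nice functions. -/
def IsMultiplier (θ : ℝ) (C : ℝ≥0∞) (m : V → ℂ) : Prop :=
  LocBdd m ∧ ∀ φ : V → ℂ, Nice φ →
    recipNorm θ (fun x => ‖synth (fun ξ => m ξ * φ ξ) x‖ₑ) ≤ C * recipNorm θ (fun x => ‖synth φ x‖ₑ)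

namespace IsMultiplier

variable {θ : ℝ} {C D : ℝ≥0∞} {m n : V → ℂ}

lemma mono (hm : IsMultiplier θ C m) (h : C ≤ D) : IsMultiplier θ D m :=
  ⟨hm.1, fun φ hφ => (hm.2 φ hφ).trans (mul_le_mul' h le_rfl)⟩

lemma one : IsMultiplier θ 1 (fun _ : V => (1 : ℂ)) :=
  ⟨continuous_const.locBdd, fun φ _ => by simp⟩

lemma mul (hm : IsMultiplier θ C m) (hn : IsMultiplier θ D n) :
    IsMultiplier θ (C * D) fun ξ => m ξ * n ξ := by
  refine ⟨hm.1.mul hn.1, fun φ hφ => ?_⟩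
  simp only [mul_assoc]
  exact (hm.2 _ (hφ.mul hn.1)).trans (mul_le_mul' le_rfl (hn.2 φ hφ))

lemma add (hθ : 0 < θ) (hθ1 : θ ≤ 1) (hm : IsMultiplier θ C m) (hn : IsMultiplier θ D n) :
    IsMultiplier θ (C + D) fun ξ => m ξ + n ξ := by
  refine ⟨hm.1.add hn.1, fun φ hφ => ?_⟩
  simp only [add_mul, synth_add (hφ.mul hm.1).1 (hφ.mul hn.1).1]
  refine (recipNorm_mono hθ fun x => enorm_add_le _ _).trans ?_
  refine (recipNorm_add_le hθ hθ1
    (continuous_synth (hφ.mul hm.1).1).enorm.measurable.aemeasurable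
    (continuous_synth (hφ.mul hn.1).1).enorm.measurable.aemeasurable).trans ?_
  exact add_le_add (hm.2 φ hφ) (hn.2 φ hφ)

lemma sub (hθ : 0 < θ) (hθ1 : θ ≤ 1) (hm : IsMultiplier θ C m) (hn : IsMultiplier θ D n) :
    IsMultiplier θ (C + D) fun ξ => m ξ - n ξ := by
  refine ⟨hm.1.sub hn.1, fun φ hφ => ?_⟩
  simp only [sub_mul, synth_sub (hφ.mul hm.1).1 (hφ.mul hn.1).1, add_mul]
  exact (recipNorm_sub_le hθ hθ1 (continuous_synth (hφ.mul hm.1).1).measurable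
    (continuous_synth (hφ.mul hn.1).1).measurable).trans (add_le_add (hm.2 φ hφ) (hn.2 φ hφ))

lemma prod {ι : Type*} (s : Finset ι) {m : ι → V → ℂ} (hm : ∀ i ∈ s, IsMultiplier θ C (m i)) :
    IsMultiplier θ (C ^ s.card) fun ξ => ∏ i ∈ s, m i ξ := by
  classical
  induction s using Finset.induction_on with
  | empty => simpa using one
  | insert i s his ih =>
    simp only [Finset.prod_insert his, Finset.card_insert_of_notMem his, pow_succ']
    exact (hm i (Finset.mem_insert_self _ _)).mul
      (ih fun j hj => hm j (Finset.mem_insert_of_mem hj))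

lemma _root_.GevreyKatoPonce.synth_comp_neg (φ : V → ℂ) (x : V) :
    synth (fun ξ => φ (-ξ)) x = synth φ (-x) := by
  simp only [synth]
  rw [← integral_neg_eq_self]
  simp [wave]

lemma _root_.GevreyKatoPonce.recipNorm_comp_neg (H : V → ℝ≥0∞) :
    recipNorm θ (fun x => H (-x)) = recipNorm θ H := by
  unfold recipNorm
  rw [lintegral_neg_eq_self (fun x => H x ^ (1 / θ))]

lemma comp_neg (hm : IsMultiplier θ C m) : IsMultiplier θ C fun ξ => m (-ξ) := by
  refine ⟨⟨hm.1.1.comp measurable_neg, fun R => ?_⟩, fun φ hφ => ?_⟩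
  · obtain ⟨A, hA⟩ := hm.1.2 R
    exact ⟨A, fun ξ hξ => hA (-ξ) (by rwa [norm_neg])⟩
  · have hφ' : Nice fun ξ => φ (-ξ) := by
      obtain ⟨hi, R, hR⟩ := hφ
      exact ⟨hi.comp_neg, R, fun ξ hξ => hR _ (by rwa [norm_neg])⟩
    have h := hm.2 _ hφ'
    have e : ∀ x, synth (fun ξ => m ξ * φ (-ξ)) x =
        synth (fun ξ => m (-ξ) * φ ξ) (-x) := fun x => by
      rw [← synth_comp_neg]; simp
    simp only [e, synth_comp_neg] at h
    rwa [recipNorm_comp_neg (fun x => ‖synth (fun ξ => m (-ξ) * φ ξ) x‖ₑ),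
      recipNorm_comp_neg (fun x => ‖synth φ x‖ₑ)] at h

lemma of_tendsto (hθ : 0 < θ) {m : ℕ → V → ℂ} {n : V → ℂ} (hm : ∀ k, IsMultiplier θ C (m k))
    {M : ℝ} (hM : ∀ k ξ, ‖m k ξ‖ ≤ M) (hlim : ∀ ξ, Tendsto (fun k => m k ξ) atTop (𝓝 (n ξ))) :
    IsMultiplier θ C n := by
  have hn : Measurable n := measurable_of_tendsto_metrizable (fun k => (hm k).1.1)
    (tendsto_pi_nhds.2 hlim)
  refine ⟨LocBdd.of_norm_le hn M fun ξ => le_of_tendsto' (hlim ξ).norm fun k => hM k ξ,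
    fun φ hφ => ?_⟩
  refine recipNorm_le_of_tendsto hθ (f := fun k => synth fun ξ => m k ξ * φ ξ)
    (fun k => (continuous_synth (hφ.mul (hm k).1).1).measurable) (fun x => ?_)
    fun k => (hm k).2 φ hφ
  refine tendsto_integral_of_dominated_convergence (fun ξ => M * ‖φ ξ‖)
    (fun k => (integrable_wave_mul (hφ.mul (hm k).1).1 x).aestronglyMeasurable)
    (hφ.1.norm.const_mul M) (fun k => Eventually.of_forall fun ξ => ?_)
    (Eventually.of_forall fun ξ => ((hlim ξ).mul_const _).const_mul _)
  rw [norm_mul, norm_mul, norm_wave, one_mul]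
  exact mul_le_mul_of_nonneg_right (hM k ξ) (norm_nonneg _)

end IsMultiplier

end Multiplier

/-- `e^{-bτ} 1_{τ ≥ 0}`. -/
noncomputable def expNonneg (b τ : ℝ) : ℂ := if 0 ≤ τ then (Real.exp (-(b * τ)) : ℂ) else 0

/-- `e^{bτ} 1_{τ < 0}`. -/
noncomputable def expNeg (b τ : ℝ) : ℂ := if τ < 0 then (Real.exp (b * τ) : ℂ) else 0

lemma exists_isMultiplier_expPos {θ : ℝ} (hθ0 : 0 < θ) (hθ1 : θ < 1) :
    ∃ C : ℝ≥0∞, C ≠ ∞ ∧ ∀ (d : ℕ) (i : Fin d) (b : ℝ), 0 ≤ b →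
      IsMultiplier θ C fun ξ : EuclideanSpace ℝ (Fin d) =>
        if 0 < ξ i then (Real.exp (-(b * ξ i)) : ℂ) else 0 := by
  obtain ⟨C, hC, H⟩ := exists_recipNorm_synth_halfSymbol_le hθ0 hθ1
  refine ⟨C, hC, fun d i b hb => ?_⟩
  have h1 : ∀ k : ℕ, 0 < b + 1 / ((k : ℝ) + 1) := fun k => by positivity
  have h2 : ∀ k : ℕ, 0 < (k : ℝ) + 1 := fun k => by positivity
  have hmul : ∀ k : ℕ, IsMultiplier θ C fun ξ : EuclideanSpace ℝ (Fin d) =>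
      halfSymbol (b + 1 / ((k : ℝ) + 1)) ((k : ℝ) + 1) (ξ i) := fun k => by
    have hc : Continuous fun ξ : EuclideanSpace ℝ (Fin d) => ξ i := by fun_prop
    exact ⟨((continuous_halfSymbol _ _).comp hc).locBdd, H d i _ _ (h1 k) (h2 k)⟩
  refine IsMultiplier.of_tendsto hθ0 (M := 2) hmul (fun k ξ => ?_) fun ξ => ?_
  · unfold halfSymbol
    split_ifs with h
    · rw [Complex.norm_real]
      refine (norm_sub_le _ _).trans ?_
      rw [Real.norm_of_nonneg (Real.exp_pos _).le, Real.norm_of_nonneg (Real.exp_pos _).le]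
      have e1 := Real.exp_le_one_iff.2 (neg_nonpos.2 (mul_nonneg (h1 k).le h.le))
      have e2 := Real.exp_le_one_iff.2 (neg_nonpos.2 (mul_nonneg (h2 k).le h.le))
      linarith
    · simp
  · unfold halfSymbol
    split_ifs with h
    · refine (Complex.continuous_ofReal.tendsto _).comp ?_
      have t1 : Tendsto (fun k : ℕ => Real.exp (-((b + 1 / ((k : ℝ) + 1)) * ξ i))) atTop
          (𝓝 (Real.exp (-((b + 0) * ξ i)))) :=
        (Real.continuous_exp.tendsto _).comp
          ((tendsto_one_div_add_atTop_nhds_zero_nat.const_add b).mul_const _).neg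
      have t2 : Tendsto (fun k : ℕ => Real.exp (-(((k : ℝ) + 1) * ξ i))) atTop (𝓝 0) := by
        refine Real.tendsto_exp_neg_atTop_nhds_zero.comp ?_
        exact (tendsto_atTop_add_const_right _ _ tendsto_natCast_atTop_atTop).atTop_mul_const h
      simpa using t1.sub t2
    · exact tendsto_const_nhds

lemma exists_isMultiplier_exp {θ : ℝ} (hθ0 : 0 < θ) (hθ1 : θ < 1) :
    ∃ C : ℝ≥0∞, C ≠ ∞ ∧ 1 ≤ C ∧ ∀ (d : ℕ) (i : Fin d) (b : ℝ), 0 ≤ b →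
      (IsMultiplier θ C fun ξ : EuclideanSpace ℝ (Fin d) => expNonneg b (ξ i)) ∧
      IsMultiplier θ C fun ξ : EuclideanSpace ℝ (Fin d) => expNeg b (ξ i) := by
  obtain ⟨C, hC, H⟩ := exists_isMultiplier_expPos hθ0 hθ1
  have hneg : ∀ (d : ℕ) (i : Fin d) (b : ℝ), 0 ≤ b →
      IsMultiplier θ C fun ξ : EuclideanSpace ℝ (Fin d) => expNeg b (ξ i) := fun d i b hb => by
    convert (H d i b hb).comp_neg using 2 with ξ
    simp [expNeg]
  refine ⟨C + (1 + C + C), by finiteness, ?_, fun d i b hb => ⟨?_, ?_⟩⟩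
  · rw [add_assoc]
    exact le_add_self.trans' le_self_add
  · convert (H d i b hb).add hθ0 hθ1.le
      ((IsMultiplier.one.sub hθ0 hθ1.le (H d i 0 le_rfl)).sub hθ0 hθ1.le (hneg d i 0 le_rfl))
      using 2 with ξ
    rcases lt_trichotomy (ξ i) 0 with h | h | h
    · simp [expNonneg, expNeg, h, h.not_ge, h.not_gt]
    · simp [expNonneg, expNeg, h]
    · simp [expNonneg, expNeg, h, h.le, h.not_gt]
  · exact (hneg d i b hb).mono le_self_add

/-! ### Synthesis of convolutions -/

section Convolution

variable {V : Type*} [NormedAddCommGroup V] [InnerProductSpace ℝ V] [FiniteDimensional ℝ V]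
  [MeasurableSpace V] [BorelSpace V]

/-- The convolution `∫ Φ(ξ) Ψ(ζ - ξ) dξ`. -/
noncomputable def conv (Φ Ψ : V → ℂ) (ζ : V) : ℂ := ∫ ξ, Φ ξ * Ψ (ζ - ξ)

lemma integrable_conv_prod {Φ Ψ : V → ℂ} (hΦ : Integrable Φ) (hΨ : Integrable Ψ) :
    Integrable fun p : V × V => Φ p.2 * Ψ (p.1 - p.2) :=
  hΦ.convolution_integrand (ContinuousLinearMap.mul ℂ ℂ) hΨ

lemma Nice.conv {Φ Ψ : V → ℂ} (hΦ : Nice Φ) (hΨ : Nice Ψ) : Nice (conv Φ Ψ) := by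
  refine ⟨(integrable_conv_prod hΦ.1 hΨ.1).integral_prod_left, ?_⟩
  obtain ⟨-, R, hR⟩ := hΦ
  obtain ⟨-, S, hS⟩ := hΨ
  refine ⟨R + S, fun ζ hζ => integral_eq_zero_of_ae (Eventually.of_forall fun ξ => ?_)⟩
  rcases lt_or_ge R ‖ξ‖ with h | h
  · simp [hR ξ h]
  · have : S < ‖ζ - ξ‖ := by
      have := norm_sub_norm_le ζ ξ
      linarith
    simp [hS _ this]

lemma LocBdd.exists_bounded {m : V → ℂ} (hm : LocBdd m) (R : ℝ) :
    ∃ n : V → ℂ, Measurable n ∧ (∃ C : ℝ, ∀ ξ, ‖n ξ‖ ≤ C) ∧ ∀ ξ, ‖ξ‖ ≤ R → n ξ = m ξ := by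
  obtain ⟨C, hC⟩ := hm.2 R
  refine ⟨(Metric.closedBall 0 R).indicator m,
    hm.1.indicator Metric.isClosed_closedBall.measurableSet,
    ⟨max C 0, fun ξ => ?_⟩, fun ξ hξ => indicator_of_mem (by simpa using hξ) _⟩
  by_cases hξ : ξ ∈ Metric.closedBall (0 : V) R
  · rw [indicator_of_mem hξ]
    exact (hC ξ (by simpa using hξ)).trans (le_max_left _ _)
  · rw [indicator_of_notMem hξ, norm_zero]
    exact le_max_right _ _

lemma integrable_bisynth_add {m : V → ℂ} (hm : LocBdd m) {Φ Ψ : V → ℂ} (hΦ : Nice Φ)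
    (hΨ : Nice Ψ) (x : V) : Integrable fun p : V × V =>
      m (p.1 + p.2) * ((wave x p.1 * Φ p.1) * (wave x p.2 * Ψ p.2)) := by
  have hi := integrable_wave_mul_prod hΦ.1 hΨ.1 x
  obtain ⟨-, R, hR⟩ := hΦ
  obtain ⟨-, S, hS⟩ := hΨ
  obtain ⟨n, hn, ⟨C, hC⟩, he⟩ := hm.exists_bounded (R + S)
  refine (hi.bdd_mul (c := C) (f := fun p : V × V => n (p.1 + p.2))
    (hn.comp measurable_add).aestronglyMeasurable (Eventually.of_forall fun _ => hC _)).congr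
    (Eventually.of_forall fun p => ?_)
  rcases lt_or_ge R ‖p.1‖ with h | h
  · simp [hR _ h]
  rcases lt_or_ge S ‖p.2‖ with h' | h'
  · simp [hS _ h']
  · simp only [he _ ((norm_add_le _ _).trans (add_le_add h h'))]

lemma synth_mul_conv {m : V → ℂ} (hm : LocBdd m) {Φ Ψ : V → ℂ} (hΦ : Nice Φ) (hΨ : Nice Ψ)
    (x : V) : synth (fun ζ => m ζ * conv Φ Ψ ζ) x = bisynth (fun p => m (p.1 + p.2)) Φ Ψ x := by
  have hInt : Integrable (Function.uncurry fun ζ ξ : V =>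
      wave x ζ * (m ζ * (Φ ξ * Ψ (ζ - ξ)))) := by
    have hi := integrable_conv_prod hΦ.1 hΨ.1
    obtain ⟨-, R, hR⟩ := hΦ
    obtain ⟨-, S, hS⟩ := hΨ
    obtain ⟨n, hn, ⟨C, hC⟩, he⟩ := hm.exists_bounded (R + S)
    have hw : Measurable fun p : V × V => wave x p.1 * n p.1 :=
      (Continuous.measurable (by fun_prop)).mul (hn.comp measurable_fst)
    refine (hi.bdd_mul (c := C) hw.aestronglyMeasurable
      (Eventually.of_forall fun p => by rw [norm_mul, norm_wave, one_mul]; exact hC _)).congr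
      (Eventually.of_forall fun p => ?_)
    simp only [Function.uncurry]
    rcases lt_or_ge R ‖p.2‖ with h | h
    · simp [hR _ h]
    rcases lt_or_ge S ‖p.1 - p.2‖ with h' | h'
    · simp [hS _ h']
    · rw [he p.1 (by
        calc ‖p.1‖ = ‖p.2 + (p.1 - p.2)‖ := by rw [add_sub_cancel]
          _ ≤ _ := (norm_add_le _ _).trans (add_le_add h h')), mul_assoc]
  calc synth (fun ζ => m ζ * conv Φ Ψ ζ) x
      = ∫ ζ, ∫ ξ, wave x ζ * (m ζ * (Φ ξ * Ψ (ζ - ξ))) := by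
        simp only [synth, conv, integral_const_mul]
    _ = ∫ ξ, ∫ ζ, wave x ζ * (m ζ * (Φ ξ * Ψ (ζ - ξ))) := integral_integral_swap hInt
    _ = ∫ ξ, ∫ η, m (ξ + η) * ((wave x ξ * Φ ξ) * (wave x η * Ψ η)) := by
        refine integral_congr_ae (Eventually.of_forall fun ξ => ?_)
        simp only []
        rw [← integral_add_left_eq_self _ ξ]
        refine integral_congr_ae (Eventually.of_forall fun η => ?_)
        simp only [add_sub_cancel_left, wave_add_right]
        ring
    _ = _ := (integral_prod _ (integrable_bisynth_add hm hΦ hΨ x)).symm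

end Convolution

/-! ### Sign patterns of the exponential weight -/

section Patterns

/-- Factors in `x + y` of the decomposition of `e^{a(|x+y|-|x|-|y|)}` by signs. -/
noncomputable def patternOut : Fin 6 → ℝ → ℂ :=
  ![fun _ => 1, fun _ => 1, expNonneg 0, expNeg 0, expNonneg 0, expNeg 0]

/-- Factors in `x` of the decomposition of `e^{a(|x+y|-|x|-|y|)}` by signs. -/
noncomputable def patternLeft (a : ℝ) : Fin 6 → ℝ → ℂ :=
  ![expNonneg 0, expNeg 0, expNonneg 0, expNonneg (2 * a), expNeg (2 * a), expNeg 0]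

/-- Factors in `y` of the decomposition of `e^{a(|x+y|-|x|-|y|)}` by signs. -/
noncomputable def patternRight (a : ℝ) : Fin 6 → ℝ → ℂ :=
  ![expNonneg 0, expNeg 0, expNeg (2 * a), expNeg 0, expNonneg 0, expNonneg (2 * a)]

lemma ofReal_exp_abs_sub (a x y : ℝ) :
    ((Real.exp (a * (|x + y| - |x| - |y|)) : ℝ) : ℂ) =
      ∑ k : Fin 6, patternOut k (x + y) * (patternLeft a k x * patternRight a k y) := by
  rw [Fin.sum_univ_six]
  simp only [patternOut, patternLeft, patternRight, expNonneg, expNeg, Matrix.cons_val, zero_mul,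
    neg_zero, Real.exp_zero, Complex.ofReal_one]
  rcases le_or_gt 0 x with hx | hx <;> rcases le_or_gt 0 y with hy | hy <;>
    rcases le_or_gt 0 (x + y) with hz | hz
  · simp [hx, hy, hz, hx.not_gt, hy.not_gt, hz.not_gt, abs_of_nonneg]
  · linarith
  · simp only [hx, hy, hz, hx.not_gt, hy.not_ge, hz.not_gt, abs_of_nonneg, abs_of_neg, if_true,
      if_false, mul_zero, zero_mul, add_zero, zero_add, one_mul, mul_one]
    congr 2; ring
  · simp only [hx, hy, hz, hx.not_gt, hy.not_ge, hz.not_ge, abs_of_nonneg, abs_of_neg, if_true,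
      if_false, mul_zero, zero_mul, add_zero, zero_add, one_mul, mul_one]
    congr 2; ring
  · simp only [hx, hy, hz, hx.not_ge, hy.not_gt, hz.not_gt, abs_of_nonneg, abs_of_neg, if_true,
      if_false, mul_zero, zero_mul, add_zero, zero_add, one_mul, mul_one]
    congr 2; ring
  · simp only [hx, hy, hz, hx.not_ge, hy.not_gt, hz.not_ge, abs_of_nonneg, abs_of_neg, if_true,
      if_false, mul_zero, zero_mul, add_zero, zero_add, one_mul, mul_one]
    congr 2; ring
  · linarith
  · simp only [hx, hy, hz, hx.not_ge, hy.not_ge, hz.not_ge, abs_of_neg, if_true,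
      if_false, mul_zero, zero_mul, add_zero, zero_add, mul_one]
    rw [show a * (-(x + y) - -x - -y) = 0 by ring, Real.exp_zero, Complex.ofReal_one]

lemma isMultiplier_pattern {θ : ℝ} {C : ℝ≥0∞} (hC : 1 ≤ C) {d : ℕ}
    (H : ∀ (i : Fin d) (b : ℝ), 0 ≤ b →
      (IsMultiplier θ C fun ξ : EuclideanSpace ℝ (Fin d) => expNonneg b (ξ i)) ∧
      IsMultiplier θ C fun ξ : EuclideanSpace ℝ (Fin d) => expNeg b (ξ i))
    {a : ℝ} (ha : 0 ≤ a) (i : Fin d) (k : Fin 6) :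
    (IsMultiplier θ C fun ξ : EuclideanSpace ℝ (Fin d) => patternOut k (ξ i)) ∧
    (IsMultiplier θ C fun ξ : EuclideanSpace ℝ (Fin d) => patternLeft a k (ξ i)) ∧
    IsMultiplier θ C fun ξ : EuclideanSpace ℝ (Fin d) => patternRight a k (ξ i) := by
  have h0 := H i 0 le_rfl
  have h2 := H i (2 * a) (by positivity)
  have h1 := (IsMultiplier.one (V := EuclideanSpace ℝ (Fin d)) (θ := θ)).mono hC
  fin_cases k
  · exact ⟨h1, h0.1, h0.1⟩
  · exact ⟨h1, h0.2, h0.2⟩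
  · exact ⟨h0.1, h0.1, h2.2⟩
  · exact ⟨h0.2, h2.1, h0.2⟩
  · exact ⟨h0.1, h2.2, h0.1⟩
  · exact ⟨h0.2, h0.2, h2.1⟩

end Patterns

/-! ### The weighted bilinear estimate -/

section Assembly

lemma recipNorm_sum_le {X ι : Type*} [MeasureSpace X] {θ : ℝ} (hθ : 0 < θ) (hθ1 : θ ≤ 1)
    (s : Finset ι) {f : ι → X → ℂ} (hf : ∀ i ∈ s, Measurable (f i)) :
    recipNorm θ (fun x => ‖∑ i ∈ s, f i x‖ₑ) ≤ ∑ i ∈ s, recipNorm θ (fun x => ‖f i x‖ₑ) := by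
  classical
  induction s using Finset.induction_on with
  | empty => simp [recipNorm, hθ]
  | insert i s his ih =>
    simp only [Finset.sum_insert his]
    refine (recipNorm_mono hθ fun x => enorm_add_le _ _).trans ?_
    refine (recipNorm_add_le hθ hθ1 (hf i (Finset.mem_insert_self _ _)).enorm.aemeasurable
      (Finset.measurable_fun_sum s fun j hj =>
        hf j (Finset.mem_insert_of_mem hj)).enorm.aemeasurable).trans ?_
    exact add_le_add le_rfl (ih fun j hj => hf j (Finset.mem_insert_of_mem hj))

section General

variable {V : Type*} [NormedAddCommGroup V] [InnerProductSpace ℝ V] [FiniteDimensional ℝ V]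
  [MeasurableSpace V] [BorelSpace V]

lemma locBdd_norm_rpow {β : ℝ} (hβ : 0 ≤ β) : LocBdd fun ξ : V => ((‖ξ‖ ^ β : ℝ) : ℂ) :=
  Continuous.locBdd (Complex.continuous_ofReal.comp (continuous_norm.rpow_const fun _ => Or.inr hβ))

lemma recipNorm_synth_riesz_mul_le {θ β : ℝ} {D : ℝ≥0∞} {m : V → ℂ} (hm : IsMultiplier θ D m)
    (hβ : 0 ≤ β) {φ : V → ℂ} (hφ : Nice φ) :
    recipNorm θ (fun x => ‖synth (riesz β fun ξ => m ξ * φ ξ) x‖ₑ) ≤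
      D * recipNorm θ (fun x => ‖synth (riesz β φ) x‖ₑ) := by
  have e : (riesz β fun ξ => m ξ * φ ξ) = fun ξ => m ξ * riesz β φ ξ := by
    ext ξ; simp only [riesz]; ring
  rw [e]
  exact hm.2 _ (hφ.riesz hβ)

lemma katoPonce_mul_le {β θ₀ θ₁ τ₀ τ₁ : ℝ} {D : ℝ≥0∞} {m n : V → ℂ} (hβ : 0 ≤ β)
    (h₀ : IsMultiplier θ₀ D m) (h₁ : IsMultiplier θ₁ D m) (k₀ : IsMultiplier τ₀ D n)
    (k₁ : IsMultiplier τ₁ D n) {φ ψ : V → ℂ} (hφ : Nice φ) (hψ : Nice ψ) :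
    katoPonce β θ₀ θ₁ τ₀ τ₁ (fun ξ => m ξ * φ ξ) (fun ξ => n ξ * ψ ξ) ≤
      D * D * katoPonce β θ₀ θ₁ τ₀ τ₁ φ ψ := by
  unfold katoPonce
  rw [mul_add]
  refine add_le_add ?_ ?_
  · exact (mul_le_mul' (recipNorm_synth_riesz_mul_le h₁ hβ hφ) (k₀.2 ψ hψ)).trans_eq (by ring)
  · exact (mul_le_mul' (h₀.2 φ hφ) (recipNorm_synth_riesz_mul_le k₁ hβ hψ)).trans_eq (by ring)

lemma recipNorm_bisynth_isMultiplier_le {θ : ℝ} {D : ℝ≥0∞} {m n : V → ℂ} (hm : IsMultiplier θ D m)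
    (hn : LocBdd n) {Φ Ψ : V → ℂ} (hΦ : Nice Φ) (hΨ : Nice Ψ) :
    recipNorm θ (fun x => ‖bisynth (fun p => m (p.1 + p.2) * n (p.1 + p.2)) Φ Ψ x‖ₑ) ≤
      D * recipNorm θ (fun x => ‖bisynth (fun p => n (p.1 + p.2)) Φ Ψ x‖ₑ) := by
  simp only [← synth_mul_conv hn hΦ hΨ, ← synth_mul_conv (hm.1.mul hn) hΦ hΨ, mul_assoc]
  exact hm.2 _ ((hΦ.conv hΨ).mul hn)

lemma measurable_bisynth_add {m : V → ℂ} (hm : LocBdd m) {Φ Ψ : V → ℂ} (hΦ : Nice Φ)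
    (hΨ : Nice Ψ) : Measurable (bisynth (fun p => m (p.1 + p.2)) Φ Ψ) := by
  have e : bisynth (fun p => m (p.1 + p.2)) Φ Ψ = synth (fun ζ => m ζ * conv Φ Ψ ζ) :=
    funext fun x => (synth_mul_conv hm hΦ hΨ x).symm
  rw [e]
  exact (continuous_synth ((hΦ.conv hΨ).mul hm).1).measurable

end General

/-- The weight `e^{a‖ξ‖₁}`. -/
noncomputable def expWeight {d : ℕ} (a : ℝ) (ξ : EuclideanSpace ℝ (Fin d)) : ℝ :=
  Real.exp (a * ∑ i, |ξ i|)

lemma continuous_expWeight {d : ℕ} (a : ℝ) :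
    Continuous (expWeight a : EuclideanSpace ℝ (Fin d) → ℝ) := by
  unfold expWeight
  fun_prop

lemma expWeight_add_div {d : ℕ} (a : ℝ) (ξ η : EuclideanSpace ℝ (Fin d)) :
    ((expWeight a (ξ + η) / (expWeight a ξ * expWeight a η) : ℝ) : ℂ) =
      ∑ σ : Fin d → Fin 6, (∏ i, patternOut (σ i) ((ξ + η) i)) *
        ((∏ i, patternLeft a (σ i) (ξ i)) * ∏ i, patternRight a (σ i) (η i)) := by
  have e : expWeight a (ξ + η) / (expWeight a ξ * expWeight a η) =
      ∏ i, Real.exp (a * (|ξ i + η i| - |ξ i| - |η i|)) := by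
    rw [expWeight, expWeight, expWeight, ← Real.exp_add, ← Real.exp_sub, ← Real.exp_sum]
    simp only [Finset.mul_sum, mul_sub, Finset.sum_sub_distrib, PiLp.add_apply]
    congr 1; ring
  rw [e, Complex.ofReal_prod]
  simp only [ofReal_exp_abs_sub, ← Finset.prod_mul_distrib, PiLp.add_apply]
  rw [Finset.prod_univ_sum, Fintype.piFinset_univ]

theorem exists_recipNorm_bisynth_expWeight_le {d : ℕ} (hd : 1 ≤ d) {β θ θ₀ θ₁ τ₀ τ₁ : ℝ}
    (hβ : 0 ≤ β) (hθ1 : θ < 1) (h₀ : 0 < θ₀) (h₁ : 0 < θ₁) (k₀ : 0 < τ₀) (k₁ : 0 < τ₁)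
    (e₁ : θ₁ + τ₀ = θ) (e₂ : θ₀ + τ₁ = θ) :
    ∃ C : ℝ≥0∞, C ≠ ∞ ∧ ∀ a : ℝ, 0 ≤ a → ∀ φ ψ : EuclideanSpace ℝ (Fin d) → ℂ,
      Nice φ → Nice ψ →
      recipNorm θ (fun x => ‖bisynth (fun p => ((expWeight a (p.1 + p.2) /
        (expWeight a p.1 * expWeight a p.2) * ‖p.1 + p.2‖ ^ β : ℝ) : ℂ)) φ ψ x‖ₑ) ≤
          C * katoPonce β θ₀ θ₁ τ₀ τ₁ φ ψ := by
  have : Nonempty (Fin d) := ⟨⟨0, hd⟩⟩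
  have hθ : 0 < θ := by linarith
  obtain ⟨K, hK, HK⟩ := exists_recipNorm_bisynth_le (EuclideanSpace ℝ (Fin d)) hβ hθ1 h₀ h₁ k₀ k₁
    e₁ e₂
  obtain ⟨A, hA, hA1, HA⟩ := exists_isMultiplier_exp hθ hθ1
  obtain ⟨A₀, hA₀, hA1₀, HA₀⟩ := exists_isMultiplier_exp h₀ (by linarith : θ₀ < 1)
  obtain ⟨A₁, hA₁, hA1₁, HA₁⟩ := exists_isMultiplier_exp h₁ (by linarith : θ₁ < 1)
  obtain ⟨B₀, hB₀, hB1₀, HB₀⟩ := exists_isMultiplier_exp k₀ (by linarith : τ₀ < 1)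
  obtain ⟨B₁, hB₁, hB1₁, HB₁⟩ := exists_isMultiplier_exp k₁ (by linarith : τ₁ < 1)
  set D : ℝ≥0∞ := A + A₀ + A₁ + B₀ + B₁ with hD
  have hDA : A ≤ D := by rw [hD]; simp only [add_assoc]; exact le_self_add
  have hDA₀ : A₀ ≤ D := by rw [hD]; exact le_add_right (le_add_right (le_add_right le_add_self))
  have hDA₁ : A₁ ≤ D := by rw [hD]; exact le_add_right (le_add_right le_add_self)
  have hDB₀ : B₀ ≤ D := by rw [hD]; exact le_add_right le_add_self
  have hDB₁ : B₁ ≤ D := by rw [hD]; exact le_add_self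
  have hprod : ∀ {τ : ℝ} {M : ℝ≥0∞} {m : Fin d → EuclideanSpace ℝ (Fin d) → ℂ}, M ≤ D →
      (∀ i, IsMultiplier τ M (m i)) → IsMultiplier τ (D ^ d) fun ξ => ∏ i, m i ξ := by
    intro τ M m hM hm
    simpa using IsMultiplier.prod Finset.univ fun i _ => (hm i).mono hM
  have hDt : D ≠ ∞ := by finiteness
  refine ⟨∑ _σ : Fin d → Fin 6, D ^ d * (K * (D ^ d * D ^ d)),
    ENNReal.sum_ne_top.2 fun _ _ => by finiteness,
    fun a ha φ ψ hφ hψ => ?_⟩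
  set O : (Fin d → Fin 6) → EuclideanSpace ℝ (Fin d) → ℂ :=
    fun σ ξ => ∏ i, patternOut (σ i) (ξ i) with hO
  set L : (Fin d → Fin 6) → EuclideanSpace ℝ (Fin d) → ℂ :=
    fun σ ξ => ∏ i, patternLeft a (σ i) (ξ i) with hL
  set R : (Fin d → Fin 6) → EuclideanSpace ℝ (Fin d) → ℂ :=
    fun σ ξ => ∏ i, patternRight a (σ i) (ξ i) with hR
  have hOm : ∀ σ, IsMultiplier θ (D ^ d) (O σ) := fun σ =>
    hprod hDA fun i => (isMultiplier_pattern hA1 (HA d) ha i (σ i)).1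
  have hL₀ : ∀ σ, IsMultiplier θ₀ (D ^ d) (L σ) := fun σ =>
    hprod hDA₀ fun i => (isMultiplier_pattern hA1₀ (HA₀ d) ha i (σ i)).2.1
  have hL₁ : ∀ σ, IsMultiplier θ₁ (D ^ d) (L σ) := fun σ =>
    hprod hDA₁ fun i => (isMultiplier_pattern hA1₁ (HA₁ d) ha i (σ i)).2.1
  have hR₀ : ∀ σ, IsMultiplier τ₀ (D ^ d) (R σ) := fun σ =>
    hprod hDB₀ fun i => (isMultiplier_pattern hB1₀ (HB₀ d) ha i (σ i)).2.2
  have hR₁ : ∀ σ, IsMultiplier τ₁ (D ^ d) (R σ) := fun σ =>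
    hprod hDB₁ fun i => (isMultiplier_pattern hB1₁ (HB₁ d) ha i (σ i)).2.2
  have hn := locBdd_norm_rpow (V := EuclideanSpace ℝ (Fin d)) hβ
  have hLφ : ∀ σ, Nice fun ξ => L σ ξ * φ ξ := fun σ => hφ.mul (hL₀ σ).1
  have hRψ : ∀ σ, Nice fun ξ => R σ ξ * ψ ξ := fun σ => hψ.mul (hR₀ σ).1
  have hsum : ∀ x, bisynth (fun p => ((expWeight a (p.1 + p.2) /
        (expWeight a p.1 * expWeight a p.2) * ‖p.1 + p.2‖ ^ β : ℝ) : ℂ)) φ ψ x =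
      ∑ σ, bisynth (fun p => O σ (p.1 + p.2) * ((‖p.1 + p.2‖ ^ β : ℝ) : ℂ))
        (fun ξ => L σ ξ * φ ξ) (fun ξ => R σ ξ * ψ ξ) x := fun x => by
    simp only [bisynth]
    rw [← integral_finsetSum _ fun σ _ =>
      integrable_bisynth_add ((hOm σ).1.mul hn) (hLφ σ) (hRψ σ) x]
    refine integral_congr_ae (Eventually.of_forall fun p => ?_)
    simp only []
    rw [Complex.ofReal_mul, expWeight_add_div, Finset.sum_mul, Finset.sum_mul]
    refine Finset.sum_congr rfl fun σ _ => ?_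
    simp only [hO, hL, hR]
    ring
  simp only [hsum]
  refine (recipNorm_sum_le hθ hθ1.le _ fun σ _ =>
    measurable_bisynth_add ((hOm σ).1.mul hn) (hLφ σ) (hRψ σ)).trans ?_
  rw [Finset.sum_mul]
  refine Finset.sum_le_sum fun σ _ => ?_
  refine (recipNorm_bisynth_isMultiplier_le (hOm σ) hn (hLφ σ) (hRψ σ)).trans ?_
  rw [mul_assoc, mul_assoc K]
  exact mul_le_mul' le_rfl ((HK _ _ (hLφ σ) (hRψ σ)).trans (mul_le_mul' le_rfl
    (katoPonce_mul_le hβ (hL₀ σ) (hL₁ σ) (hR₀ σ) (hR₁ σ) hφ hψ)))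

lemma nice_of_hasCompactSupport {d : ℕ} {F : EuclideanSpace ℝ (Fin d) → ℂ} (hF : Continuous F)
    (hc : HasCompactSupport F) : Nice F := by
  refine ⟨hF.integrable_of_hasCompactSupport hc, ?_⟩
  obtain ⟨R, hR⟩ := hc.isCompact.isBounded.exists_norm_le
  exact ⟨R, fun ξ hξ => by_contra fun h => (hR ξ (subset_tsupport F h)).not_gt hξ⟩

lemma fourier_mul_eq_conv {d : ℕ} (f g : SchwartzMap (EuclideanSpace ℝ (Fin d)) ℂ) :
    𝓕 (fun x => f x * g x) = conv (𝓕 ⇑f) (𝓕 ⇑g) := by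
  set K := SchwartzMap.convolution (ContinuousLinearMap.mul ℂ ℂ) (𝓕 f) (𝓕 g) with hK
  have hdouble : ∀ (h : SchwartzMap (EuclideanSpace ℝ (Fin d)) ℂ) x, 𝓕 (𝓕 h) (-x) = h x := by
    intro h x
    have : 𝓕⁻ (𝓕 h) x = h x := by rw [FourierTransform.fourierInv_fourier_eq]
    rw [← this, SchwartzMap.fourierInv_coe, Real.fourierInv_eq_fourier_neg, SchwartzMap.fourier_coe]
  have hfg : (fun x => f x * g x) = ⇑(𝓕⁻ K : SchwartzMap (EuclideanSpace ℝ (Fin d)) ℂ) := by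
    ext x
    rw [SchwartzMap.fourierInv_coe, Real.fourierInv_eq_fourier_neg, ← SchwartzMap.fourier_coe, hK,
      SchwartzMap.fourier_convolution, SchwartzMap.pairing_apply_apply, hdouble, hdouble]
    rfl
  rw [hfg, ← SchwartzMap.fourier_coe, FourierTransform.fourier_fourierInv_eq]
  ext ζ
  rw [hK, SchwartzMap.convolution_apply]
  rfl

end Assembly

/-! ### The operators `gev` -/

section Gevrey

variable {d : ℕ}

lemma gev_eq_synth (a β : ℝ) (h : EuclideanSpace ℝ (Fin d) → ℂ) :
    gev d a β h = synth (riesz β fun ξ => (expWeight a ξ : ℂ) * 𝓕 h ξ) := by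
  ext x
  refine integral_congr_ae (Filter.Eventually.of_forall fun ξ => ?_)
  simp only [riesz, wave, expWeight, Complex.ofReal_mul]
  ring

lemma eLpNorm_gev_eq {p : ℝ≥0∞} (hp : 0 < p) (hp' : p < ⊤) (a β : ℝ)
    (h : EuclideanSpace ℝ (Fin d) → ℂ) : eLpNorm (gev d a β h) p volume =
      recipNorm (1 / p.toReal)
        (fun x => ‖synth (riesz β fun ξ => (expWeight a ξ : ℂ) * 𝓕 h ξ) x‖ₑ) := by
  rw [eLpNorm_eq_recipNorm hp hp', gev_eq_synth]

lemma gev_mul_eq_bisynth {a β : ℝ} (hβ : 0 ≤ β) {f g : SchwartzMap (EuclideanSpace ℝ (Fin d)) ℂ}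
    (hf : Nice (𝓕 ⇑f)) (hg : Nice (𝓕 ⇑g)) (x : EuclideanSpace ℝ (Fin d)) :
    gev d a β (fun x => f x * g x) x =
      bisynth (fun p => ((expWeight a (p.1 + p.2) /
        (expWeight a p.1 * expWeight a p.2) * ‖p.1 + p.2‖ ^ β : ℝ) : ℂ))
        (fun ξ => (expWeight a ξ : ℂ) * 𝓕 ⇑f ξ) (fun ξ => (expWeight a ξ : ℂ) * 𝓕 ⇑g ξ) x := by
  have hw : LocBdd fun ξ : EuclideanSpace ℝ (Fin d) => (expWeight a ξ : ℂ) :=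
    (Complex.continuous_ofReal.comp (continuous_expWeight a)).locBdd
  have e := synth_mul_conv ((locBdd_norm_rpow hβ).mul hw) hf hg x
  rw [gev_eq_synth, fourier_mul_eq_conv]
  simp only [mul_assoc] at e
  refine e.trans (integral_congr_ae (Filter.Eventually.of_forall fun p => ?_))
  have h₁ : (expWeight a p.1 : ℂ) ≠ 0 := Complex.ofReal_ne_zero.2 (Real.exp_ne_zero _)
  have h₂ : (expWeight a p.2 : ℂ) ≠ 0 := Complex.ofReal_ne_zero.2 (Real.exp_ne_zero _)
  push_cast
  field_simp

end Gevrey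

end GevreyKatoPonce

/-- Lemma 2.6, Kato–Ponce inequality in Gevrey classes: for `β ≥ 0` and
exponents in `(1,∞)` with `1/p = 1/p₁ + 1/q₁ = 1/p₂ + 1/q₂`, there is `C` independent of
`a ≥ 0` such that for all Schwartz `f, g` with compactly supported Fourier transforms:
`‖G_{a,β}(fg)‖_{L^p} ≤ C (‖G_{a,β}f‖_{L^{p₁}} ‖G_{a,0}g‖_{L^{q₁}}
 + ‖G_{a,0}f‖_{L^{p₂}} ‖G_{a,β}g‖_{L^{q₂}})`. -/
theorem stmt10 (d : ℕ) (hd : 1 ≤ d) (β : ℝ) (hβ : 0 ≤ β)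
    (p p₁ q₁ p₂ q₂ : ℝ≥0∞)
    (hp : 1 < p) (hp' : p < ⊤) (hp₁ : 1 < p₁) (hp₁' : p₁ < ⊤)
    (hq₁ : 1 < q₁) (hq₁' : q₁ < ⊤) (hp₂ : 1 < p₂) (hp₂' : p₂ < ⊤)
    (hq₂ : 1 < q₂) (hq₂' : q₂ < ⊤)
    (h1 : 1 / p = 1 / p₁ + 1 / q₁) (h2 : 1 / p = 1 / p₂ + 1 / q₂) :
    ∃ C : ℝ, 0 < C ∧
      ∀ a : ℝ, 0 ≤ a →
        ∀ f g : SchwartzMap (EuclideanSpace ℝ (Fin d)) ℂ,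
          HasCompactSupport (𝓕 ⇑f) → HasCompactSupport (𝓕 ⇑g) →
          eLpNorm (gev d a β fun x => f x * g x) p volume ≤
            ENNReal.ofReal C *
              (eLpNorm (gev d a β ⇑f) p₁ volume * eLpNorm (gev d a 0 ⇑g) q₁ volume +
                eLpNorm (gev d a 0 ⇑f) p₂ volume * eLpNorm (gev d a β ⇑g) q₂ volume) := by
  have hinv : ∀ {r : ℝ≥0∞}, 1 < r → r < ⊤ → 0 < 1 / r.toReal := fun hr hr' =>
    one_div_pos.2 (ENNReal.toReal_pos (zero_lt_one.trans hr).ne' hr'.ne)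
  have hadd : ∀ {r s : ℝ≥0∞}, 1 < r → 1 < s → 1 / p = 1 / r + 1 / s →
      1 / r.toReal + 1 / s.toReal = 1 / p.toReal := by
    intro r s hr hs h
    have := congrArg ENNReal.toReal h
    rw [ENNReal.toReal_add (by simpa using (zero_lt_one.trans hr).ne')
      (by simpa using (zero_lt_one.trans hs).ne')] at this
    simpa using this.symm
  have hθ1 : 1 / p.toReal < 1 := by
    have : 1 < p.toReal := by simpa using (ENNReal.toReal_lt_toReal ENNReal.one_ne_top hp'.ne).2 hp
    exact (div_lt_one (by linarith)).2 this
  obtain ⟨C, hC, H⟩ := GevreyKatoPonce.exists_recipNorm_bisynth_expWeight_le hd hβ hθ1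
    (hinv hp₂ hp₂') (hinv hp₁ hp₁') (hinv hq₁ hq₁') (hinv hq₂ hq₂') (hadd hp₁ hq₁ h1)
    (hadd hp₂ hq₂ h2)
  refine ⟨C.toReal + 1, by positivity, fun a ha f g hf hg => ?_⟩
  have hC' : C ≤ ENNReal.ofReal (C.toReal + 1) := by
    conv_lhs => rw [← ENNReal.ofReal_toReal hC]
    exact ENNReal.ofReal_le_ofReal (by linarith)
  have hw : Continuous fun ξ : EuclideanSpace ℝ (Fin d) => (GevreyKatoPonce.expWeight a ξ : ℂ) :=
    Complex.continuous_ofReal.comp (GevreyKatoPonce.continuous_expWeight a)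
  have hF : Continuous (𝓕 ⇑f) := (𝓕 f).continuous
  have hG : Continuous (𝓕 ⇑g) := (𝓕 g).continuous
  have hnF := GevreyKatoPonce.nice_of_hasCompactSupport hF hf
  have hnG := GevreyKatoPonce.nice_of_hasCompactSupport hG hg
  have key := H a ha _ _ (hnF.mul hw.locBdd) (hnG.mul hw.locBdd)
  simp only [← GevreyKatoPonce.gev_mul_eq_bisynth hβ hnF hnG] at key
  have pos : ∀ {r : ℝ≥0∞}, 1 < r → 0 < r := fun h => zero_lt_one.trans h
  rw [GevreyKatoPonce.eLpNorm_eq_recipNorm (pos hp) hp']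
  refine key.trans (mul_le_mul' hC' (le_of_eq ?_))
  simp only [GevreyKatoPonce.katoPonce, GevreyKatoPonce.eLpNorm_gev_eq (pos hp₁) hp₁',
    GevreyKatoPonce.eLpNorm_gev_eq (pos hp₂) hp₂', GevreyKatoPonce.eLpNorm_gev_eq (pos hq₁) hq₁',
    GevreyKatoPonce.eLpNorm_gev_eq (pos hq₂) hq₂', GevreyKatoPonce.riesz_zero]
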